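/- arXiv:1209.1601 — 4 statements merged into one kernel-verified Lean document; each statement's English description precedes it below -/
import Mathlib

section
/- (Kopell's Lemma) Let a < b be real numbers and let f and g be commuting orientation-preserving diffeomorphisms of [a,b], with f of class C² and g of class C¹. If f has no fixed point in the open interval (a,b) and g has at least one fixed point in (a,b), then g = id. -/
set_option autoImplicit false

open Set

/-- `f : ℝ → ℝ` represents (a `C^r` extension of) an orientation-preserving `C^r`
diffeomorphism of the interval `[a,b]`. -/
def CrDiffeoOn (r : ℕ∞) (f : ℝ → ℝ) (a b : ℝ) : Prop :=
  ContDiff ℝ r f ∧ f a = a ∧ f b = b ∧ (∀ x ∈ Icc a b, 0 < deriv f x) ∧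
    MapsTo f (Icc a b) (Icc a b)

/-- Iterates of a monotone continuous self-map of an interval converge to a fixed point. -/
lemma kop_conv (h : ℝ → ℝ) (hc : Continuous h) (c e : ℝ) (hm : MonotoneOn h (Icc c e))
    (hM : MapsTo h (Icc c e) (Icc c e)) (x : ℝ) (hx : x ∈ Icc c e) :
    ∃ d ∈ Icc c e, h d = d ∧ Filter.Tendsto (fun k => h^[k] x) Filter.atTop (nhds d) := by
  have hmem : ∀ k, h^[k] x ∈ Icc c e := fun k => hM.iterate k hx
  suffices hs : ∃ d, Filter.Tendsto (fun k => h^[k] x) Filter.atTop (nhds d) by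
    obtain ⟨d, hd⟩ := hs
    refine ⟨d, isClosed_Icc.mem_of_tendsto hd (Filter.Eventually.of_forall hmem), ?_, hd⟩
    exact isFixedPt_of_tendsto_iterate hd hc.continuousAt
  rcases le_total x (h x) with h1 | h1
  · have hmono : Monotone (fun k => h^[k] x) := by
      apply monotone_nat_of_le_succ
      intro k
      induction k with
      | zero => simpa using h1
      | succ k ih =>
        have := hm (hmem k) (hmem (k+1)) ih
        simpa only [Function.iterate_succ_apply'] using this
    exact ⟨_, tendsto_atTop_ciSup hmono ⟨e, by rintro _ ⟨k, rfl⟩; exact (hmem k).2⟩⟩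
  · have hmono : Antitone (fun k => h^[k] x) := by
      apply antitone_nat_of_succ_le
      intro k
      induction k with
      | zero => simpa using h1
      | succ k ih =>
        have := hm (hmem (k+1)) (hmem k) ih
        simpa only [Function.iterate_succ_apply'] using this
    exact ⟨_, tendsto_atTop_ciInf hmono ⟨c, by rintro _ ⟨k, rfl⟩; exact (hmem k).1⟩⟩

/-- Mean value theorem in absolute value form. -/
lemma kop_mvt (f : ℝ → ℝ) (hf : Differentiable ℝ f) (c e x y : ℝ)
    (hpos : ∀ z ∈ Icc c e, 0 < deriv f z) (hx : x ∈ Icc c e) (hy : y ∈ Icc c e) :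
    ∃ z ∈ Icc c e, |f x - f y| = deriv f z * |x - y| := by
  rcases lt_trichotomy x y with h | h | h
  · obtain ⟨z, hz, h2⟩ := exists_deriv_eq_slope f h hf.continuous.continuousOn hf.differentiableOn
    have hz' : z ∈ Icc c e := ⟨hx.1.trans hz.1.le, hz.2.le.trans hy.2⟩
    refine ⟨z, hz', ?_⟩
    have : f x - f y = deriv f z * (x - y) := by
      rw [h2]; have : y - x ≠ 0 := by linarith
      field_simp; ring
    rw [this, abs_mul, abs_of_pos (hpos z hz')]
  · subst h; exact ⟨x, hx, by simp⟩
  · obtain ⟨z, hz, h2⟩ := exists_deriv_eq_slope f h hf.continuous.continuousOn hf.differentiableOn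
    have hz' : z ∈ Icc c e := ⟨hy.1.trans hz.1.le, hz.2.le.trans hx.2⟩
    refine ⟨z, hz', ?_⟩
    have : f x - f y = deriv f z * (x - y) := by
      rw [h2]; have : x - y ≠ 0 := by linarith
      field_simp
    rw [this, abs_mul, abs_of_pos (hpos z hz')]

/-- The derivative of a `C²` diffeomorphism is log-Lipschitz. -/
lemma kop_log (a b : ℝ) (hab : a < b) (f : ℝ → ℝ) (hf : ContDiff ℝ 2 f)
    (hpos : ∀ x ∈ Icc a b, 0 < deriv f x) :
    ∃ C : ℝ, 0 ≤ C ∧ ∀ x ∈ Icc a b, ∀ y ∈ Icc a b,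
      deriv f x ≤ Real.exp (C * |x - y|) * deriv f y := by
  have h1 : ContDiff ℝ 1 (deriv f) := by
    have : ContDiff ℝ (1 + 1) f := by simpa [one_add_one_eq_two] using hf
    exact (contDiff_succ_iff_deriv.1 this).2.2
  have hne : (Icc a b).Nonempty := ⟨a, left_mem_Icc.2 hab.le⟩
  obtain ⟨m, hm, hmin⟩ := isCompact_Icc.exists_isMinOn hne h1.continuous.continuousOn
  obtain ⟨L, hL⟩ := isCompact_Icc.exists_bound_of_continuousOn (s := Icc a b)
    (h1.continuous_deriv le_rfl).continuousOn
  have hL0 : 0 ≤ L := (norm_nonneg _).trans (hL a (left_mem_Icc.2 hab.le))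
  have hm0 := hpos m hm
  refine ⟨L / deriv f m, by positivity, fun x hx y hy => ?_⟩
  have h2 := (convex_Icc a b).norm_image_sub_le_of_norm_deriv_le
    (fun z _ => (h1.differentiable one_ne_zero) z) hL hy hx
  simp only [Real.norm_eq_abs] at h2
  have h3 := (le_abs_self _).trans h2
  have h4 : deriv f m ≤ deriv f y := hmin hy
  have h5 := Real.add_one_le_exp (L / deriv f m * |x - y|)
  have h6 : L * |x - y| ≤ L / deriv f m * |x - y| * deriv f y := by
    have : L * |x - y| = L / deriv f m * |x - y| * deriv f m := by field_simp
    rw [this]; gcongr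
  nlinarith [mul_le_mul_of_nonneg_right h5 (hpos y hy).le]

/-- The case `f x < x`. -/
lemma kop_core (a b : ℝ) (hab : a < b) (f g : ℝ → ℝ)
    (hf : CrDiffeoOn 2 f a b) (hg : CrDiffeoOn 1 g a b)
    (hcomm : ∀ x ∈ Icc a b, f (g x) = g (f x))
    (hffix : ∀ x ∈ Ioo a b, f x < x)
    (hgfix : ∃ x ∈ Ioo a b, g x = x) :
    ∀ x ∈ Icc a b, g x = x := by
  obtain ⟨p₀, hp₀, hgp₀⟩ := hgfix
  obtain ⟨hfC, hfa, hfb, hfd, hfM⟩ := hf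
  obtain ⟨hgC, hga, hgb, hgd, hgM⟩ := hg
  have hfC' : ContDiff ℝ 2 f := hfC
  have hgC' : ContDiff ℝ 1 g := hgC
  have hfdiff : Differentiable ℝ f := hfC'.differentiable two_ne_zero
  have hgdiff : Differentiable ℝ g := hgC'.differentiable one_ne_zero
  have hfsm : StrictMonoOn f (Icc a b) := strictMonoOn_of_deriv_pos (convex_Icc a b)
    hfdiff.continuous.continuousOn (fun x hx => hfd x (interior_subset hx))
  have hgsm : StrictMonoOn g (Icc a b) := strictMonoOn_of_deriv_pos (convex_Icc a b)
    hgdiff.continuous.continuousOn (fun x hx => hgd x (interior_subset hx))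
  have hsub : ∀ {x}, x ∈ Ioo a b → x ∈ Icc a b := fun h => Ioo_subset_Icc_self h
  have haI : a ∈ Icc a b := left_mem_Icc.2 hab.le
  have hfIoo : MapsTo f (Ioo a b) (Ioo a b) := fun x hx =>
    ⟨by simpa [hfa] using hfsm haI (hsub hx) hx.1, (hffix x hx).trans hx.2⟩
  have hfitI : ∀ n x, x ∈ Ioo a b → f^[n] x ∈ Ioo a b := fun n x hx => hfIoo.iterate n hx
  have hfitC : ∀ n x, x ∈ Icc a b → f^[n] x ∈ Icc a b := fun n x hx => hfM.iterate n hx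
  have hgitC : ∀ n x, x ∈ Icc a b → g^[n] x ∈ Icc a b := fun n x hx => hgM.iterate n hx
  have hfitm : ∀ n, StrictMonoOn (f^[n]) (Icc a b) := by
    intro n
    induction n with
    | zero => exact fun x _ y _ h => h
    | succ n ih =>
      intro x hx y hy h
      rw [Function.iterate_succ_apply', Function.iterate_succ_apply']
      exact hfsm (hfitC n x hx) (hfitC n y hy) (ih hx hy h)
  -- convergence to a
  have hlim : ∀ x ∈ Ioo a b, Filter.Tendsto (fun n => f^[n] x) Filter.atTop (nhds a) := by
    intro x hx
    have hss : Icc a x ⊆ Icc a b := Icc_subset_Icc_right hx.2.le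
    obtain ⟨d, hd, hfix, ht⟩ := kop_conv f hfdiff.continuous a x (hfsm.monotoneOn.mono hss)
      (fun y hy => ⟨(hfM (hss hy)).1,
        (hfsm.monotoneOn (hss hy) (hsub hx) hy.2).trans (hffix x hx).le⟩) x ⟨hx.1.le, le_rfl⟩
    rcases hd.1.eq_or_lt with h | h
    · rwa [h]
    · exact absurd hfix (hffix d ⟨h, hd.2.trans_lt hx.2⟩).ne
  -- commutation
  have hc1 : ∀ n, ∀ x ∈ Icc a b, f^[n] (g x) = g (f^[n] x) := by
    intro n
    induction n with
    | zero => intro x _; rfl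
    | succ n ih =>
      intro x hx
      rw [Function.iterate_succ_apply', ih x hx, hcomm _ (hfitC n x hx),
        Function.iterate_succ_apply']
  have hc2 : ∀ k n, ∀ x ∈ Icc a b, f^[n] (g^[k] x) = g^[k] (f^[n] x) := by
    intro k n
    induction k with
    | zero => intro x _; rfl
    | succ k ih =>
      intro x hx
      rw [Function.iterate_succ_apply', hc1 n _ (hgitC k x hx), ih x hx,
        Function.iterate_succ_apply']
  -- derivative at a
  have hga1 : HasStrictDerivAt g 1 a := by
    have h0 : HasStrictDerivAt g (deriv g a) a :=
      hgC'.contDiffAt.hasStrictDerivAt one_ne_zero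
    have h1 := hasDerivAt_iff_tendsto_slope.1 h0.hasDerivAt
    have h2 : Filter.Tendsto (fun n => f^[n] p₀) Filter.atTop (nhdsWithin a {a}ᶜ) :=
      tendsto_nhdsWithin_iff.2 ⟨hlim p₀ hp₀, Filter.Eventually.of_forall
        fun n => (hfitI n p₀ hp₀).1.ne'⟩
    have h3 := h1.comp h2
    have h4 : (slope g a ∘ fun n => f^[n] p₀) = fun _ => (1 : ℝ) := by
      funext n
      have : f^[n] p₀ - a ≠ 0 := sub_ne_zero.2 (hfitI n p₀ hp₀).1.ne'
      simp only [Function.comp, slope_def_field, ← hc1 n p₀ (hsub hp₀), hgp₀, hga]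
      exact div_self this
    rw [h4] at h3
    rw [tendsto_nhds_unique h3 tendsto_const_nhds] at h0
    exact h0
  obtain ⟨C, hC0, hC⟩ := kop_log a b hab f hfC' hfd
  -- distortion
  have hdist : ∀ p ∈ Ioo a b, ∀ u ∈ Icc (f p) p, ∀ v ∈ Icc (f p) p, ∀ u' ∈ Icc (f p) p,
      ∀ v' ∈ Icc (f p) p, ∀ n, |f^[n] u' - f^[n] v'| * |u - v| ≤
        Real.exp (C * (p - f^[n] p)) * (|f^[n] u - f^[n] v| * |u' - v'|) := by
    intro p hp u hu v hv u' hu' v' hv' n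
    have hss : Icc (f p) p ⊆ Icc a b := Icc_subset_Icc (hfIoo hp).1.le hp.2.le
    induction n with
    | zero => simp [mul_comm]
    | succ n ih =>
      have hJ : ∀ w ∈ Icc (f p) p, f^[n] w ∈ Icc (f^[n+1] p) (f^[n] p) := fun w hw =>
        ⟨(hfitm n).monotoneOn (hss ⟨le_rfl, (hffix p hp).le⟩) (hss hw) hw.1,
          (hfitm n).monotoneOn (hss hw) (hsub hp) hw.2⟩
      have hss2 : Icc (f^[n+1] p) (f^[n] p) ⊆ Icc a b :=
        Icc_subset_Icc (hfitI _ p hp).1.le (hfitI _ p hp).2.le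
      obtain ⟨z, hz, hz2⟩ := kop_mvt f hfdiff _ _ _ _ (fun z hz => hfd z (hss2 hz))
        (hJ u hu) (hJ v hv)
      obtain ⟨z', hz', hz2'⟩ := kop_mvt f hfdiff _ _ _ _ (fun z hz => hfd z (hss2 hz))
        (hJ u' hu') (hJ v' hv')
      have hzz : deriv f z' ≤ Real.exp (C * (f^[n] p - f^[n+1] p)) * deriv f z := by
        refine (hC z' (hss2 hz') z (hss2 hz)).trans ?_
        have := (hfd z (hss2 hz)).le
        have h3 : |z' - z| ≤ f^[n] p - f^[n+1] p :=
          abs_sub_le_iff.2 ⟨by linarith [hz'.2, hz.1], by linarith [hz.2, hz'.1]⟩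
        gcongr
      have hexp : Real.exp (C * (p - f^[n+1] p)) =
          Real.exp (C * (f^[n] p - f^[n+1] p)) * Real.exp (C * (p - f^[n] p)) := by
        rw [← Real.exp_add]; congr 1; ring
      rw [hexp]
      simp only [Function.iterate_succ_apply'] at hz2 hz2' hzz ⊢
      rw [hz2, hz2']
      calc _ = deriv f z' * (|f^[n] u' - f^[n] v'| * |u - v|) := by ring
        _ ≤ (Real.exp (C * (f^[n] p - f (f^[n] p))) * deriv f z) *
            (Real.exp (C * (p - f^[n] p)) * (|f^[n] u - f^[n] v| * |u' - v'|)) := by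
          apply mul_le_mul hzz ih (by positivity)
          exact mul_nonneg (Real.exp_pos _).le (hfd z (hss2 hz)).le
        _ = _ := by ring
  -- identity on a fundamental domain
  have hfund : ∀ p ∈ Ioo a b, g p = p → ∀ x ∈ Icc (f p) p, g x = x := by
    intro p hp hgp x hx
    have hss : Icc (f p) p ⊆ Icc a b := Icc_subset_Icc (hfIoo hp).1.le hp.2.le
    have hfpm : f p ∈ Icc (f p) p := ⟨le_rfl, (hffix p hp).le⟩
    have hgfp : g (f p) = f p := by rw [← hcomm p (hsub hp), hgp]
    have hgJ : MapsTo g (Icc (f p) p) (Icc (f p) p) := fun y hy =>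
      ⟨by simpa [hgfp] using hgsm.monotoneOn (hss hfpm) (hss hy) hy.1,
        by simpa [hgp] using hgsm.monotoneOn (hss hy) (hsub hp) hy.2⟩
    obtain ⟨d, hd, hgd', ht⟩ := kop_conv g hgdiff.continuous (f p) p
      (hgsm.monotoneOn.mono hss) hgJ x hx
    by_cases hxd : d = x
    · rw [← hxd, hgd']
    exfalso
    have hdI : d ∈ Ioo a b := ⟨(hfIoo hp).1.trans_le hd.1, hd.2.trans_lt hp.2⟩
    have hxI : x ∈ Ioo a b := ⟨(hfIoo hp).1.trans_le hx.1, hx.2.trans_lt hp.2⟩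
    have key : ∀ k, |d - x| ≤ 2 * Real.exp (C * (p - a)) * |d - g^[k] x| := by
      intro k
      have hG : HasStrictDerivAt (g^[k]) 1 a := by
        simpa using HasStrictDerivAt.iterate _ hga1 hga k
      have ho := hG.isLittleO.def (show (0:ℝ) < 1/2 by norm_num)
      have hpair : Filter.Tendsto (fun n => (f^[n] d, f^[n] x)) Filter.atTop (nhds (a, a)) :=
        (hlim d hdI).prodMk_nhds (hlim x hxI)
      obtain ⟨n, hn⟩ := (hpair.eventually ho).exists
      have hgkd : g^[k] d = d := Function.iterate_fixed hgd' k
      have e1 : g^[k] (f^[n] d) = f^[n] d := by rw [← hc2 k n d (hsub hdI), hgkd]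
      have e2 : g^[k] (f^[n] x) = f^[n] (g^[k] x) := (hc2 k n x (hsub hxI)).symm
      simp [e1, e2] at hn
      have h1 := hdist p hp d hd x hx d hd (g^[k] x) (hgJ.iterate k hx) n
      have hne : 0 < |f^[n] d - f^[n] x| := abs_pos.2 (sub_ne_zero.2
        fun h => hxd ((hfitm n).injOn (hsub hdI) (hsub hxI) h))
      have h2 : |f^[n] d - f^[n] x| ≤ 2 * |f^[n] d - f^[n] (g^[k] x)| := by
        have h3 := abs_sub_abs_le_abs_sub (f^[n] d - f^[n] x) (f^[n] d - f^[n] (g^[k] x))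
        rw [abs_sub_comm (f^[n] d - f^[n] x), sub_sub_sub_cancel_left] at h3
        linarith
      have h4 : Real.exp (C * (p - f^[n] p)) ≤ Real.exp (C * (p - a)) := by
        have := (hfitI n p hp).1.le
        gcongr
      have h5 : |f^[n] d - f^[n] x| * |d - x| ≤
          |f^[n] d - f^[n] x| * (2 * Real.exp (C * (p - a)) * |d - g^[k] x|) := by
        calc _ ≤ (2 * |f^[n] d - f^[n] (g^[k] x)|) * |d - x| := by gcongr
          _ = 2 * (|f^[n] d - f^[n] (g^[k] x)| * |d - x|) := by ring
          _ ≤ 2 * (Real.exp (C * (p - f^[n] p)) *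
              (|f^[n] d - f^[n] x| * |d - g^[k] x|)) := by gcongr
          _ ≤ 2 * (Real.exp (C * (p - a)) *
              (|f^[n] d - f^[n] x| * |d - g^[k] x|)) := by gcongr
          _ = _ := by ring
      exact le_of_mul_le_mul_left h5 hne
    have hl : Filter.Tendsto (fun k => 2 * Real.exp (C * (p - a)) * |d - g^[k] x|)
        Filter.atTop (nhds (2 * Real.exp (C * (p - a)) * |d - d|)) :=
      ((tendsto_const_nhds.sub ht).abs).const_mul _
    have := ge_of_tendsto' hl key
    simp at this
    exact hxd (sub_eq_zero.1 this)
  -- identity on (a, p₀]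
  have hleft : ∀ x ∈ Ioc a p₀, g x = x := by
    intro x hx
    have hex : ∃ n, f^[n] p₀ < x := ((hlim p₀ hp₀).eventually (gt_mem_nhds hx.1)).exists
    classical
    obtain ⟨n, hn, hmin⟩ := Nat.findX hex
    cases n with
    | zero => exact absurd hx.2 (not_le.2 hn)
    | succ n =>
      have h1 := not_lt.1 (hmin n (Nat.lt_succ_self n))
      refine hfund (f^[n] p₀) (hfitI n p₀ hp₀) ?_ x ⟨?_, h1⟩
      · rw [← hc1 n p₀ (hsub hp₀), hgp₀]
      · rw [← Function.iterate_succ_apply' f]; exact hn.le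
  intro x hx
  rcases hx.1.eq_or_lt with h | h
  · rw [← h, hga]
  rcases hx.2.eq_or_lt with h' | h'
  · rw [h', hgb]
  obtain ⟨n, hn⟩ := ((hlim x ⟨h, h'⟩).eventually (gt_mem_nhds hp₀.1)).exists
  have h1 := hleft (f^[n] x) ⟨(hfitI n x ⟨h, h'⟩).1, hn.le⟩
  rw [← hc1 n x hx] at h1
  exact (hfitm n).injOn (hgM hx) hx h1

/-- Reflection of the interval. -/
lemma kop_refl (r : ℕ∞) (f : ℝ → ℝ) (a b : ℝ) (hf : CrDiffeoOn r f a b) :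
    CrDiffeoOn r (fun x => a + b - f (a + b - x)) a b := by
  obtain ⟨h1, h2, h3, h4, h5⟩ := hf
  have hm : ∀ x ∈ Icc a b, a + b - x ∈ Icc a b := fun x hx =>
    ⟨by linarith [hx.2], by linarith [hx.1]⟩
  refine ⟨contDiff_const.sub (h1.comp (contDiff_const.sub contDiff_id)), ?_, ?_, ?_, ?_⟩
  · simp [h3]
  · simp [h2]
  · intro x hx
    have : deriv (fun x => a + b - f (a + b - x)) x = deriv f (a + b - x) := by
      rw [deriv_const_sub, deriv_comp_const_sub]; simp
    rw [this]; exact h4 _ (hm x hx)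
  · intro x hx
    exact hm _ (h5 (hm x hx))

/-- **Kopell's Lemma.** Let `f` and `g` be commuting orientation-preserving
diffeomorphisms of `[a,b]`, `f` of class `C²` and `g` of class `C¹`. If `f` has no fixed
point in `(a,b)` and `g` has at least one, then `g = id`. -/
theorem kopell (a b : ℝ) (hab : a < b) (f g : ℝ → ℝ)
    (hf : CrDiffeoOn 2 f a b) (hg : CrDiffeoOn 1 g a b)
    (hcomm : ∀ x ∈ Icc a b, f (g x) = g (f x))
    (hffix : ∀ x ∈ Ioo a b, f x ≠ x)
    (hgfix : ∃ x ∈ Ioo a b, g x = x) :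
    ∀ x ∈ Icc a b, g x = x := by
  have hfc : Continuous f := hf.1.continuous
  by_cases hlt : ∀ x ∈ Ioo a b, f x < x
  · exact kop_core a b hab f g hf hg hcomm hlt hgfix
  push Not at hlt
  obtain ⟨y, hy, hyf⟩ := hlt
  have hgt : ∀ x ∈ Ioo a b, x < f x := by
    intro x hx
    by_contra hcon
    have hpc : IsPreconnected (Ioo a b) := isPreconnected_Ioo
    obtain ⟨z, hz, hz2⟩ := hpc.intermediate_value₂ hx hy hfc.continuousOn continuousOn_id
      (not_lt.1 hcon) hyf
    exact hffix z hz hz2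
  have hm : ∀ x ∈ Icc a b, a + b - x ∈ Icc a b := fun x hx =>
    ⟨by linarith [hx.2], by linarith [hx.1]⟩
  have key := kop_core a b hab _ _ (kop_refl 2 f a b hf) (kop_refl 1 g a b hg)
    (by
      intro x hx
      simp only [sub_sub_cancel]
      rw [hcomm _ (hm x hx)])
    (by
      intro x hx
      have := hgt (a + b - x) ⟨by linarith [hx.2], by linarith [hx.1]⟩
      show a + b - f (a + b - x) < x
      linarith)
    (by
      obtain ⟨p, hp, hgp⟩ := hgfix
      refine ⟨a + b - p, ⟨by linarith [hp.2], by linarith [hp.1]⟩, ?_⟩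
      simp only [sub_sub_cancel, hgp])
  intro x hx
  have h := key (a + b - x) (hm x hx)
  simp only [sub_sub_cancel] at h
  linarith
end

section
/- Let f and g be commuting orientation-preserving C^∞ diffeomorphisms of [0,1], and let J be the closure of a connected component of [0,1] \ (ITI(f) ∩ ITI(g)). If neither f restricted to J nor g restricted to J is the identity, then f and g have exactly the same fixed points in the interior of J, and at each such fixed point p they have the same finite order of contact with the identity, i.e., the smallest k ≥ 1 with D^k(f − id)(p) ≠ 0 exists, is finite, and equals the smallest k ≥ 1 with D^k(g − id)(p) ≠ 0. -/
set_option autoImplicit false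

open Set

/-- `f : ℝ → ℝ` represents (a smooth extension of) an orientation-preserving `C^∞`
diffeomorphism of the interval `[0,1]`. -/
def SmoothDiffeoI (f : ℝ → ℝ) : Prop :=
  ContDiff ℝ (⊤ : ℕ∞) f ∧ f 0 = 0 ∧ f 1 = 1 ∧ (∀ x ∈ Icc (0 : ℝ) 1, 0 < deriv f x) ∧
    MapsTo f (Icc (0 : ℝ) 1) (Icc (0 : ℝ) 1)

/-- `f` is infinitely tangent to the identity at `p`. -/
def ITIat (f : ℝ → ℝ) (p : ℝ) : Prop :=
  f p = p ∧ ∀ n : ℕ, 1 ≤ n → iteratedDeriv n (fun x => f x - x) p = 0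

section Aux
open Filter Topology Asymptotics
theorem SmoothDiffeoI.cont {f : ℝ → ℝ} (h : SmoothDiffeoI f) : Continuous f := h.1.continuous

theorem SmoothDiffeoI.diff {f : ℝ → ℝ} (h : SmoothDiffeoI f) : Differentiable ℝ f :=
  h.1.differentiable (by simp)

theorem SmoothDiffeoI.smono {f : ℝ → ℝ} (h : SmoothDiffeoI f) :
    StrictMonoOn f (Icc (0 : ℝ) 1) := by
  apply strictMonoOn_of_deriv_pos (convex_Icc _ _) h.cont.continuousOn
  intro x hx
  exact h.2.2.2.1 x (interior_subset hx)

theorem SmoothDiffeoI.comp {f g : ℝ → ℝ} (hf : SmoothDiffeoI f) (hg : SmoothDiffeoI g) :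
    SmoothDiffeoI (f ∘ g) := by
  refine ⟨hf.1.comp hg.1, ?_, ?_, ?_, hf.2.2.2.2.comp hg.2.2.2.2⟩
  · simp [hf.2.1, hg.2.1]
  · simp [hf.2.2.1, hg.2.2.1]
  · intro x hx
    rw [deriv_comp x (hf.diff _) (hg.diff _)]
    exact mul_pos (hf.2.2.2.1 _ (hg.2.2.2.2 hx)) (hg.2.2.2.1 x hx)

theorem SmoothDiffeoI.iter {f : ℝ → ℝ} (hf : SmoothDiffeoI f) (n : ℕ) :
    SmoothDiffeoI (f^[n]) := by
  induction n with
  | zero =>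
    refine ⟨contDiff_id, rfl, rfl, ?_, fun x hx => hx⟩
    intro x hx
    simp
  | succ n ih => exact ih.comp hf

theorem SmoothDiffeoI.reflect {f : ℝ → ℝ} (hf : SmoothDiffeoI f) :
    SmoothDiffeoI (fun x => 1 - f (1 - x)) := by
  refine ⟨?_, ?_, ?_, ?_, ?_⟩
  · exact contDiff_const.sub (hf.1.comp (contDiff_const.sub contDiff_id))
  · simp [hf.2.2.1]
  · simp [hf.2.1]
  · intro x hx
    have h1 : HasDerivAt (fun x : ℝ => 1 - f (1 - x)) (-(deriv f (1 - x) * (-1))) x := by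
      have h2 : HasDerivAt (fun x : ℝ => 1 - x) (-1) x := by
        simpa using (hasDerivAt_id x).const_sub 1
      have h3 := (hf.diff (1 - x)).hasDerivAt.comp x h2
      simpa using h3.const_sub 1
    rw [h1.deriv]
    have := hf.2.2.2.1 (1 - x) ⟨by linarith [hx.2], by linarith [hx.1]⟩
    linarith
  · intro x hx
    have := hf.2.2.2.2 (x := 1 - x) ⟨by linarith [hx.2], by linarith [hx.1]⟩
    exact ⟨by linarith [this.2], by linarith [this.1]⟩

theorem comm_iter {f g : ℝ → ℝ} (hg : SmoothDiffeoI g)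
    (hcomm : ∀ x ∈ Icc (0 : ℝ) 1, f (g x) = g (f x)) (n : ℕ) :
    ∀ x ∈ Icc (0 : ℝ) 1, f (g^[n] x) = g^[n] (f x) := by
  induction n with
  | zero => intro x _; rfl
  | succ n ih =>
    intro x hx
    rw [Function.iterate_succ_apply, Function.iterate_succ_apply, ih _ (hg.2.2.2.2 hx),
      hcomm x hx]

theorem lim_inc {h : ℝ → ℝ} (hc : Continuous h) {x β : ℝ} (hb : ∀ n, h^[n] x ≤ β)
    (hm : ∀ n, h^[n] x ≤ h^[n+1] x) :
    ∃ q, x ≤ q ∧ q ≤ β ∧ h q = q ∧ Tendsto (fun n => h^[n] x) atTop (𝓝 q) := by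
  have hmono : Monotone (fun n => h^[n] x) := monotone_nat_of_le_succ hm
  have hbdd : BddAbove (range (fun n => h^[n] x)) := ⟨β, by rintro _ ⟨n, rfl⟩; exact hb n⟩
  have ht := tendsto_atTop_ciSup hmono hbdd
  refine ⟨_, ?_, ciSup_le hb, isFixedPt_of_tendsto_iterate ht hc.continuousAt, ht⟩
  exact le_ciSup hbdd 0

theorem lim_dec {h : ℝ → ℝ} (hc : Continuous h) {x α : ℝ} (hb : ∀ n, α ≤ h^[n] x)
    (hm : ∀ n, h^[n+1] x ≤ h^[n] x) :
    ∃ q, α ≤ q ∧ q ≤ x ∧ h q = q ∧ Tendsto (fun n => h^[n] x) atTop (𝓝 q) := by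
  have hmono : Antitone (fun n => h^[n] x) := antitone_nat_of_succ_le hm
  have hbdd : BddBelow (range (fun n => h^[n] x)) := ⟨α, by rintro _ ⟨n, rfl⟩; exact hb n⟩
  have ht := tendsto_atTop_ciInf hmono hbdd
  refine ⟨_, le_ciInf hb, ?_, isFixedPt_of_tendsto_iterate ht hc.continuousAt, ht⟩
  exact ciInf_le hbdd 0

theorem SmoothDiffeoI.iter_inc {h : ℝ → ℝ} (hh : SmoothDiffeoI h) {x : ℝ}
    (hx : x ∈ Icc (0 : ℝ) 1) (hle : x ≤ h x) (n : ℕ) : h^[n] x ≤ h^[n+1] x := by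
  rw [Function.iterate_succ_apply]
  exact (hh.iter n).smono.monotoneOn hx (hh.2.2.2.2 hx) hle

theorem SmoothDiffeoI.iter_dec {h : ℝ → ℝ} (hh : SmoothDiffeoI h) {x : ℝ}
    (hx : x ∈ Icc (0 : ℝ) 1) (hle : h x ≤ x) (n : ℕ) : h^[n+1] x ≤ h^[n] x := by
  rw [Function.iterate_succ_apply]
  exact (hh.iter n).smono.monotoneOn (hh.2.2.2.2 hx) hx hle

theorem iter_fix {h : ℝ → ℝ} {x : ℝ} (hx : h x = x) (n : ℕ) : h^[n] x = x :=
  Function.iterate_fixed hx n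

/-- constant sign of `h - id` on an interval without fixed points -/
theorem lt_iff_of_no_fix {h : ℝ → ℝ} (hc : Continuous h) {s : Set ℝ} (hs : IsPreconnected s)
    (hn : ∀ z ∈ s, h z ≠ z) {x y : ℝ} (hx : x ∈ s) (hy : y ∈ s) (hlt : x < h x) : y < h y := by
  by_contra hcon
  push Not at hcon
  obtain ⟨z, hz, hz'⟩ := hs.intermediate_value (f := fun z => h z - z) hy hx
    (hc.sub continuous_id).continuousOn (show (0 : ℝ) ∈ Icc _ _ from
      ⟨by linarith, by linarith⟩)
  exact hn z hz (by simpa [sub_eq_zero] using hz')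

theorem gt_of_no_fix {h : ℝ → ℝ} (hc : Continuous h) {s : Set ℝ} (hs : IsPreconnected s)
    (hn : ∀ z ∈ s, h z ≠ z) {x y : ℝ} (hx : x ∈ s) (hy : y ∈ s) (hlt : h x < x) : h y < y := by
  by_contra hcon
  push Not at hcon
  have := lt_iff_of_no_fix hc hs hn hy hx (lt_of_le_of_ne hcon (hn y hy).symm)
  linarith

theorem exists_last_fix {h : ℝ → ℝ} (hc : Continuous h) {a x : ℝ} (hax : a ≤ x) (ha : h a = a) :
    ∃ u, a ≤ u ∧ u ≤ x ∧ h u = u ∧ ∀ z ∈ Ioc u x, h z ≠ z := by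
  have hcl : IsClosed {z | h z = z} := isClosed_eq hc continuous_id
  have hcomp : IsCompact (Icc a x ∩ {z | h z = z}) := isCompact_Icc.inter_right hcl
  obtain ⟨u, hu, hu'⟩ := hcomp.exists_isGreatest ⟨a, ⟨le_refl _, hax⟩, ha⟩
  refine ⟨u, hu.1.1, hu.1.2, hu.2, fun z hz hzz => ?_⟩
  have := hu' ⟨⟨hu.1.1.trans hz.1.le, hz.2⟩, hzz⟩
  linarith [hz.1]

theorem exists_first_fix {h : ℝ → ℝ} (hc : Continuous h) {b x : ℝ} (hax : x ≤ b) (hb : h b = b) :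
    ∃ u, x ≤ u ∧ u ≤ b ∧ h u = u ∧ ∀ z ∈ Ico x u, h z ≠ z := by
  have hcl : IsClosed {z | h z = z} := isClosed_eq hc continuous_id
  have hcomp : IsCompact (Icc x b ∩ {z | h z = z}) := isCompact_Icc.inter_right hcl
  obtain ⟨u, hu, hu'⟩ := hcomp.exists_isLeast ⟨b, ⟨hax, le_refl _⟩, hb⟩
  refine ⟨u, hu.1.1, hu.1.2, hu.2, fun z hz hzz => ?_⟩
  have := hu' ⟨⟨hz.1, hz.2.le.trans hu.1.2⟩, hzz⟩
  linarith [hz.2]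

theorem id_of_lip {f : ℝ → ℝ} (hf : SmoothDiffeoI f) {a b K : ℝ} (ha0 : 0 ≤ a) (hb1 : b ≤ 1)
    (hfa : f a = a) (hfb : f b = b) (hK : 0 < K)
    (hL : ∀ N : ℕ, ∀ x ∈ Icc a b, ∀ y ∈ Icc a b, x < y → f^[N] y - f^[N] x ≤ K * (y - x)) :
    ∀ x ∈ Icc a b, f x = x := by
  intro x hx
  by_contra hne
  rcases lt_or_gt_of_ne hne with hlt | hgt
  · obtain ⟨v, h1, h2, h3, h4⟩ := exists_first_fix hf.cont hx.2 hfb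
    have hxv : x < v := lt_of_le_of_ne h1 (fun h => hne (by rw [h]; exact h3))
    have hy : ∃ y, x < y ∧ y < v ∧ K * (v - y) < v - x := by
      refine ⟨v - (v - x) / (K + 1), ?_, ?_, ?_⟩
      · have : (v - x) / (K + 1) < v - x := div_lt_self (by linarith) (by linarith)
        linarith
      · have : 0 < (v - x) / (K + 1) := div_pos (by linarith) (by linarith)
        linarith
      · rw [sub_sub_cancel, mul_div_assoc', div_lt_iff₀ (by linarith)]
        nlinarith
    obtain ⟨y, hxy, hyv, hKy⟩ := hy
    have hyI : y ∈ Icc (0 : ℝ) 1 := ⟨by linarith [hx.1], by linarith⟩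
    have hfy : f y < y := gt_of_no_fix hf.cont isPreconnected_Ico h4 ⟨le_refl _, hxv⟩
      ⟨hxy.le, hyv⟩ hlt
    obtain ⟨q, q1, q2, q3, -⟩ := lim_dec hf.cont (x := y) (α := v - K * (v - y)) (fun n => by
      have := hL n y ⟨by linarith [hx.1], by linarith⟩ v ⟨by linarith [hx.1], h2⟩ hyv
      rw [iter_fix h3] at this
      linarith) (hf.iter_dec hyI hfy.le)
    exact h4 q ⟨by linarith, by linarith⟩ q3
  · obtain ⟨v, h1, h2, h3, h4⟩ := exists_last_fix hf.cont hx.1 hfa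
    have hxv : v < x := lt_of_le_of_ne h2 (fun h => hne (by rw [← h]; exact h3))
    have hy : ∃ y, v < y ∧ y < x ∧ K * (y - v) < x - v := by
      refine ⟨v + (x - v) / (K + 1), ?_, ?_, ?_⟩
      · have : 0 < (x - v) / (K + 1) := div_pos (by linarith) (by linarith)
        linarith
      · have : (x - v) / (K + 1) < x - v := div_lt_self (by linarith) (by linarith)
        linarith
      · rw [add_sub_cancel_left, mul_div_assoc', div_lt_iff₀ (by linarith)]
        nlinarith
    obtain ⟨y, hxy, hyv, hKy⟩ := hy
    have hyI : y ∈ Icc (0 : ℝ) 1 := ⟨by linarith, by linarith [hx.2]⟩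
    have hfy : y < f y := lt_iff_of_no_fix hf.cont isPreconnected_Ioc h4 ⟨hxv, le_refl _⟩
      ⟨hxy, hyv.le⟩ hgt
    obtain ⟨q, q1, q2, q3, -⟩ := lim_inc hf.cont (x := y) (β := v + K * (y - v)) (fun n => by
      have := hL n v ⟨h1, by linarith [hx.2]⟩ y ⟨by linarith, by linarith [hx.2]⟩ hxy
      rw [iter_fix h3] at this
      linarith) (hf.iter_inc hyI hfy.le)
    exact h4 q ⟨by linarith, by linarith⟩ q3

theorem SmoothDiffeoI.ratio {g : ℝ → ℝ} (hg : SmoothDiffeoI g) :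
    ∃ C : ℝ, 0 ≤ C ∧ ∀ x ∈ Icc (0 : ℝ) 1, ∀ y ∈ Icc (0 : ℝ) 1,
      deriv g x ≤ Real.exp (C * |x - y|) * deriv g y := by
  have hd : ContDiff ℝ 1 (deriv g) := by
    have h2 : ContDiff ℝ (1 + 1) g := by
      have := contDiff_infty.1 hg.1 2
      rw [one_add_one_eq_two]
      exact_mod_cast this
    exact (contDiff_succ_iff_deriv.1 h2).2.2
  have hdd : Continuous (deriv (deriv g)) := hd.continuous_deriv le_rfl
  obtain ⟨L, hL⟩ := (isCompact_Icc (a := (0 : ℝ)) (b := 1)).exists_bound_of_continuousOn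
    hdd.continuousOn
  obtain ⟨z, hz, hzmin⟩ := (isCompact_Icc (a := (0 : ℝ)) (b := 1)).exists_isMinOn
    ⟨0, by simp⟩ hd.continuous.continuousOn
  have hmu : 0 < deriv g z := hg.2.2.2.1 z hz
  have hL0 : 0 ≤ L := (norm_nonneg _).trans (hL 0 (by simp))
  refine ⟨L / deriv g z, by positivity, fun x hx y hy => ?_⟩
  have h1 : ‖deriv g x - deriv g y‖ ≤ L * ‖x - y‖ :=
    (convex_Icc (0 : ℝ) 1).norm_image_sub_le_of_norm_deriv_le
      (fun w _ => (hd.differentiable one_ne_zero) w) hL hy hx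
  rw [Real.norm_eq_abs, Real.norm_eq_abs] at h1
  have h2 : deriv g x ≤ deriv g y + L * |x - y| := by linarith [le_abs_self (deriv g x - deriv g y)]
  have h3 : deriv g z ≤ deriv g y := hzmin hy
  have h4 := Real.add_one_le_exp (L / deriv g z * |x - y|)
  have h5 : L * |x - y| ≤ L / deriv g z * |x - y| * deriv g y := by
    have : L * |x - y| = L / deriv g z * |x - y| * deriv g z := by field_simp
    rw [this]
    gcongr
  nlinarith

theorem deriv_iter_succ {g : ℝ → ℝ} (hg : SmoothDiffeoI g) (m : ℕ) (s : ℝ) :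
    deriv (g^[m+1]) s = deriv g (g^[m] s) * deriv (g^[m]) s := by
  rw [Function.iterate_succ']
  exact deriv_comp s (hg.diff _) ((hg.iter m).diff _)

theorem distortion {g : ℝ → ℝ} (hg : SmoothDiffeoI g) :
    ∃ K : ℝ, 0 < K ∧ ∀ p ∈ Icc (0 : ℝ) 1, g p ≤ p → ∀ m : ℕ, ∀ s ∈ Icc (g p) p,
      ∀ t ∈ Icc (g p) p, deriv (g^[m]) s ≤ K * deriv (g^[m]) t := by
  obtain ⟨C, hC, hr⟩ := hg.ratio
  refine ⟨Real.exp C, Real.exp_pos _, fun p hp hgp m s hs t ht => ?_⟩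
  have hgpI := hg.2.2.2.2 hp
  have hsI : s ∈ Icc (0 : ℝ) 1 := ⟨hgpI.1.trans hs.1, hs.2.trans hp.2⟩
  have htI : t ∈ Icc (0 : ℝ) 1 := ⟨hgpI.1.trans ht.1, ht.2.trans hp.2⟩
  have key : ∀ m : ℕ, deriv (g^[m]) s ≤ Real.exp (C * (p - g^[m] p)) * deriv (g^[m]) t := by
    intro m
    induction m with
    | zero => simp
    | succ m ih =>
      have hsm := (hg.iter m).2.2.2.2 hsI
      have htm := (hg.iter m).2.2.2.2 htI
      have h1 := hr _ hsm _ htm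
      have mo := (hg.iter m).smono.monotoneOn
      have e1 : g^[m] s ≤ g^[m] p := mo hsI hp hs.2
      have e2 : g^[m] t ≤ g^[m] p := mo htI hp ht.2
      have e3 : g^[m+1] p ≤ g^[m] s := by
        rw [Function.iterate_succ_apply]; exact mo hgpI hsI hs.1
      have e4 : g^[m+1] p ≤ g^[m] t := by
        rw [Function.iterate_succ_apply]; exact mo hgpI htI ht.1
      have h2 : |g^[m] s - g^[m] t| ≤ g^[m] p - g^[m+1] p := by
        rw [abs_le]; constructor <;> linarith
      rw [deriv_iter_succ hg, deriv_iter_succ hg]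
      have p1 : 0 < deriv g (g^[m] t) := hg.2.2.2.1 _ htm
      have p2 : 0 < deriv (g^[m]) t := (hg.iter m).2.2.2.1 _ htI
      have p3 : 0 < deriv (g^[m]) s := (hg.iter m).2.2.2.1 _ hsI
      calc deriv g (g^[m] s) * deriv (g^[m]) s
          ≤ (Real.exp (C * |g^[m] s - g^[m] t|) * deriv g (g^[m] t)) *
            (Real.exp (C * (p - g^[m] p)) * deriv (g^[m]) t) := by gcongr
        _ ≤ (Real.exp (C * (g^[m] p - g^[m+1] p)) * deriv g (g^[m] t)) *
            (Real.exp (C * (p - g^[m] p)) * deriv (g^[m]) t) := by gcongr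
        _ = Real.exp (C * (g^[m] p - g^[m+1] p) + C * (p - g^[m] p)) *
            (deriv g (g^[m] t) * deriv (g^[m]) t) := by rw [Real.exp_add]; ring
        _ = _ := by congr 2; ring
  refine (key m).trans ?_
  have p2 : 0 < deriv (g^[m]) t := (hg.iter m).2.2.2.1 _ htI
  have h0 := ((hg.iter m).2.2.2.2 hp).1
  have : C * (p - g^[m] p) ≤ C := by nlinarith [hp.2]
  gcongr

theorem kopell_down {f g : ℝ → ℝ} (hf : SmoothDiffeoI f) (hg : SmoothDiffeoI g)
    (hcomm : ∀ x ∈ Icc (0 : ℝ) 1, f (g x) = g (f x)) {p : ℝ} (hp : p ∈ Icc (0 : ℝ) 1)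
    (hfp : f p = p) (hgp : g p < p) : ∀ x ∈ Icc (g p) p, f x = x := by
  obtain ⟨c, c0, cp, gc, hno⟩ := exists_last_fix hg.cont hp.1 hg.2.1
  have hcp : c < p := lt_of_le_of_ne cp (fun h => by rw [h] at gc; linarith)
  have hcI : c ∈ Icc (0 : ℝ) 1 := ⟨c0, cp.trans hp.2⟩
  have hgpI := hg.2.2.2.2 hp
  have hfix : ∀ m, f (g^[m] p) = g^[m] p := fun m => by
    rw [comm_iter hg hcomm m p hp, hfp]
  have hlow : ∀ m, c < g^[m] p := fun m => by
    have := (hg.iter m).smono hcI hp hcp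
    rwa [iter_fix gc] at this
  obtain ⟨q, q1, q2, q3, hlim⟩ := lim_dec hg.cont (fun n => (hlow n).le) (hg.iter_dec hp hgp.le)
  have hqc : q = c := by
    by_contra hne
    exact hno q ⟨lt_of_le_of_ne q1 (Ne.symm hne), q2⟩ q3
  rw [hqc] at hlim
  obtain ⟨K, hK, hdist⟩ := distortion hg
  refine id_of_lip hf (K := 2 * K) hgpI.1 hp.2 (hfix 1) hfp (by positivity) ?_
  intro N x hx y hy hxy
  have hF := hf.iter N
  have hFcomm : ∀ m, ∀ x ∈ Icc (0 : ℝ) 1, f^[N] (g^[m] x) = g^[m] (f^[N] x) := by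
    intro m x hx
    exact (comm_iter hf (fun z hz => (comm_iter hg hcomm m z hz).symm) N x hx).symm
  set F := f^[N] with hFdef
  have hFfix : ∀ m, F (g^[m] p) = g^[m] p := fun m => iter_fix (hfix m) N
  have hFp : F p = p := hFfix 0
  have hFgp : F (g p) = g p := hFfix 1
  have hFc : F c = c := tendsto_nhds_unique
    ((hF.cont.tendsto c).comp hlim) (hlim.congr (fun m => (hFfix m).symm))
  have hder : deriv F c = 1 := by
    have h1 := (hF.diff c).hasDerivAt.tendsto_slope
    have h2 : Tendsto (fun m => g^[m] p) atTop (𝓝[≠] c) :=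
      tendsto_nhdsWithin_iff.2 ⟨hlim, Eventually.of_forall fun m => (hlow m).ne'⟩
    refine tendsto_nhds_unique (h1.comp h2) ?_
    refine tendsto_const_nhds.congr (fun m => ?_)
    simp only [Function.comp, slope_def_field]
    rw [hFfix m, hFc, div_self]
    exact sub_ne_zero.2 (hlow m).ne'
  have hdc : Continuous (deriv F) := hF.1.continuous_deriv (by simp)
  have hev : ∀ᶠ z in 𝓝 c, deriv F z < 2 :=
    (hdc.tendsto c).eventually_lt_const (by rw [hder]; norm_num)
  obtain ⟨ε, hε, hball⟩ := Metric.eventually_nhds_iff.1 hev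
  obtain ⟨m, hm⟩ := (hlim.eventually (Metric.ball_mem_nhds c hε)).exists
  have hm' : g^[m] p - c < ε := by
    rw [Real.dist_eq] at hm
    exact (le_abs_self _).trans_lt hm
  have hxI : x ∈ Icc (0 : ℝ) 1 := ⟨hgpI.1.trans hx.1, hx.2.trans hp.2⟩
  have hyI : y ∈ Icc (0 : ℝ) 1 := ⟨hgpI.1.trans hy.1, hy.2.trans hp.2⟩
  have hFxy : F x < F y := hF.smono hxI hyI hxy
  have hG := hg.iter m
  have hFx : g p ≤ F x := by
    have := hF.smono.monotoneOn hgpI hxI hx.1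
    rwa [hFgp] at this
  have hFy : F y ≤ p := by
    have := hF.smono.monotoneOn hyI hp hy.2
    rwa [hFp] at this
  have hgc : c ≤ g p := (hlow 1).le
  have hGxy : g^[m] x < g^[m] y := hG.smono hxI hyI hxy
  obtain ⟨s, hs, hs'⟩ := exists_deriv_eq_slope (g^[m]) hFxy hG.cont.continuousOn
    hG.diff.differentiableOn
  obtain ⟨t, ht, ht'⟩ := exists_deriv_eq_slope (g^[m]) hxy hG.cont.continuousOn
    hG.diff.differentiableOn
  obtain ⟨r, hr, hr'⟩ := exists_deriv_eq_slope F hGxy hF.cont.continuousOn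
    hF.diff.differentiableOn
  rw [eq_div_iff (sub_pos.2 hFxy).ne'] at hs'
  rw [eq_div_iff (sub_pos.2 hxy).ne'] at ht'
  rw [eq_div_iff (sub_pos.2 hGxy).ne', hFcomm m x hxI, hFcomm m y hyI] at hr'
  have hr2 : deriv F r < 2 := by
    apply hball
    have h1 : c ≤ g^[m] x := by
      have := hG.smono.monotoneOn hcI hxI (hgc.trans hx.1)
      rwa [iter_fix gc] at this
    have h2 : g^[m] y ≤ g^[m] p := hG.smono.monotoneOn hyI hp hy.2
    rw [Real.dist_eq, abs_lt]
    constructor <;> linarith [hr.1, hr.2]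
  have hd := hdist p hp hgp.le m t ⟨by linarith [hx.1, ht.1], by linarith [hy.2, ht.2]⟩
    s ⟨by linarith [hs.1], by linarith [hs.2]⟩
  have hspos : 0 < deriv (g^[m]) s := hG.2.2.2.1 s
    ⟨by linarith [hs.1, hgpI.1], by linarith [hs.2, hp.2]⟩
  have hxy' : 0 < y - x := sub_pos.2 hxy
  have : deriv (g^[m]) s * (F y - F x) ≤ deriv (g^[m]) s * (2 * K * (y - x)) := by
    calc deriv (g^[m]) s * (F y - F x) = deriv F r * (g^[m] y - g^[m] x) := by rw [hs', hr']
      _ ≤ 2 * (g^[m] y - g^[m] x) := by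
        have := sub_pos.2 hGxy
        gcongr
      _ = 2 * (deriv (g^[m]) t * (y - x)) := by rw [ht']
      _ ≤ 2 * ((K * deriv (g^[m]) s) * (y - x)) := by gcongr
      _ = _ := by ring
  exact le_of_mul_le_mul_left this hspos

theorem kopell_nhds_down {f g : ℝ → ℝ} (hf : SmoothDiffeoI f) (hg : SmoothDiffeoI g)
    (hcomm : ∀ x ∈ Icc (0 : ℝ) 1, f (g x) = g (f x)) {p : ℝ} (hp : p ∈ Ioo (0 : ℝ) 1)
    (hfp : f p = p) (hgp : g p < p) : ∀ᶠ x in 𝓝 p, f x = x := by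
  have hpI : p ∈ Icc (0 : ℝ) 1 := ⟨hp.1.le, hp.2.le⟩
  obtain ⟨q, hq, hgq⟩ := intermediate_value_Icc hp.2.le hg.cont.continuousOn
    (show p ∈ Icc (g p) (g 1) from ⟨hgp.le, by rw [hg.2.2.1]; exact hp.2.le⟩)
  have hpq : p < q := lt_of_le_of_ne hq.1 (fun h => by rw [← h] at hgq; linarith)
  have hqI : q ∈ Icc (0 : ℝ) 1 := ⟨by linarith [hp.1], hq.2⟩
  have hfq : f q = q := by
    apply hg.smono.injOn (hf.2.2.2.2 hqI) hqI
    rw [← hcomm q hqI, hgq, hfp]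
  have h1 := kopell_down hf hg hcomm hpI hfp hgp
  have h2 := kopell_down hf hg hcomm hqI hfq (by rw [hgq]; exact hpq)
  filter_upwards [Ioo_mem_nhds hgp hpq] with x hx
  rcases le_total x p with h | h
  · exact h1 x ⟨hx.1.le, h⟩
  · exact h2 x ⟨by rw [hgq]; exact h, hx.2.le⟩

theorem comm_reflect {f g : ℝ → ℝ}
    (hcomm : ∀ x ∈ Icc (0 : ℝ) 1, f (g x) = g (f x)) : ∀ x ∈ Icc (0 : ℝ) 1,
    (fun x => 1 - f (1 - x)) ((fun x => 1 - g (1 - x)) x) =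
    (fun x => 1 - g (1 - x)) ((fun x => 1 - f (1 - x)) x) := by
  intro x hx
  simp only [sub_sub_cancel]
  rw [hcomm (1 - x) ⟨by linarith [hx.2], by linarith [hx.1]⟩]

theorem kopell_nhds {f g : ℝ → ℝ} (hf : SmoothDiffeoI f) (hg : SmoothDiffeoI g)
    (hcomm : ∀ x ∈ Icc (0 : ℝ) 1, f (g x) = g (f x)) {p : ℝ} (hp : p ∈ Ioo (0 : ℝ) 1)
    (hfp : f p = p) (hgp : g p ≠ p) : ∀ᶠ x in 𝓝 p, f x = x := by
  rcases lt_or_gt_of_ne hgp with h | h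
  · exact kopell_nhds_down hf hg hcomm hp hfp h
  · have := kopell_nhds_down hf.reflect hg.reflect (comm_reflect hcomm) (p := 1 - p)
      ⟨by linarith [hp.2], by linarith [hp.1]⟩ (by simp [hfp])
      (by simp only [sub_sub_cancel]; linarith)
    have ht : Tendsto (fun x : ℝ => 1 - x) (𝓝 p) (𝓝 (1 - p)) :=
      (continuous_const.sub continuous_id).tendsto p
    filter_upwards [ht.eventually this] with x hx
    simp only [sub_sub_cancel] at hx
    linarith

theorem SmoothDiffeoI.iter_le {h : ℝ → ℝ} (hh : SmoothDiffeoI h) {x : ℝ}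
    (hx : x ∈ Icc (0 : ℝ) 1) (hle : h x ≤ x) (n : ℕ) : h^[n] x ≤ x :=
  antitone_nat_of_succ_le (f := fun n => h^[n] x) (hh.iter_dec hx hle) (Nat.zero_le n)

theorem taylor_lead {φ : ℝ → ℝ} (hφ : ContDiff ℝ (⊤ : ℕ∞) φ) {p : ℝ} {l : ℕ}
    (h0 : ∀ m < l, iteratedDeriv m φ p = 0) :
    (fun x => φ x - ((l.factorial : ℝ)⁻¹ * iteratedDeriv l φ p) * (x - p) ^ l)
      =o[𝓝 p] (fun x => (x - p) ^ l) := by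
  have h := taylor_isLittleO_univ (f := φ) (x₀ := p) (n := l) (contDiff_infty.1 hφ l)
  refine h.congr_left (fun x => ?_)
  rw [taylor_within_apply, Finset.sum_range_succ, Finset.sum_eq_zero]
  · simp only [iteratedDerivWithin_univ, smul_eq_mul, zero_add]
    ring
  · intro k hk
    rw [iteratedDerivWithin_univ, h0 k (Finset.mem_range.1 hk), smul_zero]

theorem iter_small {f : ℝ → ℝ} (hc : Continuous f) {p : ℝ} (hfp : f p = p) {l : ℕ} (hl : 1 ≤ l)
    (hfo : (fun x => f x - x) =o[𝓝 p] (fun x => (x - p) ^ l)) (N : ℕ) :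
    (fun x => f^[N] x - x) =o[𝓝 p] (fun x => (x - p) ^ l) := by
  induction N with
  | zero => simp
  | succ N ih =>
    have hN : Tendsto (f^[N]) (𝓝 p) (𝓝 p) := by
      have := (hc.iterate N).tendsto p
      rwa [iter_fix hfp] at this
    have hpow : (fun x => (x - p) ^ l) =O[𝓝 p] (fun x => x - p) := by
      obtain ⟨k, rfl⟩ := Nat.exists_eq_add_of_le hl
      have hb : (fun x : ℝ => (x - p) ^ k) =O[𝓝 p] (fun _ => (1 : ℝ)) :=
        (((continuous_id.sub continuous_const).pow k).tendsto p).isBigO_one ℝ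
      have := (isBigO_refl (fun x : ℝ => x - p) (𝓝 p)).mul hb
      refine this.congr (fun x => ?_) (fun x => ?_)
      · ring
      · ring
    have hO : (fun x => f^[N] x - p) =O[𝓝 p] (fun x => x - p) := by
      have := (ih.isBigO.trans hpow).add (isBigO_refl (fun x : ℝ => x - p) (𝓝 p))
      refine this.congr_left (fun x => by ring)
    have h1 := (hfo.comp_tendsto hN).trans_isBigO (hO.pow l)
    refine (h1.add ih).congr_left (fun x => ?_)
    simp only [Function.comp, Function.iterate_succ_apply']
    ring

/-- pointwise extraction on a right neighbourhood -/
theorem small_right {φ : ℝ → ℝ} {p : ℝ} {l : ℕ} (h : φ =o[𝓝 p] (fun x => (x - p) ^ l))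
    {ε : ℝ} (hε : 0 < ε) : ∃ δ > 0, ∀ x ∈ Ioo p (p + δ), |φ x| ≤ ε * (x - p) ^ l := by
  obtain ⟨δ, hδ, hb⟩ := Metric.eventually_nhds_iff.1 (h.def hε)
  refine ⟨δ, hδ, fun x hx => ?_⟩
  have := hb (y := x) (by rw [Real.dist_eq, abs_lt]; constructor <;> linarith [hx.1, hx.2])
  rwa [Real.norm_eq_abs, Real.norm_eq_abs, abs_of_nonneg (a := (x - p) ^ l)
    (pow_nonneg (by linarith [hx.1]) _)] at this

theorem flat_right {f g : ℝ → ℝ} (hf : SmoothDiffeoI f) (hg : SmoothDiffeoI g)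
    (hcomm : ∀ x ∈ Icc (0 : ℝ) 1, f (g x) = g (f x)) {p : ℝ} (hp : p ∈ Ioo (0 : ℝ) 1)
    (hfp : f p = p) (hgp : g p = p) {l : ℕ} (hl : 1 ≤ l) {c : ℝ} (hc : c ≠ 0)
    (hfo : (fun x => f x - x) =o[𝓝 p] (fun x => (x - p) ^ l))
    (hgo : (fun x => g x - x - c * (x - p) ^ l) =o[𝓝 p] (fun x => (x - p) ^ l)) :
    ∃ δ > 0, ∀ x ∈ Ioo p (p + δ), f x = x := by
  have hc' : 0 < |c| := abs_pos.2 hc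
  obtain ⟨δ₁, hδ₁, hg1⟩ := small_right hgo (ε := |c| / 2) (by positivity)
  obtain ⟨δ, hδ, hδle, hδ1⟩ : ∃ δ > 0, δ ≤ δ₁ ∧ p + δ ≤ 1 :=
    ⟨min δ₁ (1 - p), lt_min hδ₁ (by linarith [hp.2]), min_le_left _ _, by
      linarith [min_le_right δ₁ (1 - p)]⟩
  replace hg1 : ∀ x ∈ Ioo p (p + δ), |g x - x - c * (x - p) ^ l| ≤ |c| / 2 * (x - p) ^ l :=
    fun x hx => hg1 x ⟨hx.1, by linarith [hx.2]⟩
  have hI : ∀ x ∈ Ioo p (p + δ), x ∈ Icc (0 : ℝ) 1 := fun x hx =>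
    ⟨by linarith [hx.1, hp.1], by linarith [hx.2]⟩
  have hpI : p ∈ Icc (0 : ℝ) 1 := ⟨hp.1.le, hp.2.le⟩
  have hpow : ∀ x ∈ Ioo p (p + δ), 0 < (x - p) ^ l := fun x hx =>
    pow_pos (by linarith [hx.1]) _
  have hgne : ∀ x ∈ Ioo p (p + δ), g x ≠ x := by
    intro x hx h
    have h1 := hg1 x hx
    rw [h, sub_self, zero_sub, abs_neg, abs_mul, abs_of_pos (hpow x hx)] at h1
    nlinarith [mul_pos hc' (hpow x hx)]
  by_cases H : ∃ q ∈ Ioo p (p + δ), f q = q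
  · refine ⟨δ, hδ, ?_⟩
    obtain ⟨q, hq, hfq⟩ := H
    have hopen : ∀ x ∈ Ioo p (p + δ), f x = x → x ∈ interior {x | f x = x} := by
      intro x hx hfx
      rw [mem_interior_iff_mem_nhds]
      exact kopell_nhds hf hg hcomm ⟨by linarith [hx.1, hp.1], by linarith [hx.2]⟩ hfx (hgne x hx)
    have hcl : IsClosed {x | f x = x} := isClosed_eq hf.cont continuous_id
    have := isPreconnected_Ioo.subset_of_closure_inter_subset (isOpen_interior
      (s := {x | f x = x})) ⟨q, hq, hopen q hq hfq⟩ (fun x hx => hopen x hx.2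
        (closure_minimal interior_subset hcl hx.1))
    exact fun x hx => (interior_subset (s := {x | f x = x}) (this hx) : x ∈ {x | f x = x})
  · exfalso
    push Not at H
    have hFp : ∀ N, f^[N] p = p := iter_fix hfp
    have hGp : ∀ N, g^[N] p = p := iter_fix hgp
    -- dynamics of f
    have flow : ∀ N, ∀ x ∈ Ioo p (p + δ), p < f^[N] x := fun N x hx => by
      have := (hf.iter N).smono hpI (hI x hx) hx.1
      rwa [hFp] at this
    have glow : ∀ N, ∀ x ∈ Ioo p (p + δ), p < g^[N] x := fun N x hx => by
      have := (hg.iter N).smono hpI (hI x hx) hx.1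
      rwa [hGp] at this
    have fcomm : ∀ N, ∀ x ∈ Icc (0 : ℝ) 1, f^[N] (g x) = g (f^[N] x) := fun N x hx =>
      (comm_iter hf (fun z hz => (hcomm z hz).symm) N x hx).symm
    have fNgM : ∀ N M, ∀ x ∈ Icc (0 : ℝ) 1, f^[N] (g^[M] x) = g^[M] (f^[N] x) := fun N M x hx =>
      comm_iter hg (fcomm N) M x hx
    obtain ⟨x, hx, hgx⟩ : ∃ x ∈ Ioo p (p + δ), g x < p + δ := by
      have h1 : ∀ᶠ x in 𝓝[>] p, g x < p + δ := by
        apply eventually_nhdsWithin_of_eventually_nhds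
        apply (hg.cont.tendsto p).eventually_lt_const
        rw [hgp]; linarith
      have h2 : ∀ᶠ x in 𝓝[>] p, x ∈ Ioo p (p + δ) := Ioo_mem_nhdsGT (by linarith)
      obtain ⟨x, h⟩ := (h2.and h1).exists
      exact ⟨x, h⟩
    have hxI := hI x hx
    have hgxI := hg.2.2.2.2 hxI
    have hgxp : p < g x := glow 1 x hx
    have flim : f x < x → ∀ η > p, ∃ M, f^[M] x < η := by
      intro hlt η hη
      obtain ⟨q, q1, q2, q3, q4⟩ := lim_dec hf.cont (fun n => (flow n x hx).le)
        (hf.iter_dec hxI hlt.le)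
      have : q = p := by
        by_contra hne
        exact H q ⟨lt_of_le_of_ne q1 (Ne.symm hne), by linarith [hx.2]⟩ q3
      rw [this] at q4
      exact (q4.eventually_lt_const hη).exists
    have fsign : ∀ y ∈ Ioo p (p + δ), x < f x → y < f y := fun y hy h =>
      lt_iff_of_no_fix hf.cont isPreconnected_Ioo H hx hy h
    have hN := fun N => small_right (iter_small hf.cont hfp hl hfo N) (ε := |c| / 4)
      (by positivity)
    rcases lt_or_gt_of_ne (H x hx) with hfx | hfx
    · rcases lt_or_gt_of_ne hc with hcn | hcpos
      · -- f < id, g < id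
        rw [abs_of_neg hcn] at hg1 hN
        obtain ⟨N, hNx⟩ := flim hfx (g x) hgxp
        obtain ⟨η, hη, hsm⟩ := hN N
        obtain ⟨M, hM⟩ := flim hfx (p + η) (by linarith)
        obtain ⟨M', hM'⟩ := flim hfx (p + δ) (by linarith)
        set z := f^[M] x with hz
        have hzx : z ≤ x := hf.iter_le hxI hfx.le M
        have hzp : p < z := flow M x hx
        have hzI : z ∈ Ioo p (p + δ) := ⟨hzp, by linarith [hx.2]⟩
        have e1 := abs_le.1 (hsm z ⟨hzp, hM⟩)
        have e2 := abs_le.1 (hg1 z hzI)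
        have e3 := mul_pos (neg_pos.2 hcn) (hpow z hzI)
        have e4 : g z < f^[N] z := by linarith [e1.1, e2.2]
        have e5 : f^[M] (f^[N] x) < f^[M] (g x) :=
          (hf.iter M).smono ((hf.iter N).2.2.2.2 hxI) hgxI hNx
        rw [fcomm M x hxI, ← Function.iterate_add_apply, add_comm M N,
          Function.iterate_add_apply] at e5
        linarith
      · -- f < id, g > id
        rw [abs_of_pos hcpos] at hg1 hN
        obtain ⟨η₀, hη₀, hη₀'⟩ : ∃ η₀ > p, ∀ y ∈ Ioo p η₀, g y < x := by
          have h1 : ∀ᶠ y in 𝓝 p, g y < x := by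
            apply (hg.cont.tendsto p).eventually_lt_const
            rw [hgp]; exact hx.1
          obtain ⟨ε, hε, hb⟩ := Metric.eventually_nhds_iff.1 h1
          refine ⟨p + ε, by linarith, fun y hy => hb ?_⟩
          rw [Real.dist_eq, abs_lt]; constructor <;> linarith [hy.1, hy.2]
        obtain ⟨N, hNx⟩ := flim hfx η₀ hη₀
        have hgN : g (f^[N] x) < x := hη₀' _ ⟨flow N x hx, hNx⟩
        -- compare g w - w with z - w, w = f^[N] z
        obtain ⟨η, hη, hsm⟩ := small_right (iter_small hf.cont hfp hl hfo N)
          (ε := min (c / 4 * (1 / 2) ^ l) 1) (lt_min (by positivity) one_pos)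
        obtain ⟨η', hη', hsm'⟩ := small_right (l := 1) (p := p) (φ := fun x => f^[N] x - x)
          (by
            refine (iter_small hf.cont hfp hl hfo N).trans_isBigO ?_
            obtain ⟨k, rfl⟩ := Nat.exists_eq_add_of_le hl
            have hb : (fun x : ℝ => (x - p) ^ k) =O[𝓝 p] (fun _ => (1 : ℝ)) :=
              (((continuous_id.sub continuous_const).pow k).tendsto p).isBigO_one ℝ
            have := (isBigO_refl (fun x : ℝ => x - p) (𝓝 p)).mul hb
            exact this.congr (fun x => by ring) (fun x => by ring)) (ε := 1 / 2) (by norm_num)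
        obtain ⟨M, hM⟩ := flim hfx (p + min η η') (by linarith [lt_min hη hη'])
        set z := f^[M] x with hz
        have hzx : z ≤ x := hf.iter_le hxI hfx.le M
        have hzp : p < z := flow M x hx
        have hzI : z ∈ Ioo p (p + δ) := ⟨hzp, by linarith [hx.2]⟩
        have e1 := abs_le.1 (hsm z ⟨hzp, by linarith [min_le_left η η']⟩)
        have e1' := abs_le.1 (hsm' z ⟨hzp, by linarith [min_le_right η η']⟩)
        have hwp : p < f^[N] z := flow N z hzI
        have hwz : f^[N] z ≤ z := by
          have := gt_of_no_fix hf.cont isPreconnected_Ioo H hx hzI hfx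
          exact hf.iter_le (hI z hzI) this.le N
        have hwI : f^[N] z ∈ Ioo p (p + δ) := ⟨hwp, by linarith [hzI.2]⟩
        have e2 := abs_le.1 (hg1 _ hwI)
        have e6 : (1 / 2 * (z - p)) ^ l ≤ (f^[N] z - p) ^ l := by
          apply pow_le_pow_left₀ (by linarith)
          rw [pow_one] at e1'
          linarith [e1'.1]
        rw [mul_pow] at e6
        have e7 : min (c / 4 * (1 / 2) ^ l) 1 * (z - p) ^ l ≤ c / 4 * (f^[N] z - p) ^ l := by
          have h1 := mul_le_mul_of_nonneg_right (min_le_left (c / 4 * (1 / 2) ^ l) 1)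
            (hpow z hzI).le
          have h2 := mul_le_mul_of_nonneg_left e6 (show 0 ≤ c / 4 by positivity)
          linarith
        have e3 := mul_pos hcpos (hpow _ hwI)
        have e4 : z < g (f^[N] z) := by linarith [e1.1, e2.1]
        have e5 : f^[M] (g (f^[N] x)) < f^[M] x :=
          (hf.iter M).smono (hg.2.2.2.2 ((hf.iter N).2.2.2.2 hxI)) hxI hgN
        rw [fcomm M _ ((hf.iter N).2.2.2.2 hxI), ← Function.iterate_add_apply, add_comm M N,
          Function.iterate_add_apply] at e5
        linarith
    · -- f > id : no bounded orbits
      have funb : ∀ y ∈ Ioo p (p + δ), ∀ β < p + δ, ∃ N, β < f^[N] y := by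
        intro y hy β hβ
        by_contra hcon
        push Not at hcon
        obtain ⟨q, q1, q2, q3, -⟩ := lim_inc hf.cont hcon
          (hf.iter_inc (hI y hy) (fsign y hy hfx).le)
        exact H q ⟨by linarith [hy.1], by linarith⟩ q3
      rcases lt_or_gt_of_ne hc with hcn | hcpos
      · -- f > id, g < id
        rw [abs_of_neg hcn] at hg1 hN
        have gneg : ∀ y ∈ Ioo p (p + δ), g y < y := fun y hy => by
          have e2 := abs_le.1 (hg1 y hy)
          have e3 := mul_pos (neg_pos.2 hcn) (hpow y hy)
          linarith [e2.2]
        obtain ⟨q, q1, q2, q3, q4⟩ := lim_dec hg.cont (fun n => (glow n x hx).le)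
          (hg.iter_dec hxI (gneg x hx).le)
        have hqp : q = p := by
          by_contra hne
          exact hgne q ⟨lt_of_le_of_ne q1 (Ne.symm hne), by linarith [hx.2]⟩ q3
        rw [hqp] at q4
        obtain ⟨N, hNx⟩ := funb (g x) ⟨hgxp, hgx⟩ x hx.2
        obtain ⟨η, hη, hsm⟩ := hN N
        obtain ⟨M, hM⟩ := (q4.eventually_lt_const (show p < p + η by linarith)).exists
        set z := g^[M] x with hz
        have hzx : z ≤ x :=
          hg.iter_le hxI (gneg x hx).le M
        have hzp : p < z := glow M x hx
        have hzI : z ∈ Ioo p (p + δ) := ⟨hzp, by linarith [hx.2]⟩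
        have hwp : p < g z := glow 1 z hzI
        have hwz := gneg z hzI
        have e1 := abs_le.1 (hsm (g z) ⟨hwp, by linarith⟩)
        have e2 := abs_le.1 (hg1 z hzI)
        have e3 := mul_pos (neg_pos.2 hcn) (hpow z hzI)
        have e6 : (g z - p) ^ l ≤ (z - p) ^ l :=
          pow_le_pow_left₀ (by linarith) (by linarith) l
        have e7 := mul_le_mul_of_nonneg_left e6 (show 0 ≤ -c / 4 by linarith)
        have e4 : f^[N] (g z) < z := by linarith [e1.2, e2.2]
        have e5 : g^[M] x < g^[M] (f^[N] (g x)) :=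
          (hg.iter M).smono hxI ((hf.iter N).2.2.2.2 hgxI) hNx
        rw [← fNgM N M _ hgxI, ← Function.iterate_succ_apply, Function.iterate_succ_apply'] at e5
        linarith
      · -- f > id, g > id
        rw [abs_of_pos hcpos] at hg1 hN
        obtain ⟨N, hNx⟩ := funb x hx (g x) hgx
        obtain ⟨η, hη, hsm⟩ := hN N
        obtain ⟨y, hy, hyη⟩ : ∃ y ∈ Ioo p (p + δ), y < p + η :=
          ⟨p + min δ η / 2, ⟨by linarith [lt_min hδ hη], by
            linarith [min_le_left δ η, lt_min hδ hη]⟩, by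
            linarith [min_le_right δ η, lt_min hδ hη]⟩
        obtain ⟨M, hM⟩ := funb y hy x hx.2
        obtain ⟨z, hz, hzx⟩ := intermediate_value_Icc hy.1.le (hf.iter M).cont.continuousOn
          (show x ∈ Icc (f^[M] p) (f^[M] y) from ⟨by rw [hFp]; exact hx.1.le, hM.le⟩)
        have hzp : p < z := lt_of_le_of_ne hz.1 (fun h => by
          rw [← h, hFp] at hzx
          exact hx.1.ne hzx)
        have hzI : z ∈ Ioo p (p + δ) := ⟨hzp, by linarith [hz.2, hy.2]⟩
        have e1 := abs_le.1 (hsm z ⟨hzp, by linarith [hz.2]⟩)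
        have e2 := abs_le.1 (hg1 z hzI)
        have e3 := mul_pos hcpos (hpow z hzI)
        have e4 : f^[N] z < g z := by linarith [e1.2, e2.1]
        have e5 : f^[M] (f^[N] z) < f^[M] (g z) :=
          (hf.iter M).smono ((hf.iter N).2.2.2.2 (hI z hzI)) (hg.2.2.2.2 (hI z hzI)) e4
        rw [fcomm M z (hI z hzI), ← Function.iterate_add_apply, add_comm M N,
          Function.iterate_add_apply, hzx] at e5
        linarith

theorem reflect_isLittleO {φ : ℝ → ℝ} {p : ℝ} {l : ℕ} (h : φ =o[𝓝 p] (fun x => (x - p) ^ l)) :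
    (fun x => φ (1 - x)) =o[𝓝 (1 - p)] (fun x => (x - (1 - p)) ^ l) := by
  have ht : Tendsto (fun x : ℝ => 1 - x) (𝓝 (1 - p)) (𝓝 p) := by
    have hcont : Continuous (fun x : ℝ => 1 - x) := by fun_prop
    have := hcont.tendsto (1 - p)
    rwa [sub_sub_cancel] at this
  have h1 := h.comp_tendsto ht
  refine h1.trans_isBigO ?_
  apply IsBigO.of_bound 1
  refine Eventually.of_forall (fun x => ?_)
  simp only [Function.comp, norm_pow, one_mul]
  rw [show (1 - x - p : ℝ) = -(x - (1 - p)) by ring, norm_neg]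

theorem flat_nhds {f g : ℝ → ℝ} (hf : SmoothDiffeoI f) (hg : SmoothDiffeoI g)
    (hcomm : ∀ x ∈ Icc (0 : ℝ) 1, f (g x) = g (f x)) {p : ℝ} (hp : p ∈ Ioo (0 : ℝ) 1)
    (hfp : f p = p) (hgp : g p = p) {l : ℕ} (hl : 1 ≤ l) {c : ℝ} (hc : c ≠ 0)
    (hfo : (fun x => f x - x) =o[𝓝 p] (fun x => (x - p) ^ l))
    (hgo : (fun x => g x - x - c * (x - p) ^ l) =o[𝓝 p] (fun x => (x - p) ^ l)) :
    ∀ᶠ x in 𝓝 p, f x = x := by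
  obtain ⟨δ, hδ, h1⟩ := flat_right hf hg hcomm hp hfp hgp hl hc hfo hgo
  obtain ⟨δ', hδ', h2⟩ := flat_right hf.reflect hg.reflect (comm_reflect hcomm) (p := 1 - p)
    ⟨by linarith [hp.2], by linarith [hp.1]⟩ (by simp [hfp]) (by simp [hgp]) hl
    (c := -(c * (-1) ^ l)) (by simp [hc])
    ((reflect_isLittleO hfo).neg_left.congr_left (fun x => by ring))
    ((reflect_isLittleO hgo).neg_left.congr_left (fun x => by
      rw [show (1 - x - p : ℝ) = (-1) * (x - (1 - p)) by ring, mul_pow]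
      ring))
  filter_upwards [Ioo_mem_nhds (show p - δ' < p by linarith) (show p < p + δ by linarith)]
    with x hx
  rcases lt_trichotomy x p with h | h | h
  · have := h2 (1 - x) ⟨by linarith, by linarith [hx.1]⟩
    simp only [sub_sub_cancel] at this
    linarith
  · rw [h, hfp]
  · exact h1 x ⟨h, hx.2⟩

theorem flat_of_derivs {f g : ℝ → ℝ} (hf : SmoothDiffeoI f) (hg : SmoothDiffeoI g)
    (hcomm : ∀ x ∈ Icc (0 : ℝ) 1, f (g x) = g (f x)) {p : ℝ} (hp : p ∈ Ioo (0 : ℝ) 1)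
    (hfp : f p = p) (hgp : g p = p) {l : ℕ}
    (hf0 : ∀ m ≤ l, iteratedDeriv m (fun x => f x - x) p = 0)
    (hg0 : ∀ m < l, iteratedDeriv m (fun x => g x - x) p = 0)
    (hgl : iteratedDeriv l (fun x => g x - x) p ≠ 0) :
    ∀ᶠ x in 𝓝 p, f x = x := by
  have hl : 1 ≤ l := by
    rcases Nat.eq_zero_or_pos l with h | h
    · rw [h] at hgl
      simp [hgp] at hgl
    · exact h
  have h1 := taylor_lead (hf.1.sub contDiff_id) (p := p) (l := l) (fun m hm => hf0 m hm.le)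
  have h2 := taylor_lead (hg.1.sub contDiff_id) (p := p) (l := l) hg0
  refine flat_nhds hf hg hcomm hp hfp hgp hl
    (c := ((l.factorial : ℝ)⁻¹ * iteratedDeriv l (fun x => g x - x) p)) ?_ ?_ h2
  · exact mul_ne_zero (inv_ne_zero (by exact_mod_cast l.factorial_ne_zero)) hgl
  · refine h1.congr_left (fun x => ?_)
    have : iteratedDeriv l (fun x => f x - id x) p = 0 := hf0 l le_rfl
    rw [this]
    simp

theorem iti_of_eventually {f : ℝ → ℝ} {p : ℝ} (h : ∀ᶠ x in 𝓝 p, f x = x) : ITIat f p := by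
  refine ⟨h.self_of_nhds, fun n hn => ?_⟩
  have : (fun x => f x - x) =ᶠ[𝓝 p] (fun _ => (0 : ℝ)) := by
    filter_upwards [h] with x hx
    rw [hx, sub_self]
  rw [this.iteratedDeriv_eq n]
  simp [iteratedDeriv_const]

theorem exists_order {f : ℝ → ℝ} {p : ℝ} (hfp : f p = p) (h : ¬ ITIat f p) :
    ∃ l, 1 ≤ l ∧ iteratedDeriv l (fun x => f x - x) p ≠ 0 ∧
      ∀ m < l, iteratedDeriv m (fun x => f x - x) p = 0 := by
  classical
  have hex : ∃ l, iteratedDeriv l (fun x => f x - x) p ≠ 0 := by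
    by_contra hcon
    push Not at hcon
    exact h ⟨hfp, fun n _ => hcon n⟩
  refine ⟨Nat.find hex, ?_, Nat.find_spec hex, fun m hm => ?_⟩
  · rw [Nat.one_le_iff_ne_zero]
    intro h0
    have := Nat.find_spec hex
    rw [h0] at this
    simp [hfp] at this
  · simpa using Nat.find_min hex hm

theorem iti_deriv_zero {f : ℝ → ℝ} {p : ℝ} (h : ITIat f p) (m : ℕ) :
    iteratedDeriv m (fun x => f x - x) p = 0 := by
  rcases Nat.eq_zero_or_pos m with h0 | h0
  · rw [h0]; simp [h.1]
  · exact h.2 m h0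

theorem isClosed_iti {f : ℝ → ℝ} (hf : SmoothDiffeoI f) : IsClosed {x | ITIat f x} := by
  have : {x | ITIat f x} = ⋂ m : ℕ, {x | iteratedDeriv m (fun x => f x - x) x = 0} := by
    ext x
    simp only [mem_setOf_eq, mem_iInter]
    refine ⟨iti_deriv_zero, fun h => ⟨?_, fun n _ => h n⟩⟩
    have := h 0
    simp only [iteratedDeriv_zero] at this
    linarith
  rw [this]
  refine isClosed_iInter (fun m => isClosed_eq ?_ continuous_const)
  have hs : ContDiff ℝ (⊤ : ℕ∞) (fun x => f x - x) := hf.1.sub contDiff_id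
  exact (contDiff_infty.1 hs m).continuous_iteratedDeriv m le_rfl

theorem not_iti {f g : ℝ → ℝ} (hf : SmoothDiffeoI f) (hg : SmoothDiffeoI g)
    (hcomm : ∀ x ∈ Icc (0 : ℝ) 1, f (g x) = g (f x)) {U : Set ℝ} (hUc : IsPreconnected U)
    (hU01 : U ⊆ Ioo (0 : ℝ) 1) (hU : ∀ x ∈ U, ¬ (ITIat f x ∧ ITIat g x))
    (hne : ¬ ∀ x ∈ U, f x = x) : ∀ p ∈ U, ¬ ITIat f p := by
  intro p hp hfp
  have hopen : ∀ x ∈ U, ITIat f x → x ∈ interior {x | f x = x} := by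
    intro x hx hfx
    rw [mem_interior_iff_mem_nhds]
    by_cases hgx : g x = x
    · obtain ⟨l, hl, h1, h2⟩ := exists_order hgx (fun h => hU x hx ⟨hfx, h⟩)
      exact flat_of_derivs hf hg hcomm (hU01 hx) hfx.1 hgx (fun m _ => iti_deriv_zero hfx m) h2 h1
    · exact kopell_nhds hf hg hcomm (hU01 hx) hfx.1 hgx
  have hsub : interior {x | f x = x} ⊆ {x | ITIat f x} := by
    intro x hx
    rw [mem_interior_iff_mem_nhds] at hx
    exact iti_of_eventually hx
  have := hUc.subset_of_closure_inter_subset (isOpen_interior (s := {x | f x = x}))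
    ⟨p, hp, hopen p hp hfp⟩
    (fun x hx => hopen x hx.2 (closure_minimal hsub (isClosed_iti hf) hx.1))
  exact hne (fun x hx => (interior_subset (s := {x | f x = x}) (this hx) : x ∈ {x | f x = x}))

theorem interior_closure_subset {C : Set ℝ} (hC : IsPreconnected C) :
    interior (closure C) ⊆ C := by
  intro p hp
  rw [mem_interior_iff_mem_nhds, Metric.mem_nhds_iff] at hp
  obtain ⟨ε, hε, hb⟩ := hp
  have key : ∀ q, dist q p < ε / 2 → ∃ y ∈ C, dist q y < ε / 2 := fun q hq =>
    Metric.mem_closure_iff.1 (hb (show q ∈ Metric.ball p ε by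
      rw [Metric.mem_ball]; linarith)) _ (by linarith)
  have key2 : ∀ q, dist q p < ε → ∀ r > 0, ∃ y ∈ C, dist q y < r := fun q hq r hr =>
    Metric.mem_closure_iff.1 (hb hq) r hr
  obtain ⟨y, hy, hy'⟩ := key2 (p + ε / 2) (by
    rw [Real.dist_eq, add_sub_cancel_left, abs_of_pos] <;> linarith) (ε / 2) (by linarith)
  obtain ⟨z, hz, hz'⟩ := key2 (p - ε / 2) (by
    rw [Real.dist_eq, show p - ε / 2 - p = -(ε / 2) by ring, abs_neg, abs_of_pos] <;> linarith)
    (ε / 2) (by linarith)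
  rw [Real.dist_eq, abs_lt] at hy' hz'
  exact hC.ordConnected.out hz hy ⟨by linarith [hz'.1], by linarith [hy'.2]⟩

end Aux

/-- Let `f, g` be commuting orientation-preserving `C^∞` diffeomorphisms of `[0,1]` and let
`J` be the closure of a connected component of `[0,1] \ (ITI(f) ∩ ITI(g))`. If neither
`f|_J` nor `g|_J` is the identity, then `f` and `g` have the same fixed points in the
interior of `J`, with the same (finite) order of contact with the identity. -/
theorem same_fixed_points_and_contact_order (f g : ℝ → ℝ)
    (hf : SmoothDiffeoI f) (hg : SmoothDiffeoI g)
    (hcomm : ∀ x ∈ Icc (0 : ℝ) 1, f (g x) = g (f x))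
    (S : Set ℝ) (hS : S = Icc (0 : ℝ) 1 \ {x | ITIat f x ∧ ITIat g x})
    (x₀ : ℝ) (hx₀ : x₀ ∈ S)
    (J : Set ℝ) (hJ : J = closure (connectedComponentIn S x₀))
    (hfJ : ¬ ∀ x ∈ J, f x = x) (hgJ : ¬ ∀ x ∈ J, g x = x) :
    ∀ p ∈ interior J,
      (f p = p ↔ g p = p) ∧
      (f p = p →
        ∃ k : ℕ, 1 ≤ k ∧ iteratedDeriv k (fun x => f x - x) p ≠ 0 ∧
          iteratedDeriv k (fun x => g x - x) p ≠ 0 ∧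
          ∀ m : ℕ, 1 ≤ m → m < k →
            iteratedDeriv m (fun x => f x - x) p = 0 ∧
            iteratedDeriv m (fun x => g x - x) p = 0) := by
  subst hJ
  intro p hp
  set C := connectedComponentIn S x₀ with hCdef
  have hC : IsPreconnected C := isPreconnected_connectedComponentIn
  have hCS : C ⊆ S := connectedComponentIn_subset S x₀
  have hUC := interior_closure_subset hC
  have hUS : interior (closure C) ⊆ S := hUC.trans hCS
  have hconv : Convex ℝ (closure C) := (convex_iff_ordConnected.2 hC.ordConnected).closure
  have hUconv : Convex ℝ (interior (closure C)) := hconv.interior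
  have hUpre : IsPreconnected (interior (closure C)) := hUconv.isPreconnected
  have hU01 : interior (closure C) ⊆ Ioo (0 : ℝ) 1 := by
    rw [← interior_Icc]
    refine interior_maximal (hUS.trans ?_) isOpen_interior
    rw [hS]
    exact diff_subset
  have hU : ∀ x ∈ interior (closure C), ¬ (ITIat f x ∧ ITIat g x) := by
    intro x hx
    have := hUS hx
    rw [hS] at this
    exact this.2
  have hcl : closure (interior (closure C)) = closure C := by
    rw [hconv.closure_interior_eq_closure_of_nonempty_interior ⟨p, hp⟩, closure_closure]
  have hne : ∀ h : ℝ → ℝ, SmoothDiffeoI h → (¬ ∀ x ∈ closure C, h x = x) →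
      ¬ ∀ x ∈ interior (closure C), h x = x := by
    intro h hh hJ hcon
    apply hJ
    rw [← hcl]
    exact closure_minimal (t := {x | h x = x}) hcon (isClosed_eq hh.cont continuous_id)
  have hcomm' : ∀ x ∈ Icc (0 : ℝ) 1, g (f x) = f (g x) := fun x hx => (hcomm x hx).symm
  have hfn := not_iti hf hg hcomm hUpre hU01 hU (hne f hf hfJ)
  have hgn := not_iti hg hf hcomm' hUpre hU01 (fun x hx h => hU x hx h.symm) (hne g hg hgJ)
  have hiff : f p = p ↔ g p = p := by
    constructor
    · intro h
      by_contra hg'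
      exact hfn p hp (iti_of_eventually (kopell_nhds hf hg hcomm (hU01 hp) h hg'))
    · intro h
      by_contra hf'
      exact hgn p hp (iti_of_eventually (kopell_nhds hg hf hcomm' (hU01 hp) h hf'))
  refine ⟨hiff, fun hfp => ?_⟩
  have hgp := hiff.1 hfp
  obtain ⟨k, hk, k1, k2⟩ := exists_order hfp (hfn p hp)
  obtain ⟨l, hl, l1, l2⟩ := exists_order hgp (hgn p hp)
  rcases lt_trichotomy k l with h | h | h
  · exact absurd (iti_of_eventually (flat_of_derivs hg hf hcomm' (hU01 hp) hgp hfp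
      (fun m hm => l2 m (by omega)) k2 k1)) (hgn p hp)
  · subst h
    exact ⟨k, hk, k1, l1, fun m _ hm => ⟨k2 m hm, l2 m hm⟩⟩
  · exact absurd (iti_of_eventually (flat_of_derivs hf hg hcomm (hU01 hp) hfp hgp
      (fun m hm => k2 m (by omega)) l2 l1)) (hfn p hp)
end

section
/- Let ∂ ⊂ {0,1} with 0 ∈ ∂, and let f ∈ Diff*_∂[0,1] be the time-1 map of the flow of a vector field ξ on [0,1] which is C¹ on [0,1] (and C^∞ on (0,1)). Then for all n ∈ ℕ \ {0} and all η > 0, one has ξ(x)^{n−1} Dⁿξ(x) = O(‖f − id‖_{0,[0,x]}^{n−η}) as x → 0 in (0,1). -/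
set_option autoImplicit false

open Set

/-- `Diff*_∂[0,1]`: the identity, together with the orientation-preserving `C^∞`
diffeomorphisms of `[0,1]` which are infinitely tangent to the identity exactly at the
points of `D` and nowhere else in `[0,1]`. -/
def DiffStar (D : Set ℝ) (f : ℝ → ℝ) : Prop :=
  SmoothDiffeoI f ∧
    ((∀ x ∈ Icc (0 : ℝ) 1, f x = x) ∨ ∀ p ∈ Icc (0 : ℝ) 1, (ITIat f p ↔ p ∈ D))

/-- `φ` is the (complete) flow of the vector field `ξ` on the interval `[a,b]`. -/
def IsFlowOn (ξ : ℝ → ℝ) (φ : ℝ → ℝ → ℝ) (a b : ℝ) : Prop :=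
  (∀ x ∈ Icc a b, φ 0 x = x) ∧
    ∀ x ∈ Icc a b, ∀ t : ℝ, φ t x ∈ Icc a b ∧ HasDerivAt (fun s => φ s x) (ξ (φ t x)) t


/-- sup of `|h|` on `[0,x]` -/
noncomputable def supA (h : ℝ → ℝ) (x : ℝ) : ℝ := ⨆ y : Icc (0 : ℝ) x, |h y.1|

lemma supA_bdd {h : ℝ → ℝ} (hc : Continuous h) (x : ℝ) :
    BddAbove (range fun y : Icc (0 : ℝ) x => |h y.1|) := by
  have := (isCompact_Icc (a := (0:ℝ)) (b := x)).bddAbove_image (f := fun y => |h y|)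
    (hc.abs.continuousOn)
  obtain ⟨M, hM⟩ := this
  refine ⟨M, ?_⟩
  rintro _ ⟨y, rfl⟩
  exact hM ⟨y.1, y.2, rfl⟩

lemma le_supA {h : ℝ → ℝ} (hc : Continuous h) {x y : ℝ} (h0 : 0 ≤ y) (hy : y ≤ x) :
    |h y| ≤ supA h x :=
  le_ciSup (supA_bdd hc x) (⟨y, h0, hy⟩ : Icc (0 : ℝ) x)

lemma supA_le {h : ℝ → ℝ} {x M : ℝ} (hx : 0 ≤ x) (hM : ∀ y, 0 ≤ y → y ≤ x → |h y| ≤ M) :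
    supA h x ≤ M := by
  have : Nonempty (Icc (0 : ℝ) x) := ⟨⟨0, le_rfl, hx⟩⟩
  exact ciSup_le fun y => hM y.1 y.2.1 y.2.2

lemma supA_nonneg {h : ℝ → ℝ} (hc : Continuous h) {x : ℝ} (hx : 0 ≤ x) : 0 ≤ supA h x :=
  (abs_nonneg _).trans (le_supA hc le_rfl hx)

lemma supA_mono {h : ℝ → ℝ} (hc : Continuous h) {x y : ℝ} (hx : 0 ≤ x) (hxy : x ≤ y) :
    supA h x ≤ supA h y :=
  supA_le hx fun _ h0 h1 => le_supA hc h0 (h1.trans hxy)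

def Flat (h : ℝ → ℝ) : Prop := ContDiff ℝ (⊤ : ℕ∞) h ∧ ∀ k, iteratedDeriv k h 0 = 0

lemma Flat.deriv {h : ℝ → ℝ} (hh : Flat h) : Flat (deriv h) := by
  refine ⟨?_, fun k => ?_⟩
  · exact ((contDiff_infty_iff_deriv).1 hh.1).2
  · rw [← iteratedDeriv_succ']; exact hh.2 _

lemma Flat.zero {h : ℝ → ℝ} (hh : Flat h) : h 0 = 0 := by simpa using hh.2 0

lemma Flat.diff {h : ℝ → ℝ} (hh : Flat h) : Differentiable ℝ h :=
  hh.1.differentiable (by simp)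

lemma Flat.cont {h : ℝ → ℝ} (hh : Flat h) : Continuous h := hh.1.continuous

lemma landau_aux {h : ℝ → ℝ} (hh : Flat h) {x y : ℝ} (h0 : 0 ≤ y) (hyx : y ≤ x)
    (hd : 0 ≤ deriv h y) :
    (deriv h y) ^ 2 ≤ 8 * supA h x * supA (deriv (deriv h)) x := by
  have hx : 0 ≤ x := h0.trans hyx
  have hA0 := supA_nonneg hh.cont hx
  have hA2 := supA_nonneg hh.deriv.deriv.cont hx
  set d := deriv h y with hdd
  set A2 := supA (deriv (deriv h)) x with hA2d
  -- Lipschitz bound for the derivative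
  have lip : ∀ z, 0 ≤ z → z ≤ y → d - deriv h z ≤ A2 * (y - z) := by
    intro z hz hzy
    rcases hzy.eq_or_lt with rfl | hlt
    · simp [hdd]
    obtain ⟨c, hc, hce⟩ := exists_deriv_eq_slope (deriv h) hlt
      hh.deriv.cont.continuousOn hh.deriv.diff.differentiableOn
    have h1 := le_supA hh.deriv.deriv.cont (hz.trans hc.1.le) (hc.2.le.trans hyx)
    have h2 := (le_abs_self _).trans h1
    rw [hce, div_le_iff₀ (by linarith)] at h2
    exact h2
  rcases hd.eq_or_lt with hd0 | hdpos
  · rw [← hd0, zero_pow two_ne_zero]; positivity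
  have hdy : d ≤ A2 * y := by
    have := lip 0 le_rfl h0
    rw [hh.deriv.zero] at this; simpa using this
  have hA2p : 0 < A2 := by
    rcases hA2.eq_or_lt with h | h
    · rw [← h] at hdy; simp at hdy; linarith
    · exact h
  have hsy : d / A2 ≤ y := by rw [div_le_iff₀ hA2p]; linarith
  have hs : 0 < d / A2 := by positivity
  have hlt : y - d / A2 / 2 < y := by linarith
  obtain ⟨c, hc, hce⟩ := exists_deriv_eq_slope h hlt
      hh.cont.continuousOn hh.diff.differentiableOn
  have hc0 : 0 ≤ c := by linarith [hc.1]
  have h3 := lip c hc0 hc.2.le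
  have h4 : A2 * (y - c) ≤ d / 2 := by
    have : y - c ≤ d / A2 / 2 := by linarith [hc.1]
    calc A2 * (y - c) ≤ A2 * (d / A2 / 2) := by gcongr
      _ = d / 2 := by field_simp
  have h5 : d / 2 ≤ deriv h c := by linarith
  rw [hce, le_div_iff₀ (by linarith)] at h5
  have h6 : d / 2 * (y - (y - d / A2 / 2)) = d ^ 2 / (4 * A2) := by field_simp; ring
  rw [h6] at h5
  have h7 := (le_abs_self _).trans (le_supA hh.cont h0 hyx)
  have h8 := (neg_le_abs _).trans (le_supA hh.cont (y := y - d / A2 / 2) (x := x)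
    (by linarith) (by linarith))
  have h9 : d ^ 2 / (4 * A2) ≤ 2 * supA h x := by linarith
  rw [div_le_iff₀ (by positivity)] at h9
  linarith

lemma Flat.neg {h : ℝ → ℝ} (hh : Flat h) : Flat (fun x => - h x) := by
  refine ⟨hh.1.neg, fun k => ?_⟩
  have := iteratedDeriv_fun_neg (𝕜 := ℝ) k h 0
  rw [this, hh.2 k, neg_zero]

lemma landau {h : ℝ → ℝ} (hh : Flat h) {x : ℝ} (hx : 0 ≤ x) :
    (supA (deriv h) x) ^ 2 ≤ 8 * supA h x * supA (deriv (deriv h)) x := by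
  have key : ∀ y, 0 ≤ y → y ≤ x → |deriv h y| ≤
      √(8 * supA h x * supA (deriv (deriv h)) x) := by
    intro y h0 hy
    apply Real.le_sqrt_of_sq_le
    rw [sq_abs]
    rcases le_total 0 (deriv h y) with hd | hd
    · exact landau_aux hh h0 hy hd
    · have := landau_aux hh.neg (x := x) h0 hy (by simpa using hd)
      have e1 : supA (fun x => - h x) x = supA h x := by simp [supA]
      have e2 : supA (deriv (deriv (fun x => - h x))) x = supA (deriv (deriv h)) x := by
        have : deriv (fun x => - h x) = fun x => - deriv h x := by
          ext; simp
        rw [this]; simp [supA]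
      rw [e1, e2] at this
      simpa using this
  have h1 := supA_le hx key
  have h2 := supA_nonneg hh.deriv.cont hx
  have hA0 := supA_nonneg hh.cont hx
  have hA2 := supA_nonneg hh.deriv.deriv.cont hx
  calc _ ≤ (√(8 * supA h x * supA (deriv (deriv h)) x)) ^ 2 := by gcongr
    _ = _ := Real.sq_sqrt (by positivity)

/-- bootstrapped interpolation -/
lemma interp (m : ℕ) : ∀ h : ℝ → ℝ, Flat h → ∃ C > (0:ℝ), ∀ x, 0 ≤ x → x ≤ 1 →
    supA (deriv h) x ≤ C * (supA h x) ^ ((m:ℝ) / (m + 1)) := by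
  induction m with
  | zero =>
    intro h hh
    refine ⟨supA (deriv h) 1 + 1, by linarith [supA_nonneg hh.deriv.cont (zero_le_one)], ?_⟩
    intro x hx hx1
    have := supA_mono hh.deriv.cont hx hx1
    simp; linarith
  | succ m ih =>
    intro h hh
    obtain ⟨C, hC, hb⟩ := ih (deriv h) hh.deriv
    set θ : ℝ := (m:ℝ) / (m + 1) with hθ
    have hm : (0:ℝ) < m + 1 := by positivity
    have hθ1 : 0 < 2 - θ := by
      have : θ ≤ 1 := by rw [hθ, div_le_one hm]; linarith
      linarith
    have hinv : (2 - θ)⁻¹ = ((m + 1 : ℕ):ℝ) / ((m + 1 : ℕ) + 1) := by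
      have : 2 - θ = ((m:ℝ) + 2) / (m + 1) := by rw [hθ]; field_simp; ring
      rw [this, inv_div]; push_cast; congr 1; ring
    refine ⟨(8 * C) ^ (2 - θ)⁻¹, by positivity, fun x hx hx1 => ?_⟩
    have hA0 := supA_nonneg hh.cont hx
    rcases (supA_nonneg hh.deriv.cont hx).eq_or_lt with h1 | h1
    · rw [← h1]; positivity
    · have h2 := landau hh hx
      have h3 := hb x hx hx1
      have h4 : supA (deriv h) x ^ (2 - θ) ≤ 8 * C * supA h x := by
        rw [Real.rpow_sub h1, div_le_iff₀ (by positivity)]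
        calc supA (deriv h) x ^ (2:ℝ) = supA (deriv h) x ^ 2 := by norm_cast
          _ ≤ _ := h2
          _ ≤ 8 * supA h x * (C * supA (deriv h) x ^ θ) := by gcongr
          _ = _ := by ring
      rw [← hinv, ← Real.mul_rpow (by positivity) hA0]
      calc supA (deriv h) x = (supA (deriv h) x ^ (2 - θ)) ^ (2 - θ)⁻¹ := by
            rw [← Real.rpow_mul h1.le, mul_inv_cancel₀ hθ1.ne', Real.rpow_one]
        _ ≤ _ := by gcongr

lemma interp_iter (m : ℕ) {h : ℝ → ℝ} (hh : Flat h) (i : ℕ) : ∃ C > (0:ℝ), ∀ x, 0 ≤ x → x ≤ 1 →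
    supA (deriv^[i] h) x ≤ C * (supA h x) ^ (((m:ℝ) / (m + 1)) ^ i) := by
  have hfl : ∀ i, Flat (deriv^[i] h) := by
    intro i
    induction i with
    | zero => exact hh
    | succ i ih => rw [Function.iterate_succ_apply']; exact ih.deriv
  induction i with
  | zero => exact ⟨1, one_pos, fun x _ _ => by simp⟩
  | succ i ih =>
    obtain ⟨C, hC, hb⟩ := ih
    obtain ⟨C', hC', hb'⟩ := interp m _ (hfl i)
    refine ⟨C' * C ^ ((m:ℝ) / (m + 1)), by positivity, fun x hx hx1 => ?_⟩
    rw [Function.iterate_succ_apply']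
    have hA0 := supA_nonneg hh.cont hx
    have hAi := supA_nonneg (hfl i).cont hx
    calc _ ≤ C' * supA (deriv^[i] h) x ^ ((m:ℝ) / (m + 1)) := hb' x hx hx1
      _ ≤ C' * (C * (supA h x) ^ (((m:ℝ) / (m + 1)) ^ i)) ^ ((m:ℝ) / (m + 1)) := by
          gcongr; exact hb x hx hx1
      _ = _ := by
          rw [Real.mul_rpow hC.le (by positivity), ← Real.rpow_mul hA0, pow_succ]; ring
lemma xi_deriv_bdd {ξ : ℝ → ℝ} (hξ1 : ContDiffOn ℝ 1 ξ (Icc (0 : ℝ) 1)) :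
    ContinuousOn (derivWithin ξ (Icc 0 1)) (Icc 0 1) ∧
    ∃ K : ℝ, 0 ≤ K ∧ ∀ x ∈ Icc (0:ℝ) 1, |derivWithin ξ (Icc 0 1) x| ≤ K := by
  have hc := hξ1.continuousOn_derivWithin (uniqueDiffOn_Icc zero_lt_one) le_rfl
  obtain ⟨M, hM⟩ := (isCompact_Icc (a := (0:ℝ)) (b := 1)).bddAbove_image hc.abs
  refine ⟨hc, M, ?_, fun x hx => hM ⟨x, hx, rfl⟩⟩
  exact (abs_nonneg _).trans (hM ⟨0, by simp, rfl⟩)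

lemma flow_group {ξ : ℝ → ℝ} {φ : ℝ → ℝ → ℝ}
    (hξ1 : ContDiffOn ℝ 1 ξ (Icc (0 : ℝ) 1)) (hflow : IsFlowOn ξ φ 0 1)
    {x : ℝ} (hx : x ∈ Icc (0:ℝ) 1) (s t : ℝ) : φ s (φ t x) = φ (s + t) x := by
  obtain ⟨-, K, hK, hb⟩ := xi_deriv_bdd hξ1
  have hlip : LipschitzOnWith K.toNNReal ξ (Icc 0 1) :=
    (convex_Icc (0:ℝ) 1).lipschitzOnWith_of_nnnorm_derivWithin_le
      (hξ1.differentiableOn (by simp)) (fun x hx => by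
        rw [← NNReal.coe_le_coe, Real.coe_toNNReal K hK]; simpa using hb x hx)
  have := ODE_solution_unique_univ (v := fun _ => ξ) (s := fun _ => Icc (0:ℝ) 1) (t₀ := 0)
    (K := K.toNNReal) (f := fun s => φ s (φ t x)) (g := fun s => φ (s + t) x)
    (fun _ => hlip) (fun s => ?_) (fun s => ?_) ?_
  · exact congrFun this s
  · have := hflow.2 (φ t x) (hflow.2 x hx t).1 s
    exact ⟨this.2, this.1⟩
  · have := hflow.2 x hx (s + t)
    exact ⟨this.2.comp_add_const s t, this.1⟩
  · simp [hflow.1 _ (hflow.2 x hx t).1]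

lemma flow_exp {ξ : ℝ → ℝ} {φ : ℝ → ℝ → ℝ}
    (hξ1 : ContDiffOn ℝ 1 ξ (Icc (0 : ℝ) 1)) (hflow : IsFlowOn ξ φ 0 1) :
    ∃ K : ℝ, 0 ≤ K ∧ ∀ x ∈ Icc (0:ℝ) 1, ∃ E : ℝ → ℝ,
      (∀ t, ξ (φ t x) = ξ x * Real.exp (E t)) ∧ ∀ t ∈ Icc (0:ℝ) 1, |E t| ≤ K := by
  obtain ⟨hc, K, hK, hb⟩ := xi_deriv_bdd hξ1
  refine ⟨K, hK, fun x hx => ?_⟩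
  set a : ℝ → ℝ := fun t => derivWithin ξ (Icc 0 1) (φ t x) with ha
  have hyc : Continuous (fun t => φ t x) :=
    continuous_iff_continuousAt.2 fun t => (hflow.2 x hx t).2.continuousAt
  have hac : Continuous a := hc.comp_continuous hyc fun t => (hflow.2 x hx t).1
  refine ⟨fun t => ∫ s in (0:ℝ)..t, a s, fun t => ?_, fun t ht => ?_⟩
  · have hE : ∀ t, HasDerivAt (fun t => ∫ s in (0:ℝ)..t, a s) (a t) t := fun t =>
      intervalIntegral.integral_hasDerivAt_right (hac.intervalIntegrable _ _)
        (hac.stronglyMeasurableAtFilter _ _) hac.continuousAt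
    have hz : ∀ t, HasDerivAt (fun t => ξ (φ t x)) (a t * ξ (φ t x)) t := by
      intro t
      have h1 : HasDerivWithinAt ξ (a t) (Icc 0 1) (φ t x) :=
        ((hξ1.differentiableOn (by simp)) _ (hflow.2 x hx t).1).hasDerivWithinAt
      have h2 := (hflow.2 x hx t).2.hasDerivWithinAt (s := univ)
      have h3 := HasDerivWithinAt.comp t h1 h2 (fun t _ => (hflow.2 x hx t).1)
      rwa [hasDerivWithinAt_univ] at h3
    have hq : ∀ t, HasDerivAt (fun t => ξ (φ t x) * Real.exp (-∫ s in (0:ℝ)..t, a s)) 0 t := by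
      intro t
      have := (hz t).mul (hE t).neg.exp
      refine this.congr_deriv ?_
      ring
    have hcst := is_const_of_deriv_eq_zero (fun t => (hq t).differentiableAt)
      (fun t => (hq t).deriv) t 0
    simp [hflow.1 x hx] at hcst
    rw [← hcst, mul_assoc, ← Real.exp_add]; simp
  · have := intervalIntegral.norm_integral_le_of_norm_le_const (a := (0:ℝ)) (b := t) (f := a)
      (C := K) (fun s _ => by simpa using hb _ (hflow.2 x hx s).1)
    simp only [Real.norm_eq_abs, sub_zero] at this
    rw [abs_of_nonneg ht.1] at this
    calc _ ≤ K * t := this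
      _ ≤ K * 1 := by gcongr; exact ht.2
      _ = K := mul_one K

/-- flow-free summary of the hypotheses -/
structure FlowData (f ξ : ℝ → ℝ) (K : ℝ) : Prop where
  hK : 0 < K
  le : ∀ x ∈ Icc (0:ℝ) 1, |ξ x| ≤ K * |f x - x|
  zero : ∀ x ∈ Icc (0:ℝ) 1, ξ x = 0 → f x = x
  conj : ∀ x ∈ Ioo (0:ℝ) 1, ξ (f x) = deriv f x * ξ x
  orb : ∀ x ∈ Ioo (0:ℝ) 1, ξ x ≠ 0 → ∃ (s : ℝ) (ψ : ℝ → ℝ), |s| = 1 ∧ ψ 0 = x ∧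
    (∀ τ, 0 ≤ τ → ψ τ ∈ Ioc 0 x) ∧ Antitone ψ ∧ (∀ τ, 0 ≤ ψ τ) ∧
    (∀ τ, HasDerivAt ψ (s * ξ (ψ τ)) τ) ∧
    ((∀ τ, ψ (τ + 1) = f (ψ τ)) ∨ ∀ τ, ψ τ = f (ψ (τ + 1)))

lemma flowData {f ξ : ℝ → ℝ} {φ : ℝ → ℝ → ℝ} (hfd : Differentiable ℝ f) (hf0 : f 0 = 0)
    (hξ1 : ContDiffOn ℝ 1 ξ (Icc (0 : ℝ) 1)) (hflow : IsFlowOn ξ φ 0 1)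
    (htime1 : ∀ x ∈ Icc (0 : ℝ) 1, φ 1 x = f x) : ∃ K, FlowData f ξ K := by
  obtain ⟨K, hK, hE⟩ := flow_exp hξ1 hflow
  have hle : ∀ x ∈ Icc (0:ℝ) 1, |ξ x| ≤ Real.exp K * |f x - x| := by
    intro x hx
    obtain ⟨E, h1, h2⟩ := hE x hx
    obtain ⟨c, hc, hce⟩ := exists_hasDerivAt_eq_slope (fun t => φ t x) (fun t => ξ (φ t x))
      zero_lt_one (fun t _ => (hflow.2 x hx t).2.continuousAt.continuousWithinAt)
      (fun t _ => (hflow.2 x hx t).2)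
    simp only [htime1 x hx, hflow.1 x hx, sub_zero, div_one] at hce
    rw [← hce, h1 c, abs_mul, Real.abs_exp]
    have h3 := (abs_le.1 (h2 c ⟨hc.1.le, hc.2.le⟩)).1
    have h4 : 1 ≤ Real.exp K * Real.exp (E c) := by
      rw [← Real.exp_add]; exact Real.one_le_exp (by linarith)
    nlinarith [abs_nonneg (ξ x)]
  have hzero : ∀ x ∈ Icc (0:ℝ) 1, ξ x = 0 → f x = x := by
    intro x hx hx0
    obtain ⟨E, h1, h2⟩ := hE x hx
    obtain ⟨c, hc, hce⟩ := exists_hasDerivAt_eq_slope (fun t => φ t x) (fun t => ξ (φ t x))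
      zero_lt_one (fun t _ => (hflow.2 x hx t).2.continuousAt.continuousWithinAt)
      (fun t _ => (hflow.2 x hx t).2)
    simp only [htime1 x hx, hflow.1 x hx, sub_zero, div_one] at hce
    rw [h1 c, hx0, zero_mul] at hce
    linarith
  have hξ0 : ξ 0 = 0 := by
    have := hle 0 (by simp)
    simpa [hf0] using this
  have hgrp : ∀ x ∈ Icc (0:ℝ) 1, ∀ t, f (φ t x) = φ (1 + t) x := fun x hx t => by
    rw [← htime1 _ (hflow.2 x hx t).1, flow_group hξ1 hflow hx]
  refine ⟨Real.exp K, Real.exp_pos K, hle, hzero, ?_, ?_⟩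
  · intro x hx
    have hx' := Ioo_subset_Icc_self hx
    have h1 : HasDerivAt (fun t => f (φ t x)) (deriv f x * ξ x) 0 := by
      have h0 := (hflow.2 x hx' 0).2
      have hd : HasDerivAt f (deriv f x) (φ 0 x) := by
        rw [hflow.1 x hx']; exact (hfd x).hasDerivAt
      have := hd.comp 0 h0
      rwa [hflow.1 x hx'] at this
    have h2 : HasDerivAt (fun t => f (φ t x)) (ξ (f x)) 0 := by
      have h0 := (hflow.2 x hx' (1 + 0)).2.comp_const_add 1 0
      simp only [hgrp x hx']
      simpa [htime1 x hx'] using h0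
    exact h2.unique h1
  · intro x hx hne
    have hx' := Ioo_subset_Icc_self hx
    obtain ⟨E, h1, -⟩ := hE x hx'
    obtain ⟨s, hs1, hs2⟩ : ∃ s : ℝ, (s = 1 ∨ s = -1) ∧ s * ξ x < 0 := by
      rcases lt_or_gt_of_ne hne with h | h
      · exact ⟨1, Or.inl rfl, by linarith⟩
      · exact ⟨-1, Or.inr rfl, by linarith⟩
    have hder : ∀ τ, HasDerivAt (fun τ => φ (s * τ) x) (s * ξ (φ (s * τ) x)) τ := by
      intro τ
      have h0 := (hflow.2 x hx' (s * τ)).2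
      have := h0.comp τ ((hasDerivAt_id τ).const_mul s)
      have e : s * ξ (φ (s * τ) x) = ξ (φ (s * τ) x) * (s * 1) := by ring
      rw [e]; exact this
    have hanti : Antitone (fun τ => φ (s * τ) x) := by
      apply antitone_of_deriv_nonpos (fun τ => (hder τ).differentiableAt)
      intro τ
      rw [(hder τ).deriv, h1, ← mul_assoc]
      exact (mul_neg_of_neg_of_pos hs2 (Real.exp_pos _)).le
    refine ⟨s, fun τ => φ (s * τ) x, ?_, ?_, ?_, hanti, fun τ => (hflow.2 x hx' _).1.1, hder, ?_⟩
    · rcases hs1 with rfl | rfl <;> simp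
    · simp [hflow.1 x hx']
    · intro τ hτ
      refine ⟨lt_of_le_of_ne (hflow.2 x hx' _).1.1 fun h => ?_, ?_⟩
      · have := h1 (s * τ)
        have h : 0 = φ (s * τ) x := h
        rw [← h, hξ0] at this
        have := this.symm
        simp [hne] at this
      · have := hanti hτ
        simpa [hflow.1 x hx'] using this
    · rcases hs1 with rfl | rfl
      · left; intro τ; simp only [one_mul]; rw [hgrp x hx', add_comm]
      · right; intro τ
        have e : -1 * τ = 1 + -1 * (τ + 1) := by ring
        simp only []
        rw [hgrp x hx', ← e]
section Main
open Filter Topology Asymptotics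

def BigW (N : ℝ → ℝ) (w : ℕ) (h : ℝ → ℝ) : Prop :=
  ∀ η : ℝ, 0 < η → h =O[𝓝[>] (0:ℝ)] fun x => N x ^ ((w:ℝ) - η)

noncomputable def Lop (ξ h : ℝ → ℝ) : ℝ → ℝ := fun x => ξ x * deriv h x

def Scl (ξ N : ℝ → ℝ) : ℕ → ℕ → (ℝ → ℝ) → Prop
  | 0, _, h => ContDiffOn ℝ (⊤ : ℕ∞) h (Ioo 0 1)
  | m + 1, w, h => ContDiffOn ℝ (⊤ : ℕ∞) h (Ioo 0 1) ∧ BigW N w h ∧ Scl ξ N m (w + 1) (Lop ξ h)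

structure GoodN (N : ℝ → ℝ) : Prop where
  pos : ∀ᶠ x in 𝓝[>] (0:ℝ), 0 < N x
  lim : Tendsto N (𝓝[>] (0:ℝ)) (𝓝 0)

section Calculus
variable {ξ N h k : ℝ → ℝ} {m w v : ℕ}

lemma GoodN.le_one (hN : GoodN N) : ∀ᶠ x in 𝓝[>] (0:ℝ), N x ≤ 1 :=
  hN.lim.eventually (eventually_le_nhds zero_lt_one)

lemma GoodN.rpow_bigO (hN : GoodN N) {a b : ℝ} (hab : b ≤ a) :
    (fun x => N x ^ a) =O[𝓝[>] (0:ℝ)] fun x => N x ^ b := by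
  apply IsBigO.of_bound 1
  filter_upwards [hN.pos, hN.le_one] with x h1 h2
  rw [one_mul, Real.norm_of_nonneg (by positivity), Real.norm_of_nonneg (by positivity)]
  exact Real.rpow_le_rpow_of_exponent_ge h1 h2 hab

lemma Ioo_ev : ∀ᶠ x in 𝓝[>] (0:ℝ), x ∈ Ioo (0:ℝ) 1 := Ioo_mem_nhdsGT zero_lt_one

lemma BigW.congr (hb : BigW N w h) (he : EqOn h k (Ioo 0 1)) : BigW N w k := fun η hη =>
  (hb η hη).congr' (Ioo_ev.mono fun _ hx => he hx) EventuallyEq.rfl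

lemma BigW.add (h1 : BigW N w h) (h2 : BigW N w k) : BigW N w (fun x => h x + k x) :=
  fun η hη => (h1 η hη).add (h2 η hη)

lemma BigW.const_mul (c : ℝ) (h1 : BigW N w h) : BigW N w (fun x => c * h x) :=
  fun η hη => (h1 η hη).const_mul_left c

lemma BigW.mul (hN : GoodN N) (h1 : BigW N w h) (h2 : BigW N v k) :
    BigW N (w + v) (fun x => h x * k x) := fun η hη => by
  refine ((h1 (η / 2) (by linarith)).mul (h2 (η / 2) (by linarith))).congr' EventuallyEq.rfl ?_
  filter_upwards [hN.pos] with x hx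
  rw [← Real.rpow_add hx]; congr 1; push_cast; ring

lemma BigW.weaken (hN : GoodN N) (h1 : BigW N (w + 1) h) : BigW N w h := fun η hη =>
  (h1 η hη).trans (hN.rpow_bigO (by push_cast; linarith))

lemma Scl.smooth (hs : Scl ξ N m w h) : ContDiffOn ℝ (⊤ : ℕ∞) h (Ioo 0 1) := by
  cases m with
  | zero => exact hs
  | succ m => exact hs.1

lemma smooth_deriv (hs : ContDiffOn ℝ (⊤ : ℕ∞) h (Ioo 0 1)) :
    ContDiffOn ℝ (⊤ : ℕ∞) (deriv h) (Ioo 0 1) :=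
  hs.deriv_of_isOpen isOpen_Ioo (by simp)

lemma smooth_diffAt (hs : ContDiffOn ℝ (⊤ : ℕ∞) h (Ioo 0 1)) {x : ℝ} (hx : x ∈ Ioo (0:ℝ) 1) :
    DifferentiableAt ℝ h x :=
  (hs.differentiableOn (by simp)).differentiableAt (isOpen_Ioo.mem_nhds hx)

lemma Lop_congr (he : EqOn h k (Ioo 0 1)) : EqOn (Lop ξ h) (Lop ξ k) (Ioo 0 1) := by
  intro x hx
  have : h =ᶠ[𝓝 x] k := he.eventuallyEq_of_mem (isOpen_Ioo.mem_nhds hx)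
  simp only [Lop, this.deriv_eq]

lemma Scl.congr (hs : Scl ξ N m w h) (he : EqOn h k (Ioo 0 1)) : Scl ξ N m w k := by
  induction m generalizing w h k with
  | zero => exact ContDiffOn.congr hs fun x hx => (he hx).symm
  | succ m ih =>
    exact ⟨hs.1.congr fun x hx => (he hx).symm, hs.2.1.congr he, ih hs.2.2 (Lop_congr he)⟩

lemma Scl.mono (hs : Scl ξ N (m + 1) w h) : Scl ξ N m w h := by
  induction m generalizing w h with
  | zero => exact hs.1
  | succ m ih => exact ⟨hs.1, hs.2.1, ih hs.2.2⟩

lemma Scl.weaken (hN : GoodN N) (hs : Scl ξ N m (w + 1) h) : Scl ξ N m w h := by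
  induction m generalizing w h with
  | zero => exact hs
  | succ m ih => exact ⟨hs.1, hs.2.1.weaken hN, ih hs.2.2⟩

lemma Scl.add (h1 : Scl ξ N m w h) (h2 : Scl ξ N m w k) : Scl ξ N m w (fun x => h x + k x) := by
  induction m generalizing w h k with
  | zero => exact ContDiffOn.add h1 h2
  | succ m ih =>
    refine ⟨h1.1.add h2.1, h1.2.1.add h2.2.1, (ih h1.2.2 h2.2.2).congr fun x hx => ?_⟩
    simp only [Lop]
    rw [deriv_fun_add (smooth_diffAt h1.1 hx) (smooth_diffAt h2.1 hx)]; ring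

lemma Scl.const_mul (c : ℝ) (h1 : Scl ξ N m w h) : Scl ξ N m w (fun x => c * h x) := by
  induction m generalizing w h with
  | zero => exact contDiffOn_const.mul h1
  | succ m ih =>
    refine ⟨contDiffOn_const.mul h1.1, h1.2.1.const_mul c, (ih h1.2.2).congr fun x hx => ?_⟩
    simp only [Lop]
    rw [deriv_const_mul_field]; ring

lemma Scl.mul (hN : GoodN N) (h1 : Scl ξ N m w h) (h2 : Scl ξ N m v k) :
    Scl ξ N m (w + v) (fun x => h x * k x) := by
  induction m generalizing w v h k with
  | zero => exact ContDiffOn.mul h1 h2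
  | succ m ih =>
    refine ⟨h1.1.mul h2.1, h1.2.1.mul hN h2.2.1, ?_⟩
    have e1 := ih h1.2.2 h2.mono
    have e2 := ih h1.mono h2.2.2
    rw [show w + 1 + v = w + v + 1 by ring] at e1
    rw [show w + (v + 1) = w + v + 1 by ring] at e2
    refine (e1.add e2).congr fun x hx => ?_
    simp only [Lop]
    rw [deriv_fun_mul (smooth_diffAt h1.1 hx) (smooth_diffAt h2.1 hx)]; ring

lemma Lop_smooth (hξ : ContDiffOn ℝ (⊤ : ℕ∞) ξ (Ioo 0 1)) (hs : ContDiffOn ℝ (⊤ : ℕ∞) h (Ioo 0 1)) :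
    ContDiffOn ℝ (⊤ : ℕ∞) (Lop ξ h) (Ioo 0 1) := hξ.mul (smooth_deriv hs)

lemma Lop_iter_smooth (hξ : ContDiffOn ℝ (⊤ : ℕ∞) ξ (Ioo 0 1))
    (hs : ContDiffOn ℝ (⊤ : ℕ∞) h (Ioo 0 1)) (j : ℕ) :
    ContDiffOn ℝ (⊤ : ℕ∞) ((Lop ξ)^[j] h) (Ioo 0 1) := by
  induction j with
  | zero => exact hs
  | succ j ih => rw [Function.iterate_succ_apply']; exact Lop_smooth hξ ih

lemma Scl.succ_of (hξ : ContDiffOn ℝ (⊤ : ℕ∞) ξ (Ioo 0 1)) (hs : Scl ξ N m w h)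
    (hb : BigW N (w + m) ((Lop ξ)^[m] h)) : Scl ξ N (m + 1) w h := by
  induction m generalizing w h with
  | zero => exact ⟨hs, hb, Lop_smooth hξ hs⟩
  | succ m ih =>
    refine ⟨hs.1, hs.2.1, ih hs.2.2 ?_⟩
    rw [Function.iterate_succ_apply] at hb
    rwa [show w + 1 + m = w + (m + 1) by ring]

lemma Scl.last (hs : Scl ξ N (m + 1) w h) : BigW N (w + m) ((Lop ξ)^[m] h) := by
  induction m generalizing w h with
  | zero => exact hs.2.1
  | succ m ih =>
    rw [Function.iterate_succ_apply, show w + (m + 1) = w + 1 + m by ring]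
    exact ih hs.2.2

/-- `ξ` belongs to the class of weight 1. -/
lemma Scl.xi (hN : GoodN N) (hξ : ContDiffOn ℝ (⊤ : ℕ∞) ξ (Ioo 0 1)) (hb : BigW N 1 ξ)
    (hu : Scl ξ N m 1 (deriv ξ)) : Scl ξ N (m + 1) 1 ξ := by
  induction m with
  | zero => exact ⟨hξ, hb, Lop_smooth hξ hξ⟩
  | succ m ih =>
    refine ⟨hξ, hb, ?_⟩
    exact (ih hu.mono).mul hN hu

/-- the iterated derivatives of a function whose derivatives are all of weight `1` -/
lemma Scl.derivs (hN : GoodN N) (hξ : Scl ξ N m 1 ξ) {G : ℕ → ℝ → ℝ}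
    (hG : ∀ i, ContDiffOn ℝ (⊤ : ℕ∞) (G i) (Ioo 0 1)) (hGd : ∀ i, G (i + 1) = deriv (G i))
    (hGb : ∀ i, BigW N 1 (G i)) (hξs : ContDiffOn ℝ (⊤ : ℕ∞) ξ (Ioo 0 1)) (i : ℕ) :
    Scl ξ N (m + 1) 1 (G i) := by
  induction m generalizing i with
  | zero => exact ⟨hG i, hGb i, Lop_smooth hξs (hG i)⟩
  | succ m ih =>
    refine ⟨hG i, hGb i, ?_⟩
    have := hξ.mul hN (ih hξ.mono (i + 1))
    rwa [hGd] at this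

lemma Scl.recip (hN : GoodN N) {q g2 : ℝ → ℝ} (hq : ContDiffOn ℝ (⊤ : ℕ∞) q (Ioo 0 1))
    (hq0 : ∀ x ∈ Ioo (0:ℝ) 1, q x ≠ 0) (hg2 : EqOn (deriv q) g2 (Ioo 0 1))
    (hb : BigW N 0 (fun x => (q x)⁻¹)) (hξs : ContDiffOn ℝ (⊤ : ℕ∞) ξ (Ioo 0 1))
    (hξ : Scl ξ N m 1 ξ) (hg : Scl ξ N m 1 g2) :
    Scl ξ N (m + 1) 0 (fun x => (q x)⁻¹) := by
  have hsm : ContDiffOn ℝ (⊤ : ℕ∞) (fun x => (q x)⁻¹) (Ioo 0 1) := hq.inv hq0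
  induction m with
  | zero => exact ⟨hsm, hb, Lop_smooth hξs hsm⟩
  | succ m ih =>
    refine ⟨hsm, hb, ?_⟩
    have h1 := ih hξ.mono hg.mono
    have h2 := ((((hξ.mul hN hg).weaken hN).mul hN h1).mul hN h1).const_mul (-1)
    refine h2.congr fun x hx => ?_
    have hd := (smooth_diffAt hq hx).hasDerivAt.inv (hq0 x hx)
    have e : deriv (fun x => (q x)⁻¹) x = -deriv q x / q x ^ 2 := hd.deriv
    simp only [Lop]
    rw [e, hg2 hx]
    have := hq0 x hx
    field_simp

noncomputable def Top' (ξ h : ℝ → ℝ) : ℝ → ℝ := fun x => Lop ξ h x + deriv ξ x * h x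

lemma Scl.top_iter (hN : GoodN N) (hu : Scl ξ N m 1 (deriv ξ)) (hh : Scl ξ N (m + 1) w h) :
    BigW N (w + m) ((Top' ξ)^[m] h) := by
  induction m generalizing w h with
  | zero => exact hh.2.1
  | succ m ih =>
    have h1 := hu.mul hN hh.mono
    rw [add_comm 1 w] at h1
    have h2 : Scl ξ N (m + 1) (w + 1) (Top' ξ h) := hh.2.2.add h1
    have := ih hu.mono h2
    rwa [show w + 1 + m = w + (m + 1) by ring] at this

/-- final conversion: `ξ^{n-1} D^n ξ` -/
lemma Scl.final (hN : GoodN N) (hξs : ContDiffOn ℝ (⊤ : ℕ∞) ξ (Ioo 0 1))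
    (hu : ∀ m, Scl ξ N m 1 (deriv ξ)) (n : ℕ) :
    ∀ m, Scl ξ N m (n + 1) (fun x => ξ x ^ n * iteratedDeriv (n + 1) ξ x) := by
  induction n with
  | zero => intro m; simpa using hu m
  | succ n ih =>
    intro m
    have h1 := (ih (m + 1)).2.2
    have h2 := ((hu m).mul hN (ih m)).const_mul (-(n:ℝ))
    rw [show 1 + (n + 1) = n + 1 + 1 by ring] at h2
    refine (h1.add h2).congr fun x hx => ?_
    have hsm : ContDiffOn ℝ (⊤ : ℕ∞) (iteratedDeriv (n + 1) ξ) (Ioo 0 1) := by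
      have : ∀ i, ContDiffOn ℝ (⊤ : ℕ∞) (iteratedDeriv i ξ) (Ioo 0 1) := by
        intro i
        induction i with
        | zero => simpa using hξs
        | succ i ihi => rw [iteratedDeriv_succ]; exact smooth_deriv ihi
      exact this _
    have hd := ((smooth_diffAt hξs hx).hasDerivAt.pow n).mul (smooth_diffAt hsm hx).hasDerivAt
    have e : deriv (fun x => ξ x ^ n * iteratedDeriv (n + 1) ξ x) x = _ := hd.deriv
    simp only [Lop]
    rw [e, iteratedDeriv_succ (n := n + 1)]
    simp only [Pi.pow_apply]
    rcases n with _ | n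
    · simp
    · simp only [Nat.add_sub_cancel]; push_cast; ring
end Calculus
/-- the standing assumptions, without the flow -/
structure Ctx (f ξ : ℝ → ℝ) (K : ℝ) : Prop where
  fd : FlowData f ξ K
  fs : ContDiff ℝ (⊤ : ℕ∞) f
  fpos : ∀ x ∈ Icc (0:ℝ) 1, 0 < deriv f x
  fmaps : MapsTo f (Ioo 0 1) (Ioo 0 1)
  flat : Flat (fun x => f x - x)
  xi1 : ContDiffOn ℝ 1 ξ (Icc (0 : ℝ) 1)
  xis : ContDiffOn ℝ (⊤ : ℕ∞) ξ (Ioo (0 : ℝ) 1)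
  npos : ∀ x, 0 < x → 0 < supA (fun x => f x - x) x

noncomputable def Nn (f : ℝ → ℝ) : ℝ → ℝ := supA (fun x => f x - x)

noncomputable def Fp (f : ℝ → ℝ) : ℝ → ℝ := fun x => deriv (deriv f) x * (deriv f x)⁻¹

noncomputable def Uj (ξ : ℝ → ℝ) (j : ℕ) : ℝ → ℝ := (Lop ξ)^[j] (deriv ξ)

noncomputable def Rj (f ξ : ℝ → ℝ) (j : ℕ) : ℝ → ℝ := (Top' ξ)^[j] (Fp f)

section Core
variable {f ξ : ℝ → ℝ} {K : ℝ}

lemma Ctx.goodN (hc : Ctx f ξ K) : GoodN (Nn f) := by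
  refine ⟨?_, ?_⟩
  · filter_upwards [self_mem_nhdsWithin] with x hx using hc.npos x hx
  · rw [Metric.tendsto_nhds]
    intro ε hε
    have h1 : ∀ᶠ y in 𝓝 (0:ℝ), |f y - y| < ε / 2 := by
      have := (hc.flat.cont.tendsto 0).abs
      rw [hc.flat.zero, abs_zero] at this
      exact this.eventually (gt_mem_nhds (by linarith))
    obtain ⟨δ, hδ, hb⟩ := Metric.eventually_nhds_iff.1 h1
    filter_upwards [Ioo_mem_nhdsGT hδ] with x hx
    have h2 : Nn f x ≤ ε / 2 := supA_le hx.1.le fun y h0 hy => (hb (by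
      rw [Real.dist_eq, sub_zero, abs_of_nonneg h0]; linarith [hx.2])).le
    have h3 : 0 ≤ Nn f x := supA_nonneg hc.flat.cont hx.1.le
    rw [Real.dist_eq, sub_zero, abs_of_nonneg h3]; linarith

/-- the iterated derivatives of `f - id` have weight one -/
lemma Ctx.big_g (hc : Ctx f ξ K) (i : ℕ) : 
    BigW (Nn f) 1 (fun x => supA (deriv^[i] (fun x => f x - x)) x) := by
  intro η hη
  have ht : Tendsto (fun m : ℕ => ((m:ℝ) / (m + 1)) ^ i) atTop (𝓝 1) := by
    have := (tendsto_natCast_div_add_atTop (1:ℝ)).pow i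
    simpa using this
  obtain ⟨m, hm⟩ := (ht.eventually (lt_mem_nhds (show 1 - η < 1 by linarith))).exists
  obtain ⟨C, hC, hb⟩ := interp_iter m hc.flat i
  refine IsBigO.trans (g := fun x => Nn f x ^ (((m:ℝ) / (m + 1)) ^ i)) ?_
    (hc.goodN.rpow_bigO (by push_cast; exact hm.le))
  apply IsBigO.of_bound C
  filter_upwards [Ioo_ev, hc.goodN.pos] with x hx hp
  have hfl : Flat (deriv^[i] (fun x => f x - x)) := by
    clear hb hm ht
    induction i with
    | zero => exact hc.flat
    | succ i ih => rw [Function.iterate_succ_apply']; exact ih.deriv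
  rw [Real.norm_of_nonneg (supA_nonneg hfl.cont hx.1.le), Real.norm_of_nonneg (by positivity)]
  exact hb x hx.1.le hx.2.le

lemma Ctx.flat_iter (hc : Ctx f ξ K) (i : ℕ) : Flat (deriv^[i] (fun x => f x - x)) := by
  induction i with
  | zero => exact hc.flat
  | succ i ih => rw [Function.iterate_succ_apply']; exact ih.deriv

lemma Ctx.big_g' (hc : Ctx f ξ K) (i : ℕ) : 
    BigW (Nn f) 1 (deriv^[i] (fun x => f x - x)) := by
  intro η hη
  refine IsBigO.trans ?_ (hc.big_g i η hη)
  apply IsBigO.of_bound 1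
  filter_upwards [Ioo_ev] with x hx
  rw [one_mul]
  exact (le_supA (hc.flat_iter i).cont hx.1.le le_rfl).trans (le_abs_self _)

lemma Ctx.big_xi (hc : Ctx f ξ K) : BigW (Nn f) 1 ξ := by
  intro η hη
  refine IsBigO.trans ?_ (hc.big_g' 0 η hη)
  apply IsBigO.of_bound K
  filter_upwards [Ioo_ev] with x hx
  exact hc.fd.le x (Ioo_subset_Icc_self hx)

lemma Ctx.big_R (hc : Ctx f ξ K) {j : ℕ} (hu : Scl ξ (Nn f) j 1 (deriv ξ)) :
    BigW (Nn f) (j + 1) (Rj f ξ j) := by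
  have hN := hc.goodN
  have hξ := Scl.xi hN hc.xis hc.big_xi hu
  have hG := Scl.derivs hN hξ.mono (G := fun i => deriv^[i] (fun x => f x - x))
    (fun i => (hc.flat_iter i).1.contDiffOn) (fun i => Function.iterate_succ_apply' _ _ _)
    hc.big_g' hc.xis 2
  have hfd : Differentiable ℝ f := hc.fs.differentiable (by simp)
  have e1 : deriv (fun x => f x - x) = fun x => deriv f x - 1 := by
    ext x; rw [deriv_fun_sub (hfd x) differentiableAt_fun_id]; simp
  have e2 : deriv^[2] (fun x => f x - x) = deriv (deriv f) := by
    simp only [Function.iterate_succ, Function.iterate_zero, Function.comp, id, e1]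
    ext x; rw [deriv_sub_const]
  simp only [e2] at hG
  have hds : ContDiff ℝ (⊤ : ℕ∞) (deriv f) := ((contDiff_infty_iff_deriv).1 hc.fs).2
  have hrb : BigW (Nn f) 0 (fun x => (deriv f x)⁻¹) := by
    intro η hη
    have h1 : (fun x => (deriv f x)⁻¹) =O[𝓝[>] (0:ℝ)] fun _ => (1:ℝ) := by
      have h0 := hc.fpos 0 (by simp)
      have : Tendsto (fun x => (deriv f x)⁻¹) (𝓝[>] (0:ℝ)) (𝓝 (deriv f 0)⁻¹) :=
        ((hds.continuous.tendsto 0).mono_left nhdsWithin_le_nhds).inv₀ h0.ne'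
      exact this.isBigO_one ℝ
    refine h1.trans ?_
    have := hN.rpow_bigO (a := 0) (b := ((0:ℕ):ℝ) - η) (by push_cast; linarith)
    simpa using this
  have hr := Scl.recip hN hds.contDiffOn
    (fun x hx => (hc.fpos x (Ioo_subset_Icc_self hx)).ne') (fun _ _ => rfl) hrb hc.xis
    hξ.mono hG.mono
  have hF : Scl ξ (Nn f) (j + 1) (1 + 0) (Fp f) := hG.mul hN hr
  have := Scl.top_iter hN hu hF
  rwa [show 1 + 0 + j = j + 1 by ring] at this

lemma Ctx.U_smooth (hc : Ctx f ξ K) (j : ℕ) : ContDiffOn ℝ (⊤ : ℕ∞) (Uj ξ j) (Ioo 0 1) :=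
  Lop_iter_smooth hc.xis (smooth_deriv hc.xis) j

lemma Ctx.R_smooth (hc : Ctx f ξ K) (j : ℕ) : ContDiffOn ℝ (⊤ : ℕ∞) (Rj f ξ j) (Ioo 0 1) := by
  have hds : ContDiff ℝ (⊤ : ℕ∞) (deriv f) := ((contDiff_infty_iff_deriv).1 hc.fs).2
  have hdds : ContDiff ℝ (⊤ : ℕ∞) (deriv (deriv f)) := ((contDiff_infty_iff_deriv).1 hds).2
  induction j with
  | zero => exact hdds.contDiffOn.mul (hds.contDiffOn.inv
      (fun x hx => (hc.fpos x (Ioo_subset_Icc_self hx)).ne'))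
  | succ j ih =>
    unfold Rj
    rw [Function.iterate_succ_apply']
    exact (Lop_smooth hc.xis ih).add ((smooth_deriv hc.xis).mul ih)

/-- cohomological equation -/
lemma Ctx.cohom (hc : Ctx f ξ K) (j : ℕ) : ∀ x ∈ Ioo (0:ℝ) 1,
    Uj ξ j (f x) = Uj ξ j x + ξ x * Rj f ξ j x := by
  have hds : ContDiff ℝ (⊤ : ℕ∞) (deriv f) := ((contDiff_infty_iff_deriv).1 hc.fs).2
  have hfd : ∀ x, HasDerivAt f (deriv f x) x := fun x =>
    (hc.fs.differentiable (by simp) x).hasDerivAt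
  induction j with
  | zero =>
    intro x hx
    have h1 := (smooth_diffAt hc.xis (hc.fmaps hx)).hasDerivAt.comp x (hfd x)
    have h2 := ((hds.differentiable (by simp)) x).hasDerivAt.mul (smooth_diffAt hc.xis hx).hasDerivAt
    have he : (ξ ∘ f) =ᶠ[𝓝 x] deriv f * ξ := by
      filter_upwards [isOpen_Ioo.mem_nhds hx] with y hy using hc.fd.conj y hy
    have h3 := (h1.congr_of_eventuallyEq he.symm).unique h2
    have hp := (hc.fpos x (Ioo_subset_Icc_self hx)).ne'
    simp only [Uj, Rj, Function.iterate_zero, id, Fp]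
    field_simp
    linarith
  | succ j ih =>
    intro x hx
    have h1 := (smooth_diffAt (hc.U_smooth j) (hc.fmaps hx)).hasDerivAt.comp x (hfd x)
    have h2 := (smooth_diffAt (hc.U_smooth j) hx).hasDerivAt.add
      ((smooth_diffAt hc.xis hx).hasDerivAt.mul (smooth_diffAt (hc.R_smooth j) hx).hasDerivAt)
    have he : (Uj ξ j ∘ f) =ᶠ[𝓝 x] Uj ξ j + ξ * Rj f ξ j := by
      filter_upwards [isOpen_Ioo.mem_nhds hx] with y hy using ih y hy
    have h3 := (h1.congr_of_eventuallyEq he.symm).unique h2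
    have e1 : ∀ y, Uj ξ (j + 1) y = ξ y * deriv (Uj ξ j) y := fun y => by
      unfold Uj; rw [Function.iterate_succ_apply']; rfl
    have e2 : Rj f ξ (j + 1) x = ξ x * deriv (Rj f ξ j) x + deriv ξ x * Rj f ξ j x := by
      unfold Rj; rw [Function.iterate_succ_apply']; rfl
    rw [e1, e1, e2, hc.fd.conj x hx]
    linear_combination ξ x * h3

/-- comparison of the derivatives of `ξ` and `f - id` at a zero -/
lemma Ctx.deriv_zero (hc : Ctx f ξ K) {p : ℝ} (hp : p ∈ Icc (0:ℝ) 1) (h0 : f p = p) :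
    |derivWithin ξ (Icc 0 1) p| ≤ K * |deriv (fun x => f x - x) p| := by
  have hξ0 : ξ p = 0 := by simpa [h0] using hc.fd.le p hp
  have h1 : HasDerivWithinAt ξ (derivWithin ξ (Icc 0 1) p) (Icc 0 1) p :=
    (hc.xi1.differentiableOn (by simp) p hp).hasDerivWithinAt
  have h2 : HasDerivWithinAt (fun x => f x - x) (deriv (fun x => f x - x) p) (Icc 0 1) p :=
    (hc.flat.diff p).hasDerivAt.hasDerivWithinAt
  rw [hasDerivWithinAt_iff_tendsto_slope] at h1 h2
  have hne : (𝓝[Icc (0:ℝ) 1 \ {p}] p).NeBot := by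
    have := (uniqueDiffOn_Icc (zero_lt_one (α := ℝ)) p hp).accPt
    rw [accPt_principal_iff_nhdsWithin] at this
    exact this
  refine le_of_tendsto_of_tendsto h1.abs (h2.abs.const_mul K) ?_
  filter_upwards [self_mem_nhdsWithin] with y hy
  have := hc.fd.le y hy.1
  simp only [slope_def_field, hξ0, h0, sub_self, sub_zero, abs_div]
  rw [← mul_div_assoc]
  gcongr

lemma deriv_bound {W u : ℝ → ℝ} {s B c : ℝ} (hs : |s| = 1)
    (hW : ∀ τ, 0 ≤ τ → HasDerivAt W (s * u τ) τ)
    (hu : ∀ τ, 0 ≤ τ → ∀ k : ℕ, |u (τ + k) - u τ| ≤ B)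
    (hlim : Tendsto W atTop (𝓝 c)) : |u 0| ≤ B := by
  have key : ∀ h, 0 ≤ h → |W h - W 0| ≤ B * h := by
    intro h hh
    have hk : ∀ k : ℕ, |(W (h + k) - W h) - (W (0 + k) - W 0)| ≤ B * h := by
      intro k
      have := (convex_Ici (0:ℝ)).norm_image_sub_le_of_norm_hasDerivWithin_le
        (f := fun σ => W (σ + k) - W σ) (f' := fun σ => s * u (σ + k) - s * u σ) (C := B)
        (x := 0) (y := h) (fun σ hσ => ?_) (fun σ hσ => ?_) (by simp) hh
      · simpa [abs_of_nonneg hh] using this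
      · have hσ : 0 ≤ σ := hσ
        have h1 := (hW (σ + k) (by positivity)).comp_add_const σ k
        exact (h1.sub (hW σ hσ)).hasDerivWithinAt
      · rw [← mul_sub, norm_mul, Real.norm_eq_abs, hs, one_mul]
        exact hu σ hσ k
    have hl : ∀ a : ℝ, Tendsto (fun k : ℕ => W (a + k)) atTop (𝓝 c) := fun a =>
      hlim.comp (tendsto_atTop_add_const_left _ a tendsto_natCast_atTop_atTop)
    have h2 := (((hl h).sub_const (W h)).sub ((hl 0).sub_const (W 0))).abs
    have h3 := le_of_tendsto h2 (Eventually.of_forall hk)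
    rw [show c - W h - (c - W 0) = -(W h - W 0) by ring, abs_neg] at h3
    exact h3
  have h1 := (hW 0 le_rfl).hasDerivWithinAt (s := Ici 0)
  rw [hasDerivWithinAt_iff_tendsto_slope] at h1
  have h2 := h1.abs
  rw [abs_mul, hs, one_mul] at h2
  have hne : (𝓝[Ici (0:ℝ) \ {0}] 0).NeBot := by
    rw [Ici_sdiff_left]; infer_instance
  refine le_of_tendsto h2 ?_
  filter_upwards [self_mem_nhdsWithin] with y hy
  have hy0 : 0 < y := lt_of_le_of_ne hy.1 (Ne.symm hy.2)
  rw [slope_def_field, abs_div, sub_zero, abs_of_pos hy0, div_le_iff₀ hy0]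
  exact key y hy0.le
end Core
section Step
variable {f ξ : ℝ → ℝ} {K : ℝ}

lemma Ctx.orbit_bound (hc : Ctx f ξ K) (j : ℕ) {x B : ℝ} (hx : x ∈ Ioo (0:ℝ) 1)
    (hB : ∀ y ∈ Ioc 0 x, K * |Rj f ξ j y| ≤ B) {ψ : ℝ → ℝ}
    (hψ : ∀ τ, 0 ≤ τ → ψ τ ∈ Ioc 0 x) (hanti : Antitone ψ)
    (hf : (∀ τ, ψ (τ + 1) = f (ψ τ)) ∨ ∀ τ, ψ τ = f (ψ (τ + 1))) :
    ∀ τ, 0 ≤ τ → ∀ k : ℕ, |Uj ξ j (ψ (τ + k)) - Uj ξ j (ψ τ)| ≤ B := by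
  have hB0 : 0 ≤ B := (mul_nonneg hc.fd.hK.le (abs_nonneg _)).trans (hB x ⟨hx.1, le_rfl⟩)
  have base : ∀ m ∈ Ioc 0 x, |Uj ξ j (f m) - Uj ξ j m| ≤ B * |f m - m| := by
    intro m hm
    have hm1 : m ∈ Ioo (0:ℝ) 1 := ⟨hm.1, hm.2.trans_lt hx.2⟩
    rw [hc.cohom j m hm1, add_sub_cancel_left, abs_mul]
    calc |ξ m| * |Rj f ξ j m| ≤ (K * |f m - m|) * |Rj f ξ j m| := by
          gcongr; exact hc.fd.le m (Ioo_subset_Icc_self hm1)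
      _ = (K * |Rj f ξ j m|) * |f m - m| := by ring
      _ ≤ _ := by gcongr; exact hB m hm
  have one : ∀ τ, 0 ≤ τ → |Uj ξ j (ψ (τ + 1)) - Uj ξ j (ψ τ)| ≤ B * (ψ τ - ψ (τ + 1)) := by
    intro τ hτ
    have hle : ψ (τ + 1) ≤ ψ τ := hanti (by linarith)
    rcases hf with h | h
    · have := base _ (hψ τ hτ)
      rw [← h, abs_sub_comm (ψ (τ + 1)), abs_of_nonneg (sub_nonneg.2 hle)] at this
      exact this
    · have := base _ (hψ (τ + 1) (by linarith))
      rw [← h, abs_of_nonneg (sub_nonneg.2 hle), abs_sub_comm] at this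
      exact this
  intro τ hτ k
  have tele : |Uj ξ j (ψ (τ + k)) - Uj ξ j (ψ τ)| ≤ B * (ψ τ - ψ (τ + k)) := by
    induction k with
    | zero => simp
    | succ k ih =>
      have h1 := one (τ + k) (by positivity)
      push_cast
      rw [← add_assoc]
      have h2 := abs_sub_le (Uj ξ j (ψ (τ + k + 1))) (Uj ξ j (ψ (τ + k))) (Uj ξ j (ψ τ))
      linarith
  have h1 := hψ τ hτ
  have h2 := hψ (τ + k) (by positivity)
  calc _ ≤ _ := tele
    _ ≤ B * 1 := by gcongr; linarith [h1.2, h2.1, hx.2]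
    _ = B := mul_one B

lemma Ctx.orbit_limit (hc : Ctx f ξ K) {x : ℝ} (hx : x ∈ Ioo (0:ℝ) 1) {ψ : ℝ → ℝ}
    (hψ : ∀ τ, 0 ≤ τ → ψ τ ∈ Ioc 0 x) (hanti : Antitone ψ) (h0 : ∀ τ, 0 ≤ ψ τ)
    (hf : (∀ τ, ψ (τ + 1) = f (ψ τ)) ∨ ∀ τ, ψ τ = f (ψ (τ + 1))) :
    ∃ p, 0 ≤ p ∧ p ≤ x ∧ Tendsto ψ atTop (𝓝 p) ∧ f p = p := by
  have ht := tendsto_atTop_ciInf hanti ⟨0, by rintro _ ⟨τ, rfl⟩; exact h0 τ⟩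
  refine ⟨_, ge_of_tendsto' ht h0, le_of_tendsto ht ?_, ht, ?_⟩
  · filter_upwards [eventually_ge_atTop 0] with τ hτ using (hψ τ hτ).2
  · have ht1 := ht.comp (tendsto_atTop_add_const_right atTop (1:ℝ) tendsto_id)
    have hcf : Continuous f := hc.fs.continuous
    rcases hf with h | h
    · refine tendsto_nhds_unique ((hcf.tendsto _).comp ht) (ht1.congr fun τ => ?_)
      exact h τ
    · refine tendsto_nhds_unique ((hcf.tendsto _).comp ht1) (ht.congr fun τ => ?_)
      exact h τ

lemma Ctx.U0_eq (hc : Ctx f ξ K) {x : ℝ} (hx : x ∈ Ioo (0:ℝ) 1) :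
    Uj ξ 0 x = derivWithin ξ (Icc 0 1) x :=
  (derivWithin_of_mem_nhds (Icc_mem_nhds hx.1 hx.2)).symm

lemma BigW.of_small {N h : ℝ → ℝ} (hN : GoodN N) {w : ℕ}
    (H : ∀ η : ℝ, 0 < η → η < 1 → h =O[𝓝[>] (0:ℝ)] fun x => N x ^ ((w:ℝ) - η)) : BigW N w h := by
  intro η hη
  refine (H (min η (1/2)) (by positivity) ((min_le_right _ _).trans_lt (by norm_num))).trans
    (hN.rpow_bigO (by linarith [min_le_left η (1/2)]))

/-- extracting uniform bounds -/
lemma BigW.unif (hc : Ctx f ξ K) {h : ℝ → ℝ} {w : ℕ} (hb : BigW (Nn f) (w + 1) h) {η : ℝ}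
    (hη : 0 < η) (hη1 : η < 1) : ∃ C, 0 ≤ C ∧ ∀ᶠ x in 𝓝[>] (0:ℝ), ∀ y ∈ Ioc 0 x,
      |h y| ≤ C * Nn f x ^ (((w + 1 : ℕ):ℝ) - η) := by
  obtain ⟨C, hC, hb⟩ := (hb η hη).exists_nonneg
  refine ⟨C, hC, ?_⟩
  have := hb.bound
  rw [eventually_nhdsWithin_iff, Metric.eventually_nhds_iff] at this
  obtain ⟨δ, hδ, hb⟩ := this
  filter_upwards [Ioo_mem_nhdsGT hδ] with x hx y hy
  have h1 := hb (y := y) (by rw [Real.dist_eq, sub_zero, abs_of_pos hy.1]; linarith [hy.2, hx.2]) hy.1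
  have h2 : 0 ≤ Nn f y := supA_nonneg hc.flat.cont hy.1.le
  rw [Real.norm_eq_abs, Real.norm_of_nonneg (by positivity)] at h1
  refine h1.trans ?_
  have h3 : Nn f y ≤ Nn f x := supA_mono hc.flat.cont hy.1.le hy.2
  have h4 : 0 ≤ (((w + 1 : ℕ):ℝ) - η) := by
    push_cast; have : (0:ℝ) ≤ w := by positivity
    linarith
  gcongr

lemma Ctx.step (hc : Ctx f ξ K) {j : ℕ} (hu : Scl ξ (Nn f) j 1 (deriv ξ)) :
    BigW (Nn f) (j + 1) (Uj ξ j) := by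
  have hN := hc.goodN
  refine BigW.of_small hN fun η hη hη1 => ?_
  obtain ⟨C, hC, hR⟩ := BigW.unif hc (hc.big_R hu) hη hη1
  obtain ⟨C', hC', hg⟩ := ((hc.big_g 1) η hη).exists_nonneg
  replace hg := hg.bound
  have hK := hc.fd.hK
  rcases j with _ | j
  · -- `j = 0`
    apply IsBigO.of_bound (K * C + K * C')
    filter_upwards [hR, hg, Ioo_ev, hN.pos] with x hRx hgx hx hp
    simp only [Function.iterate_one] at hgx
    rw [Real.norm_of_nonneg (supA_nonneg hc.flat.deriv.cont hx.1.le),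
      Real.norm_of_nonneg (by positivity)] at hgx
    rw [Real.norm_eq_abs, Real.norm_of_nonneg (by positivity)]
    have hz : ∀ p, 0 ≤ p → p ≤ x → f p = p → |derivWithin ξ (Icc 0 1) p| ≤
        K * C' * Nn f x ^ (((0 + 1 : ℕ):ℝ) - η) := by
      intro p hp0 hpx hfp
      have h1 := hc.deriv_zero ⟨hp0, hpx.trans hx.2.le⟩ hfp
      have h2 := le_supA hc.flat.deriv.cont hp0 hpx
      calc _ ≤ _ := h1
        _ ≤ K * (C' * Nn f x ^ (((0 + 1 : ℕ):ℝ) - η)) := by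
          gcongr; simpa using h2.trans hgx
        _ = _ := by ring
    by_cases hξx : ξ x = 0
    · have h1 := hz x hx.1.le le_rfl (hc.fd.zero x (Ioo_subset_Icc_self hx) hξx)
      rw [← hc.U0_eq hx] at h1
      refine h1.trans ?_
      gcongr
      exact le_add_of_nonneg_left (by positivity)
    · obtain ⟨s, ψ, hs, hψ0, hψ, hanti, hnn, hder, hf⟩ := hc.fd.orb x hx hξx
      obtain ⟨p, hp0, hpx, hlim, hfp⟩ := hc.orbit_limit hx hψ hanti hnn hf
      have hob := hc.orbit_bound 0 hx (B := K * C * Nn f x ^ (((0 + 1 : ℕ):ℝ) - η))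
        (fun y hy => by
          have := hRx y hy
          rw [mul_assoc]; gcongr) hψ hanti hf 0 le_rfl
      simp only [zero_add, hψ0] at hob
      have hl : Tendsto (fun k : ℕ => Uj ξ 0 (ψ k)) atTop (𝓝 (derivWithin ξ (Icc 0 1) p)) := by
        have h1 : ContinuousWithinAt (derivWithin ξ (Icc 0 1)) (Icc 0 1) p :=
          (xi_deriv_bdd hc.xi1).1 p ⟨hp0, hpx.trans hx.2.le⟩
        have h2 : Tendsto (fun k : ℕ => ψ k) atTop (𝓝[Icc 0 1] p) := by
          refine tendsto_nhdsWithin_iff.2 ⟨hlim.comp tendsto_natCast_atTop_atTop, ?_⟩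
          exact Eventually.of_forall fun k => ⟨hnn _, (hψ k (by positivity)).2.trans hx.2.le⟩
        refine (h1.tendsto.comp h2).congr fun k => ?_
        have := hψ k (by positivity)
        exact (hc.U0_eq ⟨this.1, this.2.trans_lt hx.2⟩).symm
      have h3 := le_of_tendsto (hl.sub_const (Uj ξ 0 x)).abs (Eventually.of_forall hob)
      have h4 := hz p hp0 hpx hfp
      rw [abs_sub_comm] at h3
      have h5 := abs_sub_abs_le_abs_sub (Uj ξ 0 x) (derivWithin ξ (Icc 0 1) p)
      simp only [zero_add] at *
      linarith
  · -- `j + 1`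
    apply IsBigO.of_bound (K * C)
    filter_upwards [hR, Ioo_ev, hN.pos] with x hRx hx hp
    rw [Real.norm_eq_abs, Real.norm_of_nonneg (by positivity)]
    have e1 : ∀ y, Uj ξ (j + 1) y = ξ y * deriv (Uj ξ j) y := fun y => by
      unfold Uj; rw [Function.iterate_succ_apply']; rfl
    by_cases hξx : ξ x = 0
    · rw [e1, hξx, zero_mul, abs_zero]; positivity
    · obtain ⟨s, ψ, hs, hψ0, hψ, hanti, hnn, hder, hf⟩ := hc.fd.orb x hx hξx
      obtain ⟨p, hp0, hpx, hlim, hfp⟩ := hc.orbit_limit hx hψ hanti hnn hf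
      have hob := hc.orbit_bound (j + 1) hx
        (B := K * C * Nn f x ^ (((j + 1 + 1 : ℕ):ℝ) - η))
        (fun y hy => by
          have := hRx y hy
          rw [mul_assoc]; gcongr) hψ hanti hf
      have hψI : ∀ τ, 0 ≤ τ → ψ τ ∈ Ioo (0:ℝ) 1 := fun τ hτ =>
        ⟨(hψ τ hτ).1, (hψ τ hτ).2.trans_lt hx.2⟩
      have hWl : ∃ c, Tendsto (fun τ => Uj ξ j (ψ τ)) atTop (𝓝 c) := by
        rcases hp0.eq_or_lt with rfl | hp0
        · refine ⟨0, ?_⟩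
          have h1 : Tendsto ψ atTop (𝓝[>] 0) := by
            refine tendsto_nhdsWithin_iff.2 ⟨hlim, ?_⟩
            filter_upwards [eventually_ge_atTop 0] with τ hτ using (hψ τ hτ).1
          have h2 : Tendsto (Uj ξ j) (𝓝[>] 0) (𝓝 0) := by
            have h3 := hu.last (1/2) (by norm_num)
            refine h3.trans_tendsto ?_
            have hpos : (0:ℝ) < ((1 + j : ℕ):ℝ) - 1/2 := by
              push_cast; have : (0:ℝ) ≤ j := by positivity
              linarith
            have := hN.lim.rpow_const (p := ((1 + j : ℕ):ℝ) - 1/2) (Or.inr hpos.le)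
            rwa [Real.zero_rpow hpos.ne'] at this
          exact h2.comp h1
        · refine ⟨_, Tendsto.comp (ContinuousAt.tendsto ?_) hlim⟩
          exact (smooth_diffAt (hc.U_smooth j) ⟨hp0, hpx.trans_lt hx.2⟩).continuousAt
      obtain ⟨c, hcl⟩ := hWl
      have := deriv_bound (u := fun τ => Uj ξ (j + 1) (ψ τ)) hs (fun τ hτ => ?_) hob hcl
      · simpa [hψ0] using this
      · have h1 := (smooth_diffAt (hc.U_smooth j) (hψI τ hτ)).hasDerivAt.comp τ (hder τ)
        refine h1.congr_deriv ?_
        rw [e1]; ring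

lemma Ctx.all (hc : Ctx f ξ K) (j : ℕ) : Scl ξ (Nn f) j 1 (deriv ξ) := by
  induction j with
  | zero => exact smooth_deriv hc.xis
  | succ j ih =>
    refine ih.succ_of hc.xis ?_
    have := hc.step ih
    rwa [add_comm] at this
end Step
end Main

/-- Let `0 ∈ ∂ ⊆ {0,1}` and let `f ∈ Diff*_∂[0,1]` be the time-1 map of the flow of a
vector field `ξ`, `C¹` on `[0,1]` and `C^∞` on `(0,1)`. Then for every `n ≥ 1` and
`η > 0`, `ξ(x)^{n−1} Dⁿξ(x) = O(‖f − id‖_{0,[0,x]}^{n−η})` as `x → 0` in `(0,1)`. -/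
theorem szekeres_field_derivative_estimates (D : Set ℝ) (hD : D ⊆ ({0, 1} : Set ℝ))
    (h0 : (0 : ℝ) ∈ D) (f ξ : ℝ → ℝ) (φ : ℝ → ℝ → ℝ)
    (hf : DiffStar D f)
    (hξ1 : ContDiffOn ℝ 1 ξ (Icc (0 : ℝ) 1))
    (hξs : ContDiffOn ℝ (⊤ : ℕ∞) ξ (Ioo (0 : ℝ) 1))
    (hflow : IsFlowOn ξ φ 0 1) (htime1 : ∀ x ∈ Icc (0 : ℝ) 1, φ 1 x = f x)
    (n : ℕ) (hn : 1 ≤ n) (η : ℝ) (hη : 0 < η) :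
    ∃ C > (0 : ℝ), ∃ δ > (0 : ℝ), ∀ x ∈ Ioo (0 : ℝ) 1, x < δ →
      |ξ x ^ (n - 1) * iteratedDeriv n ξ x| ≤
        C * (⨆ y : Icc (0 : ℝ) x, |f y.1 - y.1|) ^ ((n : ℝ) - η) := by
  obtain ⟨⟨hfs, hf0, hf1, hfpos, hfm⟩, hcase⟩ := hf
  have hfd : Differentiable ℝ f := hfs.differentiable (by simp)
  obtain ⟨K, hfl⟩ := flowData hfd hf0 hξ1 hflow htime1
  rcases hcase with hid | hiti
  · -- `f = id`
    refine ⟨1, one_pos, 1, one_pos, fun x hx _ => ?_⟩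
    have hξ0 : ∀ y ∈ Ioo (0:ℝ) 1, ξ y = 0 := fun y hy => by
      have := hfl.le y (Ioo_subset_Icc_self hy)
      simpa [hid y (Ioo_subset_Icc_self hy)] using this
    have he : ξ =ᶠ[nhds x] fun _ => (0:ℝ) := by
      filter_upwards [isOpen_Ioo.mem_nhds hx] with y hy using hξ0 y hy
    have h1 : iteratedDeriv n ξ x = 0 := by
      rw [he.iteratedDeriv_eq]; simp
    rw [h1, mul_zero, abs_zero, one_mul]
    exact Real.rpow_nonneg (Real.iSup_nonneg fun _ => abs_nonneg _) _
  · have h0I : (0:ℝ) ∈ Icc (0:ℝ) 1 := by simp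
    have hflat : Flat (fun x => f x - x) := by
      refine ⟨hfs.sub contDiff_id, fun k => ?_⟩
      rcases k with _ | k
      · simp [hf0]
      · exact ((hiti 0 h0I).2 h0).2 _ (by omega)
    have hmono : StrictMonoOn f (Icc 0 1) := by
      apply strictMonoOn_of_deriv_pos (convex_Icc 0 1) hfs.continuous.continuousOn
      intro x hx
      exact hfpos x (interior_subset hx)
    have hc : Ctx f ξ K := by
      refine ⟨hfl, hfs, hfpos, fun x hx => ⟨?_, ?_⟩, hflat, hξ1, hξs, fun x hx => ?_⟩
      · have := hmono h0I (Ioo_subset_Icc_self hx) hx.1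
        rwa [hf0] at this
      · have := hmono (Ioo_subset_Icc_self hx) (by simp) hx.2
        rwa [hf1] at this
      · refine lt_of_le_of_ne (supA_nonneg hflat.cont hx.le) fun h => ?_
        have hz : ∀ y, 0 ≤ y → y ≤ x → f y - y = 0 := fun y h1 h2 => by
          have := le_supA hflat.cont h1 h2
          rw [← h] at this
          exact abs_nonpos_iff.1 this
        have hm : 0 < min x 1 := lt_min hx one_pos
        have hm1 : min x 1 ≤ 1 := min_le_right _ _
        have hmx : min x 1 ≤ x := min_le_left _ _
        have hpD : min x 1 / 2 ∈ D := by
          refine (hiti _ ⟨by linarith, by linarith⟩).1 ⟨?_, fun k _ => ?_⟩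
          · have := hz (min x 1 / 2) (by linarith) (by linarith)
            linarith
          · have he : (fun x => f x - x) =ᶠ[nhds (min x 1 / 2)] fun _ => (0:ℝ) := by
              filter_upwards [isOpen_Ioo.mem_nhds
                (show min x 1 / 2 ∈ Ioo 0 x from ⟨by linarith, by linarith⟩)] with y hy
              exact hz y hy.1.le hy.2.le
            rw [he.iteratedDeriv_eq]; simp
        rcases hD hpD with h | h
        · linarith
        · have h : min x 1 / 2 = 1 := h
          linarith
    obtain ⟨m, rfl⟩ : ∃ m, n = m + 1 := ⟨n - 1, by omega⟩
    have hb := (Scl.final hc.goodN hξs hc.all m 1).2.1 η hη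
    obtain ⟨C, hC, hb⟩ := hb.exists_pos
    have hb := hb.bound
    rw [eventually_nhdsWithin_iff, Metric.eventually_nhds_iff] at hb
    obtain ⟨δ, hδ, hb⟩ := hb
    refine ⟨C, hC, δ, hδ, fun x hx hxδ => ?_⟩
    have h1 := hb (y := x) (by rwa [Real.dist_eq, sub_zero, abs_of_pos hx.1]) hx.1
    have h2 : 0 ≤ Nn f x := supA_nonneg hflat.cont hx.1.le
    rw [Real.norm_eq_abs, Real.norm_of_nonneg (by positivity)] at h1
    exact h1
end

section
/- Let f be an orientation-preserving C^∞ diffeomorphism of [0,1] which is infinitely tangent to the identity at 0. Then for all n ∈ ℕ and all η > 0, both ‖log Df‖_{n,[0,x]} and ‖log Df^{−1}‖_{n,[0,x]} are O(‖f − id‖_{0,[0,x]}^{1−η}) as x → 0. -/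
set_option autoImplicit false

open Set

/-- `finv` is a two-sided inverse of `f` on the set `s`. -/
def IsInverseOn (finv f : ℝ → ℝ) (s : Set ℝ) : Prop :=
  (∀ x ∈ s, finv (f x) = x) ∧ ∀ x ∈ s, f (finv x) = x


/-- Running sup norm on `[0,x]`. -/
noncomputable def supN (u : ℝ → ℝ) (x : ℝ) : ℝ := ⨆ z : Icc (0 : ℝ) x, |u z.1|

/-- `φ k` is the `k`-th derivative of `φ 0` along `[0,1]`. -/
def DerivChain (φ : ℕ → ℝ → ℝ) : Prop :=
  ∀ k, ∀ z ∈ Icc (0 : ℝ) 1, HasDerivAt (φ k) (φ (k + 1) z) z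

/-- Decay faster than any power at `0`. -/
def Fast (u : ℝ → ℝ) : Prop :=
  ∀ N : ℕ, ∃ C : ℝ, 0 ≤ C ∧ ∀ z ∈ Icc (0 : ℝ) 1, |u z| ≤ C * z ^ N

lemma DerivChain.shift {φ : ℕ → ℝ → ℝ} (h : DerivChain φ) (j : ℕ) : DerivChain (fun k => φ (k + j)) := by
  intro k z hz
  have := h (k + j) z hz
  simpa [add_right_comm] using this

lemma DerivChain.cont {φ : ℕ → ℝ → ℝ} (h : DerivChain φ) (k : ℕ) : ContinuousOn (φ k) (Icc 0 1) :=
  fun z hz => (h k z hz).continuousAt.continuousWithinAt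

lemma supN_nonneg (u : ℝ → ℝ) (x : ℝ) : 0 ≤ supN u x :=
  Real.iSup_nonneg fun _ => abs_nonneg _

lemma bdd_of_cont {u : ℝ → ℝ} (hu : ContinuousOn u (Icc 0 1)) :
    ∃ K : ℝ, 0 < K ∧ ∀ z ∈ Icc (0 : ℝ) 1, |u z| ≤ K := by
  obtain ⟨K, hK⟩ := isCompact_Icc.exists_bound_of_continuousOn hu
  refine ⟨max K 1, by positivity, fun z hz => ?_⟩
  exact (hK z hz).trans (le_max_left _ _)

lemma le_supN {u : ℝ → ℝ} (hu : ContinuousOn u (Icc 0 1)) {x : ℝ} (hx : x ≤ 1) {z : ℝ}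
    (hz : z ∈ Icc (0 : ℝ) x) : |u z| ≤ supN u x := by
  obtain ⟨K, _, hK⟩ := bdd_of_cont hu
  have hb : BddAbove (range fun z : Icc (0 : ℝ) x => |u z.1|) := by
    refine ⟨K, ?_⟩
    rintro _ ⟨w, rfl⟩
    exact hK _ ⟨w.2.1, w.2.2.trans hx⟩
  exact le_ciSup hb ⟨z, hz⟩

lemma supN_le {u : ℝ → ℝ} {x A : ℝ} (hx : 0 ≤ x) (h : ∀ z ∈ Icc (0 : ℝ) x, |u z| ≤ A) :
    supN u x ≤ A := by
  have : Nonempty (Icc (0 : ℝ) x) := ⟨⟨0, le_rfl, hx⟩⟩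
  exact ciSup_le fun z => h z.1 z.2

lemma supN_bdd {u : ℝ → ℝ} (hu : ContinuousOn u (Icc 0 1)) :
    ∃ K : ℝ, 0 < K ∧ ∀ x ∈ Icc (0 : ℝ) 1, supN u x ≤ K := by
  obtain ⟨K, h0, hK⟩ := bdd_of_cont hu
  exact ⟨K, h0, fun x hx => supN_le hx.1 fun z hz => hK z ⟨hz.1, hz.2.trans hx.2⟩⟩

/-- Comparison of powers on bounded ranges. -/
lemma rpow_compare {s K p q : ℝ} (hs : 0 ≤ s) (hK : s ≤ K) (hp : 0 < p) (hpq : q ≤ p) :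
    s ^ p ≤ K ^ (p - q) * s ^ q := by
  rcases hs.eq_or_lt with h | h
  · subst h
    rw [Real.zero_rpow hp.ne']
    exact mul_nonneg (Real.rpow_nonneg hK _) (Real.rpow_nonneg le_rfl _)
  · have : s ^ p = s ^ (p - q) * s ^ q := by
      rw [← Real.rpow_add h]; congr 1; ring
    rw [this]
    have := Real.rpow_le_rpow hs hK (sub_nonneg.2 hpq)
    have := Real.rpow_nonneg hs q
    gcongr

/-- Landau inequality with vanishing derivative at the left end, one sign. -/
lemma landau_aux_s18 {a b c : ℝ → ℝ} {x A B : ℝ}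
    (ha : ∀ z ∈ Icc (0 : ℝ) x, HasDerivAt a (b z) z)
    (hb : ∀ z ∈ Icc (0 : ℝ) x, HasDerivAt b (c z) z)
    (hA : ∀ z ∈ Icc (0 : ℝ) x, |a z| ≤ A) (hB : ∀ z ∈ Icc (0 : ℝ) x, |c z| ≤ B)
    (hb0 : b 0 = 0) {y : ℝ} (hy : y ∈ Icc (0 : ℝ) x) (hd : 0 < b y) : b y ^ 2 ≤ 4 * A * B := by
  have lip : ∀ t ∈ Icc (0 : ℝ) x, t ≤ y → b y - b t ≤ B * (y - t) := by
    intro t ht hty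
    have := (convex_Icc (0 : ℝ) x).norm_image_sub_le_of_norm_hasDerivWithin_le
      (f := b) (f' := c) (C := B) (fun z hz => (hb z hz).hasDerivWithinAt)
      (fun z hz => hB z hz) ht hy
    rw [Real.norm_eq_abs, Real.norm_eq_abs, abs_of_nonneg (sub_nonneg.2 hty)] at this
    exact (le_abs_self _).trans this
  have h0 : (0 : ℝ) ∈ Icc (0 : ℝ) x := ⟨le_rfl, hy.1.trans hy.2⟩
  have hBn : 0 ≤ B := (abs_nonneg _).trans (hB 0 h0)
  have h1 := lip 0 h0 hy.1
  rw [hb0] at h1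
  have hBpos : 0 < B := by
    rcases hBn.eq_or_lt with h | h
    · rw [← h] at h1; linarith
    · exact h
  set d := b y with hdd
  have hh : d / B ≤ y := by rw [div_le_iff₀ hBpos]; linarith
  have hh0 : 0 < d / B := by positivity
  have ht0 : y - d / B ∈ Icc (0 : ℝ) x := ⟨by linarith, by linarith [hy.2]⟩
  have mono : MonotoneOn (fun t => a t - d * t - B / 2 * (t - y) ^ 2) (Icc 0 y) := by
    have hder : ∀ t ∈ Icc (0 : ℝ) y, HasDerivAt (fun t => a t - d * t - B / 2 * (t - y) ^ 2)
        (b t - d + B * (y - t)) t := by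
      intro t ht
      have h2 := ((ha t ⟨ht.1, ht.2.trans hy.2⟩).sub ((hasDerivAt_id t).const_mul d)).sub
        ((((hasDerivAt_id t).sub_const y).pow 2).const_mul (B / 2))
      refine h2.congr_deriv ?_
      simp
      ring
    apply monotoneOn_of_deriv_nonneg (convex_Icc 0 y)
    · exact fun t ht => (hder t ht).continuousAt.continuousWithinAt
    · intro t ht
      exact (hder t (interior_subset ht)).differentiableAt.differentiableWithinAt
    · intro t ht
      have ht' := interior_subset ht
      rw [(hder t ht').deriv]
      have := lip t ⟨ht'.1, ht'.2.trans hy.2⟩ ht'.2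
      linarith
  have h3 := mono (⟨by linarith, by linarith⟩ : y - d / B ∈ Icc 0 y) ⟨hy.1, le_rfl⟩ (by linarith)
  simp only at h3
  have e1 := (abs_le.1 (hA _ ht0)).1
  have e2 := (abs_le.1 (hA _ hy)).2
  have e3 : d * (d / B) - B / 2 * (d / B) ^ 2 = d ^ 2 / (2 * B) := by field_simp; ring
  have e4 : d ^ 2 / (2 * B) ≤ 2 * A := by
    rw [← e3]
    have : (y - d / B - y) ^ 2 = (d / B) ^ 2 := by ring
    rw [this] at h3
    nlinarith
  rw [div_le_iff₀ (by positivity)] at e4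
  linarith

lemma landau_s18 {a b c : ℝ → ℝ} {x A B : ℝ}
    (ha : ∀ z ∈ Icc (0 : ℝ) x, HasDerivAt a (b z) z)
    (hb : ∀ z ∈ Icc (0 : ℝ) x, HasDerivAt b (c z) z)
    (hA : ∀ z ∈ Icc (0 : ℝ) x, |a z| ≤ A) (hB : ∀ z ∈ Icc (0 : ℝ) x, |c z| ≤ B)
    (hb0 : b 0 = 0) {y : ℝ} (hy : y ∈ Icc (0 : ℝ) x) : b y ^ 2 ≤ 4 * A * B := by
  rcases lt_trichotomy (b y) 0 with h | h | h
  · have := landau_aux_s18 (a := fun z => -a z) (b := fun z => -b z) (c := fun z => -c z)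
      (fun z hz => (ha z hz).neg) (fun z hz => (hb z hz).neg)
      (A := A) (B := B) (by simpa using hA) (by simpa using hB) (by simpa using hb0) hy (by linarith)
    simpa using this
  · rw [h]
    have := (abs_nonneg _).trans (hA y hy)
    have := (abs_nonneg _).trans (hB y hy)
    simp only [ne_eq, OfNat.ofNat_ne_zero, not_false_eq_true, zero_pow]
    positivity
  · exact landau_aux_s18 ha hb hA hB hb0 hy h

lemma supN_sq {φ : ℕ → ℝ → ℝ} (h : DerivChain φ) (h0 : φ 1 0 = 0) {x : ℝ} (hx : x ∈ Icc (0 : ℝ) 1) :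
    supN (φ 1) x ^ 2 ≤ 4 * supN (φ 0) x * supN (φ 2) x := by
  have hs : ∀ z ∈ Icc (0 : ℝ) x, z ∈ Icc (0 : ℝ) 1 := fun z hz => ⟨hz.1, hz.2.trans hx.2⟩
  have hn : 0 ≤ 4 * supN (φ 0) x * supN (φ 2) x := by
    have := supN_nonneg (φ 0) x
    have := supN_nonneg (φ 2) x
    positivity
  have := supN_le (u := φ 1) (A := √(4 * supN (φ 0) x * supN (φ 2) x)) hx.1 (by
    intro y hy
    apply Real.abs_le_sqrt
    exact landau_s18 (fun z hz => h 0 z (hs z hz)) (fun z hz => h 1 z (hs z hz))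
      (fun z hz => le_supN (h.cont 0) hx.2 hz) (fun z hz => le_supN (h.cont 2) hx.2 hz) h0 hy)
  calc supN (φ 1) x ^ 2 ≤ √(4 * supN (φ 0) x * supN (φ 2) x) ^ 2 :=
        pow_le_pow_left₀ (supN_nonneg _ _) this 2
    _ = _ := Real.sq_sqrt hn

lemma interp_one (k : ℕ) : ∀ φ : ℕ → ℝ → ℝ, DerivChain φ → (∀ j, φ (j + 1) 0 = 0) →
    ∃ C : ℝ, 0 < C ∧ ∀ x ∈ Icc (0 : ℝ) 1,
      supN (φ 1) x ≤ C * supN (φ 0) x ^ ((k : ℝ) / (k + 1)) := by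
  induction k with
  | zero =>
    intro φ h h0
    obtain ⟨K, hK, hb⟩ := supN_bdd (h.cont 1)
    exact ⟨K, hK, fun x hx => by simpa using hb x hx⟩
  | succ k ih =>
    intro φ h h0
    obtain ⟨C, hC, hb⟩ := ih (fun k => φ (k + 1)) (h.shift 1) (fun j => h0 (j + 1))
    set a : ℝ := (k : ℝ) / (k + 1) with ha
    have hk : (0 : ℝ) < k + 1 := by positivity
    have hbe : ((k + 1 : ℕ) : ℝ) / ((k + 1 : ℕ) + 1) = (2 - a)⁻¹ := by
      have h2 : 2 - a = (k + 2) / (k + 1) := by rw [ha]; field_simp; ring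
      rw [h2, inv_div]; push_cast; congr 1; ring
    have ha2 : 0 < 2 - a := by
      have : a < 1 := by rw [ha, div_lt_one hk]; linarith
      linarith
    rw [hbe]
    refine ⟨(4 * C) ^ (2 - a)⁻¹, by positivity, fun x hx => ?_⟩
    have hP := supN_nonneg (φ 0) x
    rcases (supN_nonneg (φ 1) x).eq_or_lt with hz | hp
    · rw [← hz]; positivity
    have h1 := supN_sq h (h0 0) hx
    have h2 : supN (φ 2) x ≤ C * supN (φ 1) x ^ a := hb x hx
    have h3 : supN (φ 1) x ^ (2 - a) ≤ 4 * C * supN (φ 0) x := by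
      rw [Real.rpow_sub hp, div_le_iff₀ (by positivity)]
      have : supN (φ 1) x ^ (2 : ℝ) = supN (φ 1) x ^ 2 := by norm_cast
      rw [this]
      calc _ ≤ _ := h1
        _ ≤ 4 * supN (φ 0) x * (C * supN (φ 1) x ^ a) := by gcongr
        _ = _ := by ring
    have h4 := Real.rpow_le_rpow (by positivity) h3 (inv_pos.2 ha2).le
    rw [Real.rpow_rpow_inv hp.le ha2.ne', Real.mul_rpow (by positivity) hP] at h4
    exact h4

lemma interp_one' {φ : ℕ → ℝ → ℝ} (h : DerivChain φ) (h0 : ∀ j, φ (j + 1) 0 = 0) {η : ℝ}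
    (hη : 0 < η) :
    ∃ C : ℝ, 0 < C ∧ ∀ x ∈ Icc (0 : ℝ) 1, supN (φ 1) x ≤ C * supN (φ 0) x ^ (1 - η) := by
  obtain ⟨k, hk⟩ := exists_nat_gt (1 / η)
  obtain ⟨C, hC, hb⟩ := interp_one k φ h h0
  obtain ⟨K, hK, hbK⟩ := supN_bdd (h.cont 0)
  have hk0 : (0 : ℝ) < k := lt_trans (by positivity) hk
  have hle : 1 - η ≤ (k : ℝ) / (k + 1) := by
    rw [le_div_iff₀ (by positivity)]
    rw [div_lt_iff₀ hη] at hk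
    nlinarith
  refine ⟨C * K ^ ((k : ℝ) / (k + 1) - (1 - η)), by positivity, fun x hx => ?_⟩
  have := rpow_compare (supN_nonneg (φ 0) x) (hbK x hx) (p := (k : ℝ) / (k + 1)) (by positivity) hle
  calc _ ≤ _ := hb x hx
    _ ≤ _ := by rw [mul_assoc]; gcongr

/-- Composition of power bounds. -/
lemma bound_comp {X Y Z : ℝ → ℝ} {η K : ℝ} (hη : 0 < η) (hη1 : η < 1)
    (hY : ∀ x, 0 ≤ Y x) (hZ : ∀ x, 0 ≤ Z x)
    (hK : 0 < K) (hZK : ∀ x ∈ Icc (0 : ℝ) 1, Z x ≤ K)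
    (h1 : ∃ C : ℝ, 0 < C ∧ ∀ x ∈ Icc (0 : ℝ) 1, X x ≤ C * Y x ^ (1 - η / 2))
    (h2 : ∃ C : ℝ, 0 < C ∧ ∀ x ∈ Icc (0 : ℝ) 1, Y x ≤ C * Z x ^ (1 - η / 2)) :
    ∃ C : ℝ, 0 < C ∧ ∀ x ∈ Icc (0 : ℝ) 1, X x ≤ C * Z x ^ (1 - η) := by
  obtain ⟨C, hC, h1⟩ := h1
  obtain ⟨D, hD, h2⟩ := h2
  have hp : 0 < 1 - η / 2 := by linarith
  refine ⟨C * (D ^ (1 - η / 2) * K ^ ((1 - η / 2) * (1 - η / 2) - (1 - η))), by positivity,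
    fun x hx => ?_⟩
  have h3 := rpow_compare (hZ x) (hZK x hx) (p := (1 - η / 2) * (1 - η / 2)) (q := 1 - η)
    (by positivity) (by nlinarith)
  have hZx := hZ x
  calc X x ≤ C * Y x ^ (1 - η / 2) := h1 x hx
    _ ≤ C * (D * Z x ^ (1 - η / 2)) ^ (1 - η / 2) := by
        gcongr
        · exact hY x
        · exact h2 x hx
    _ = C * (D ^ (1 - η / 2) * Z x ^ ((1 - η / 2) * (1 - η / 2))) := by
        rw [Real.mul_rpow hD.le (by positivity), ← Real.rpow_mul hZx]
    _ ≤ C * (D ^ (1 - η / 2) * (K ^ ((1 - η / 2) * (1 - η / 2) - (1 - η)) * Z x ^ (1 - η))) := by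
        gcongr
    _ = _ := by ring

lemma interp_s18 {φ : ℕ → ℝ → ℝ} (h : DerivChain φ) (h0 : ∀ j, φ (j + 1) 0 = 0) (n : ℕ) :
    ∀ η : ℝ, 0 < η → η < 1 →
    ∃ C : ℝ, 0 < C ∧ ∀ x ∈ Icc (0 : ℝ) 1, supN (φ n) x ≤ C * supN (φ 0) x ^ (1 - η) := by
  obtain ⟨K, hK, hbK⟩ := supN_bdd (h.cont 0)
  induction n with
  | zero =>
    intro η hη hη1
    refine ⟨K ^ (1 - (1 - η)), by positivity, fun x hx => ?_⟩
    have := rpow_compare (supN_nonneg (φ 0) x) (hbK x hx) (p := 1) one_pos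
      (by linarith : 1 - η ≤ 1)
    simpa using this
  | succ n ih =>
    intro η hη hη1
    refine bound_comp hη hη1 (Y := supN (φ n)) (supN_nonneg _) (supN_nonneg _) hK hbK ?_
      (ih (η / 2) (by linarith) (by linarith))
    have := interp_one' (h.shift n) (fun j => by
      have := h0 (j + n); simpa [add_right_comm] using this) (half_pos hη)
    simpa [add_comm] using this

/-- Vanishing of all derivatives gives fast decay. -/
lemma fast_of_flat (N : ℕ) : ∀ φ : ℕ → ℝ → ℝ, DerivChain φ → (∀ j, φ j 0 = 0) →
    ∃ C : ℝ, 0 ≤ C ∧ ∀ z ∈ Icc (0 : ℝ) 1, |φ 0 z| ≤ C * z ^ N := by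
  induction N with
  | zero =>
    intro φ h h0
    obtain ⟨K, hK, hb⟩ := bdd_of_cont (h.cont 0)
    exact ⟨K, hK.le, by simpa using hb⟩
  | succ N ih =>
    intro φ h h0
    obtain ⟨C, hC, hb⟩ := ih (fun k => φ (k + 1)) (h.shift 1) (fun j => h0 (j + 1))
    refine ⟨C, hC, fun z hz => ?_⟩
    have := (convex_Icc (0 : ℝ) z).norm_image_sub_le_of_norm_hasDerivWithin_le
      (f := φ 0) (f' := φ 1) (C := C * z ^ N)
      (fun w hw => (h 0 w ⟨hw.1, hw.2.trans hz.2⟩).hasDerivWithinAt)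
      (fun w hw => (hb w ⟨hw.1, hw.2.trans hz.2⟩).trans (by
        have := hw.1; have := hw.2; gcongr)) (x := 0) (y := z) ⟨le_rfl, hz.1⟩ ⟨hz.1, le_rfl⟩
    rw [h0 0, sub_zero, sub_zero, Real.norm_eq_abs, Real.norm_eq_abs, abs_of_nonneg hz.1] at this
    rw [pow_succ, ← mul_assoc]
    exact this

lemma Fast.zero {u : ℝ → ℝ} (h : Fast u) : u 0 = 0 := by
  obtain ⟨C, _, hb⟩ := h 1
  simpa using hb 0 ⟨le_rfl, zero_le_one⟩

lemma Fast.deriv_zero {u : ℝ → ℝ} {d : ℝ} (h : Fast u) (hd : HasDerivAt u d 0) : d = 0 := by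
  obtain ⟨C, hC, hb⟩ := h 2
  have h1 : HasDerivWithinAt u d (Icc 0 1) 0 := hd.hasDerivWithinAt
  have h2 : HasDerivWithinAt u 0 (Icc 0 1) 0 := by
    rw [hasDerivWithinAt_iff_isLittleO]
    have hO : (fun z : ℝ => u z - u 0 - (z - 0) • (0 : ℝ)) =O[nhdsWithin 0 (Icc 0 1)]
        fun z : ℝ => z ^ 2 := by
      apply Asymptotics.IsBigO.of_bound C
      filter_upwards [self_mem_nhdsWithin] with z hz
      have := hb z hz
      simpa [h.zero] using this
    refine hO.trans_isLittleO ?_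
    have : (fun z : ℝ => z ^ 2) =o[nhds 0] fun z : ℝ => z ^ 1 :=
      Asymptotics.isLittleO_pow_pow one_lt_two
    simpa using this.mono nhdsWithin_le_nhds
  exact (uniqueDiffOn_Icc zero_lt_one 0 ⟨le_rfl, zero_le_one⟩).eq_deriv _ h1 h2

lemma Fast.next {φ : ℕ → ℝ → ℝ} (h : DerivChain φ) (hF : Fast (φ 0)) : Fast (φ 1) := by
  have hd := hF.deriv_zero (h 0 0 ⟨le_rfl, zero_le_one⟩)
  obtain ⟨B, hB, hbB⟩ := bdd_of_cont (h.cont 2)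
  intro N
  obtain ⟨C, hC, hb⟩ := hF (2 * N)
  refine ⟨√(4 * C * B), by positivity, fun z hz => ?_⟩
  have := landau_s18 (a := φ 0) (b := φ 1) (c := φ 2) (x := z) (A := C * z ^ (2 * N)) (B := B)
    (fun w hw => h 0 w ⟨hw.1, hw.2.trans hz.2⟩) (fun w hw => h 1 w ⟨hw.1, hw.2.trans hz.2⟩)
    (fun w hw => (hb w ⟨hw.1, hw.2.trans hz.2⟩).trans (by
        have := hw.1; have := hw.2; gcongr))
    (fun w hw => hbB w ⟨hw.1, hw.2.trans hz.2⟩) hd (y := z) ⟨hz.1, le_rfl⟩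
  have hz0 := hz.1
  refine abs_le_of_sq_le_sq ?_ (by positivity)
  rw [mul_pow, Real.sq_sqrt (by positivity)]
  calc _ ≤ _ := this
    _ = _ := by ring

lemma Fast.all {φ : ℕ → ℝ → ℝ} (h : DerivChain φ) (hF : Fast (φ 0)) (k : ℕ) : Fast (φ k) := by
  induction k with
  | zero => exact hF
  | succ k ih =>
    have := Fast.next (h.shift k) (by simpa using ih)
    simpa [add_comm] using this

lemma chain_of_contDiffOn {u : ℝ → ℝ} (h : ∀ z ∈ Icc (0 : ℝ) 1, ContDiffAt ℝ (⊤ : ℕ∞) u z) :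
    DerivChain (fun k => iteratedDeriv k u) := by
  intro k z hz
  have h1 : DifferentiableAt ℝ (iteratedDeriv k u) z := by
    have h2 : ContDiffWithinAt ℝ (⊤ : ℕ∞) u univ z := (h z hz).contDiffWithinAt
    have h3 := h2.differentiableWithinAt_iteratedDerivWithin (m := k)
      (by exact_mod_cast WithTop.coe_lt_top k) (by simpa using uniqueDiffOn_univ)
    rwa [iteratedDerivWithin_univ, differentiableWithinAt_univ] at h3
  simp only [iteratedDeriv_succ]
  exact h1.hasDerivAt

lemma Fast.of_le {u v : ℝ → ℝ} {K : ℝ} (hK : 0 ≤ K) (hv : Fast v)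
    (h : ∀ z ∈ Icc (0 : ℝ) 1, |u z| ≤ K * |v z|) : Fast u := by
  intro N
  obtain ⟨C, hC, hb⟩ := hv N
  refine ⟨K * C, by positivity, fun z hz => (h z hz).trans ?_⟩
  rw [mul_assoc]
  have := hb z hz
  gcongr

lemma abs_log_le {t m : ℝ} (hm : 0 < m) (hm1 : m ≤ 1) (ht : m ≤ t) :
    |Real.log t| ≤ m⁻¹ * |t - 1| := by
  have ht0 : 0 < t := hm.trans_le ht
  have h1 := Real.log_le_sub_one_of_pos ht0
  have h2 := Real.one_sub_inv_le_log_of_pos ht0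
  have hmi : 1 ≤ m⁻¹ := (one_le_inv₀ hm).2 hm1
  rw [abs_le]
  constructor
  · have h3 : -(1 - t⁻¹) ≤ m⁻¹ * |t - 1| := by
      have : -(1 - t⁻¹) = t⁻¹ * (1 - t) := by field_simp; ring
      rw [this]
      have h5 : t⁻¹ ≤ m⁻¹ := inv_anti₀ hm ht
      have h4 : 1 - t ≤ |t - 1| := by rw [abs_sub_comm]; exact le_abs_self _
      calc t⁻¹ * (1 - t) ≤ t⁻¹ * |t - 1| := by gcongr
        _ ≤ _ := by gcongr
    linarith
  · have := le_abs_self (t - 1)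
    have := abs_nonneg (t - 1)
    nlinarith

lemma SmoothDiffeoI.deriv_lower {f : ℝ → ℝ} (hf : SmoothDiffeoI f) :
    ∃ m : ℝ, 0 < m ∧ m ≤ 1 ∧ ∀ z ∈ Icc (0 : ℝ) 1, m ≤ deriv f z := by
  obtain ⟨hs, _, _, hp, _⟩ := hf
  have hc : ContinuousOn (deriv f) (Icc 0 1) :=
    (hs.continuous_deriv (by simp)).continuousOn
  obtain ⟨w, hw, hmin⟩ := isCompact_Icc.exists_isMinOn (nonempty_Icc.2 zero_le_one) hc
  exact ⟨min (deriv f w) 1, lt_min (hp w hw) one_pos, min_le_right _ _,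
    fun z hz => (min_le_left _ _).trans (hmin hz)⟩

lemma main_aux {f F : ℝ → ℝ} (hf : SmoothDiffeoI f) (hF : SmoothDiffeoI F) (hITI : ITIat f 0)
    {K : ℝ} (hK : 0 < K) (hcmp : ∀ z ∈ Icc (0 : ℝ) 1, |F z - z| ≤ K * |f z - z|)
    (i : ℕ) {η : ℝ} (hη : 0 < η) (hη1 : η < 1) :
    ∃ C : ℝ, 0 < C ∧ ∀ x ∈ Icc (0 : ℝ) 1,
      supN (iteratedDeriv i (fun z => Real.log (deriv F z))) x ≤
        C * supN (fun z => f z - z) x ^ (1 - η) := by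
  obtain ⟨m, hm, hm1, hmF⟩ := hF.deriv_lower
  have cf : ContDiff ℝ (⊤ : ℕ∞) (fun z => f z - z) := hf.1.sub contDiff_id
  have cF : ContDiff ℝ (⊤ : ℕ∞) (fun z => F z - z) := hF.1.sub contDiff_id
  have chf := chain_of_contDiffOn (u := fun z => f z - z) (fun z _ => cf.contDiffAt)
  have chF := chain_of_contDiffOn (u := fun z => F z - z) (fun z _ => cF.contDiffAt)
  have cd : ContDiff ℝ (⊤ : ℕ∞) (deriv F) := by
    have := hF.1.iterate_deriv 1
    simpa using this
  have chL := chain_of_contDiffOn (u := fun z => Real.log (deriv F z))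
    (fun z hz => cd.contDiffAt.log (hF.2.2.2.1 z hz).ne')
  have d1 : ∀ z, iteratedDeriv 1 (fun z => F z - z) z = deriv F z - 1 := by
    intro z
    rw [iteratedDeriv_one]
    have := ((hF.1.differentiable (by simp) z).hasDerivAt.sub (hasDerivAt_id z)).deriv
    exact this
  have Ff : Fast (fun z => f z - z) := by
    intro N
    have := fast_of_flat N _ chf (by
      intro j
      rcases j with _ | j
      · simp [hITI.1]
      · exact hITI.2 _ (by omega))
    simpa using this
  have FF : Fast (fun z => F z - z) := Ff.of_le hK.le hcmp
  have FFa := Fast.all chF (by simpa using FF)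
  have hlog : ∀ z ∈ Icc (0 : ℝ) 1, |Real.log (deriv F z)| ≤
      m⁻¹ * |iteratedDeriv 1 (fun z => F z - z) z| := by
    intro z hz
    rw [d1]
    exact abs_log_le hm hm1 (hmF z hz)
  have FL : Fast (fun z => Real.log (deriv F z)) := (FFa 1).of_le (by positivity) hlog
  have FLa := Fast.all chL (by simpa using FL)
  obtain ⟨Q, hQ, hbQ⟩ := supN_bdd (chf.cont 0)
  simp only [iteratedDeriv_zero] at hbQ
  have hη4 : 0 < η / 2 := by linarith
  refine bound_comp hη hη1 (Y := supN (fun z => Real.log (deriv F z))) (supN_nonneg _)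
    (supN_nonneg _) hQ hbQ ?_ ?_
  · have := interp_s18 chL (fun j => (FLa (j + 1)).zero) i (η / 2) hη4 (by linarith)
    simpa using this
  · obtain ⟨C, hC, hb⟩ := interp_s18 chF (fun j => (FFa (j + 1)).zero) 1 (η / 2) hη4 (by linarith)
    refine ⟨m⁻¹ * (C * K ^ (1 - η / 2)), by positivity, fun x hx => ?_⟩
    have s1 : supN (fun z => Real.log (deriv F z)) x ≤
        m⁻¹ * supN (iteratedDeriv 1 (fun z => F z - z)) x := by
      apply supN_le hx.1
      intro z hz
      refine (hlog z ⟨hz.1, hz.2.trans hx.2⟩).trans ?_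
      have := le_supN (chF.cont 1) hx.2 hz
      gcongr
    have s2 : supN (fun z => F z - z) x ≤ K * supN (fun z => f z - z) x := by
      apply supN_le hx.1
      intro z hz
      refine (hcmp z ⟨hz.1, hz.2.trans hx.2⟩).trans ?_
      have := le_supN (u := fun z => f z - z) cf.continuous.continuousOn hx.2 hz
      gcongr
    have s3 := hb x hx
    simp only [iteratedDeriv_zero] at s3
    have hp : 0 ≤ 1 - η / 2 := by linarith
    calc _ ≤ _ := s1
      _ ≤ m⁻¹ * (C * supN (fun z => F z - z) x ^ (1 - η / 2)) := by gcongr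
      _ ≤ m⁻¹ * (C * (K * supN (fun z => f z - z) x) ^ (1 - η / 2)) := by
          have := supN_nonneg (fun z => F z - z) x
          gcongr
      _ = _ := by rw [Real.mul_rpow hK.le (supN_nonneg _ _)]; ring

lemma inv_cmp {f g : ℝ → ℝ} (hf : SmoothDiffeoI f) (hg : SmoothDiffeoI g)
    (hinv : IsInverseOn g f (Icc (0 : ℝ) 1)) :
    ∃ K : ℝ, 0 < K ∧ ∀ z ∈ Icc (0 : ℝ) 1, |g z - z| ≤ K * |f z - z| := by
  obtain ⟨m, hm, hm1, hmf⟩ := hf.deriv_lower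
  have hdiff : Differentiable ℝ f := hf.1.differentiable (by simp)
  have key : ∀ a ∈ Icc (0 : ℝ) 1, ∀ b ∈ Icc (0 : ℝ) 1, a ≤ b → m * (b - a) ≤ f b - f a := by
    intro a ha b hb hab
    exact (convex_Icc (0 : ℝ) 1).mul_sub_le_image_sub_of_le_deriv hdiff.continuous.continuousOn
      hdiff.differentiableOn (fun z hz => hmf z (interior_subset hz)) a ha b hb hab
  refine ⟨m⁻¹, by positivity, fun z hz => ?_⟩
  have hw := hg.2.2.2.2 hz
  have e := hinv.2 z hz
  rw [inv_mul_eq_div, le_div_iff₀ hm, mul_comm]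
  rcases le_total z (g z) with h | h
  · have := key z hz _ hw h
    rw [e] at this
    rw [abs_of_nonneg (sub_nonneg.2 h), abs_sub_comm]
    exact this.trans (le_abs_self _)
  · have := key _ hw z hz h
    rw [e] at this
    rw [abs_sub_comm, abs_of_nonneg (sub_nonneg.2 h)]
    exact this.trans (le_abs_self _)

lemma one_side {f F : ℝ → ℝ} (hf : SmoothDiffeoI f) (hF : SmoothDiffeoI F) (hITI : ITIat f 0)
    {K : ℝ} (hK : 0 < K) (hcmp : ∀ z ∈ Icc (0 : ℝ) 1, |F z - z| ≤ K * |f z - z|)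
    (n : ℕ) {η : ℝ} (hη : 0 < η) :
    ∃ C : ℝ, 0 < C ∧ ∀ x ∈ Icc (0 : ℝ) 1, ∀ i ≤ n, ∀ y ∈ Icc (0 : ℝ) x,
      |iteratedDeriv i (fun z => Real.log (deriv F z)) y| ≤
        C * supN (fun z => f z - z) x ^ (1 - η) := by
  have hη' : 0 < min η (1 / 2) := lt_min hη (by norm_num)
  have hη1 : min η (1 / 2) < 1 := (min_le_right _ _).trans_lt (by norm_num)
  have hle : min η (1 / 2) ≤ η := min_le_left _ _
  choose c hc hb using fun i => main_aux hf hF hITI hK hcmp i hη' hη1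
  have cf : ContDiff ℝ (⊤ : ℕ∞) (fun z => f z - z) := hf.1.sub contDiff_id
  obtain ⟨Q, hQ, hbQ⟩ := supN_bdd cf.continuous.continuousOn
  have cd : ContDiff ℝ (⊤ : ℕ∞) (deriv F) := by
    have := hF.1.iterate_deriv 1
    simpa using this
  have chL := chain_of_contDiffOn (u := fun z => Real.log (deriv F z))
    (fun z hz => cd.contDiffAt.log (hF.2.2.2.1 z hz).ne')
  have hS : 0 < ∑ j ∈ Finset.range (n + 1), c j :=
    Finset.sum_pos (fun j _ => hc j) ⟨0, by simp⟩
  refine ⟨(∑ j ∈ Finset.range (n + 1), c j) * Q ^ ((1 - min η (1 / 2)) - (1 - η)), by positivity,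
    fun x hx i hi y hy => ?_⟩
  have h1 := le_supN (chL.cont i) hx.2 hy
  have h2 := hb i x hx
  have h3 : c i ≤ ∑ j ∈ Finset.range (n + 1), c j :=
    Finset.single_le_sum (fun j _ => (hc j).le) (by simp; omega)
  have hs := supN_nonneg (fun z => f z - z) x
  have h4 := rpow_compare hs (hbQ x hx) (p := 1 - min η (1 / 2)) (q := 1 - η)
    (by linarith) (by linarith)
  calc _ ≤ _ := h1
    _ ≤ _ := h2
    _ ≤ (∑ j ∈ Finset.range (n + 1), c j) * supN (fun z => f z - z) x ^ (1 - min η (1 / 2)) := by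
        gcongr
    _ ≤ _ := by rw [mul_assoc]; gcongr

/-- Let `f` be an orientation-preserving `C^∞` diffeomorphism of `[0,1]` infinitely
tangent to the identity at `0`, with inverse `f⁻¹`. Then for all `n ∈ ℕ` and `η > 0`,
both `‖log Df‖_{n,[0,x]}` and `‖log Df⁻¹‖_{n,[0,x]}` are `O(‖f − id‖_{0,[0,x]}^{1−η})`
as `x → 0`. -/
theorem log_deriv_estimate (f finv : ℝ → ℝ)
    (hf : SmoothDiffeoI f) (hfinvdiff : SmoothDiffeoI finv)
    (hfinv : IsInverseOn finv f (Icc (0 : ℝ) 1))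
    (hITI : ITIat f 0)
    (n : ℕ) (η : ℝ) (hη : 0 < η) :
    ∃ C > (0 : ℝ), ∃ δ > (0 : ℝ), ∀ x ∈ Ioo (0 : ℝ) 1, x < δ →
      ∀ i ≤ n, ∀ y ∈ Icc (0 : ℝ) x,
        |iteratedDeriv i (fun z => Real.log (deriv f z)) y| ≤
            C * (⨆ z : Icc (0 : ℝ) x, |f z.1 - z.1|) ^ ((1 : ℝ) - η) ∧
        |iteratedDeriv i (fun z => Real.log (deriv finv z)) y| ≤
            C * (⨆ z : Icc (0 : ℝ) x, |f z.1 - z.1|) ^ ((1 : ℝ) - η) := by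
  obtain ⟨K, hK, hcmp⟩ := inv_cmp hf hfinvdiff hfinv
  obtain ⟨C, hC, h1⟩ := one_side hf hf hITI one_pos (fun z _ => by simp) n hη
  obtain ⟨D, hD, h2⟩ := one_side hf hfinvdiff hITI hK hcmp n hη
  refine ⟨C + D, by positivity, 1, one_pos, fun x hx _ i hi y hy => ?_⟩
  have hx' : x ∈ Icc (0 : ℝ) 1 := ⟨hx.1.le, hx.2.le⟩
  have hs := Real.rpow_nonneg (supN_nonneg (fun z => f z - z) x) (1 - η)
  constructor
  · refine (h1 x hx' i hi y hy).trans ?_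
    change _ ≤ (C + D) * supN (fun z => f z - z) x ^ (1 - η)
    nlinarith
  · refine (h2 x hx' i hi y hy).trans ?_
    change _ ≤ (C + D) * supN (fun z => f z - z) x ^ (1 - η)
    nlinarith
end
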